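/- arXiv:1312.3068 — 9 statements merged into one kernel-verified Lean document; each statement's English description precedes it below -/
import Mathlib

section
/- For every nontrivial connected graph G with m edges, rc(G) ≠ m − 1. -/
/-- An edge-colored graph is rainbow connected if every two vertices are
joined by a path no two of whose edges have the same color. -/
def IsRainbowConnected {V α : Type*} (G : SimpleGraph V) (c : Sym2 V → α) : Prop :=
  ∀ u w : V, ∃ p : G.Walk u w, p.IsPath ∧ (p.edges.map c).Nodup

/-- The rainbow connection number: the minimum number of colors in an
edge-coloring making the graph rainbow connected. -/
noncomputable def rc {V : Type*} (G : SimpleGraph V) : ℕ :=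
  sInf {k : ℕ | ∃ c : Sym2 V → Fin k, IsRainbowConnected G c}

/-- Color the edges of `F` injectively and give all other edges one further color. -/
theorem exists_isRainbowConnected_of_walk {V : Type*} [Finite V] (G F : SimpleGraph V)
    (h : ∀ u w : V, ∃ (p : G.Walk u w) (e : Sym2 V), ∀ f ∈ p.edges, f ∈ F.edgeSet ∨ f = e) :
    ∃ c : Sym2 V → Fin (F.edgeSet.ncard + 1), IsRainbowConnected G c := by
  classical
  have φ : F.edgeSet ≃ Fin F.edgeSet.ncard := Finite.equivFin F.edgeSet
  let c : Sym2 V → Fin (F.edgeSet.ncard + 1) := fun s =>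
    if hs : s ∈ F.edgeSet then (φ ⟨s, hs⟩).castSucc else Fin.last _
  have hinj : ∀ e ∈ F.edgeSet, ∀ f, c e = c f → e = f := by
    intro e he f hef
    by_cases hf : f ∈ F.edgeSet
    · simpa [c, he, hf] using hef
    · simp only [c, he, hf, dite_true, dite_false] at hef
      exact absurd hef (Fin.castSucc_lt_last _).ne
  refine ⟨c, fun u w => ?_⟩
  obtain ⟨p, e, hp⟩ := h u w
  refine ⟨p.bypass, p.bypass_isPath, ?_⟩
  refine List.Nodup.map_on ?_ p.bypass_isPath.isTrail.edges_nodup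
  intro f hf g hg hfg
  rcases hp f (p.edges_bypass_subset_edges hf) with h1 | h1
  · exact hinj f h1 g hfg
  rcases hp g (p.edges_bypass_subset_edges hg) with h2 | h2
  · exact (hinj g h2 f hfg.symm).symm
  · rw [h1, h2]

/-- Two vertices reachable in `F` from the two ends of an edge of `G` are joined by a walk of `G`
with at most one edge outside `F`. -/
theorem exists_walk_of_reachable_adj {V : Type*} {G F : SimpleGraph V} (hF : F ≤ G)
    {u x y w : V} (hux : F.Reachable u x) (hxy : G.Adj x y) (hyw : F.Reachable y w) :
    ∃ (p : G.Walk u w) (e : Sym2 V), ∀ f ∈ p.edges, f ∈ F.edgeSet ∨ f = e := by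
  obtain ⟨p⟩ := hux
  obtain ⟨q⟩ := hyw
  refine ⟨(p.mapLe hF).append (.cons hxy (q.mapLe hF)), s(x, y), fun f hf => ?_⟩
  simp only [SimpleGraph.Walk.edges_append, SimpleGraph.Walk.edges_cons, List.mem_append,
    List.mem_cons, SimpleGraph.Walk.edges_mapLe_eq_edges] at hf
  rcases hf with hf | hf | hf
  · exact .inl (p.edges_subset_edgeSet hf)
  · exact .inr hf
  · exact .inl (q.edges_subset_edgeSet hf)

theorem exists_isRainbowConnected_of_connected {V : Type*} [Finite V] {G : SimpleGraph V}
    (hconn : G.Connected) :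
    ∃ c : Sym2 V → Fin (G.edgeSet.ncard + 1), IsRainbowConnected G c := by
  refine exists_isRainbowConnected_of_walk G G fun u w => ?_
  obtain ⟨p⟩ := hconn u w
  exact ⟨p, s(u, u), fun f hf => .inl (p.edges_subset_edgeSet hf)⟩

/-- In a connected graph with a cycle, two colors can be saved. -/
theorem rc_add_two_le_of_not_isAcyclic {V : Type*} [Finite V] {G : SimpleGraph V}
    (hconn : G.Connected) (hG : ¬ G.IsAcyclic) : rc G + 2 ≤ G.edgeSet.ncard := by
  classical
  obtain ⟨a, C, hC⟩ : ∃ (a : V) (C : G.Walk a a), C.IsCycle := by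
    simpa [SimpleGraph.IsAcyclic] using hG
  have hlen := hC.three_le_length
  have hnd := hC.edges_nodup
  match C, hlen, hnd with
  | .cons (v := b) hab (.cons (v := c) hbc (.cons (v := d) hcd p)), _, hnd =>
    simp only [SimpleGraph.Walk.edges_cons, List.nodup_cons, List.mem_cons, not_or] at hnd
    obtain ⟨⟨hn1, hn2, hn3⟩, ⟨hn4, hn5⟩, hn6, -⟩ := hnd
    let S : Set (Sym2 V) := {s(a, b), s(b, c), s(c, d)}
    let F : SimpleGraph V := G.deleteEdges S
    have hF : F ≤ G := G.deleteEdges_le S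
    have hda : F.Reachable d a := by
      refine ⟨p.toDeleteEdges S fun e he heS => ?_⟩
      rcases heS with rfl | rfl | rfl
      exacts [hn3 he, hn5 he, hn6 he]
    have hcover : ∀ v, F.Reachable a v ∨ F.Reachable b v ∨ F.Reachable c v := by
      intro v
      refine (SimpleGraph.reachable_iff_reflTransGen a v).1 (hconn a v) |>.rec (.inl .rfl) ?_
      intro x y _ hxy ih
      by_cases hS : s(x, y) ∈ S
      · have hy : y = a ∨ y = b ∨ y = c ∨ y = d := by
          simp only [S, Set.mem_insert_iff, Set.mem_singleton_iff, Sym2.eq_iff] at hS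
          tauto
        rcases hy with rfl | rfl | rfl | rfl
        exacts [.inl .rfl, .inr (.inl .rfl), .inr (.inr .rfl), .inl hda.symm]
      · have hF' : F.Reachable x y :=
          SimpleGraph.Adj.reachable (SimpleGraph.deleteEdges_adj.2 ⟨hxy, hS⟩)
        exact ih.imp (·.trans hF') (Or.imp (·.trans hF') (·.trans hF'))
    have hcard : F.edgeSet.ncard + 3 = G.edgeSet.ncard := by
      have hS : S.ncard = 3 := Set.ncard_eq_three.2 ⟨_, _, _, hn1, hn2, hn4, rfl⟩
      have hSG : S ⊆ G.edgeSet := by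
        rintro e (rfl | rfl | rfl)
        exacts [hab, hbc, hcd]
      rw [← hS, SimpleGraph.edgeSet_deleteEdges]
      exact Set.ncard_sdiff_add_ncard_of_subset hSG
    have hrc : rc G ≤ F.edgeSet.ncard + 1 := by
      refine Nat.sInf_le (exists_isRainbowConnected_of_walk G F fun u w => ?_)
      have same {u w : V} (h : F.Reachable u w) :
          ∃ (p : G.Walk u w) (e : Sym2 V), ∀ f ∈ p.edges, f ∈ F.edgeSet ∨ f = e := by
        obtain ⟨q⟩ := h
        exact ⟨q.mapLe hF, s(u, u), fun f hf => .inl (q.edges_subset_edgeSet (by simpa using hf))⟩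
      rcases hcover u with hu | hu | hu <;> rcases hcover w with hw | hw | hw
      · exact same (hu.symm.trans hw)
      · exact exists_walk_of_reachable_adj hF hu.symm hab hw
      · exact exists_walk_of_reachable_adj hF (hu.symm.trans hda.symm) hcd.symm hw
      · exact exists_walk_of_reachable_adj hF hu.symm hab.symm hw
      · exact same (hu.symm.trans hw)
      · exact exists_walk_of_reachable_adj hF hu.symm hbc hw
      · exact exists_walk_of_reachable_adj hF hu.symm hcd (hda.trans hw)
      · exact exists_walk_of_reachable_adj hF hu.symm hbc.symm hw
      · exact same (hu.symm.trans hw)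
    omega

/-- A walk whose ends are separated by deleting an edge traverses that edge. -/
theorem mem_edges_of_not_reachable_deleteEdges {V : Type*} {G : SimpleGraph V} {u w : V}
    {e : Sym2 V} (h : ¬ (G.deleteEdges {e}).Reachable u w) (p : G.Walk u w) : e ∈ p.edges := by
  by_contra he
  exact h ⟨p.toDeleteEdge e he⟩

/-- Any two distinct edges of a forest have two ends separated by both of them. -/
theorem exists_not_reachable_deleteEdges_of_isAcyclic {V : Type*} {G : SimpleGraph V}
    (hG : G.IsAcyclic) {e f : Sym2 V} (he : e ∈ G.edgeSet) (hf : f ∈ G.edgeSet) (hef : e ≠ f) :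
    ∃ u w, ¬ (G.deleteEdges {e}).Reachable u w ∧ ¬ (G.deleteEdges {f}).Reachable u w := by
  induction e with | _ a b
  induction f with | _ c d
  have hbe : ¬ (G.deleteEdges {s(a, b)}).Reachable a b :=
    SimpleGraph.isBridge_iff.1 (SimpleGraph.isAcyclic_iff_forall_isBridge.1 hG he)
  have hbf : ¬ (G.deleteEdges {s(c, d)}).Reachable c d :=
    SimpleGraph.isBridge_iff.1 (SimpleGraph.isAcyclic_iff_forall_isBridge.1 hG hf)
  have hab : (G.deleteEdges {s(c, d)}).Reachable a b :=
    SimpleGraph.Adj.reachable (SimpleGraph.deleteEdges_adj.2 ⟨he, hef⟩)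
  have hcd : (G.deleteEdges {s(a, b)}).Reachable c d :=
    SimpleGraph.Adj.reachable (SimpleGraph.deleteEdges_adj.2 ⟨hf, hef.symm⟩)
  by_cases h1 : (G.deleteEdges {s(c, d)}).Reachable a c
  · have had : ¬ (G.deleteEdges {s(c, d)}).Reachable a d := fun h => hbf (h1.symm.trans h)
    by_cases h2 : (G.deleteEdges {s(a, b)}).Reachable a d
    · exact ⟨b, d, fun h => hbe (h2.trans h.symm), fun h => had (hab.trans h)⟩
    · exact ⟨a, d, h2, had⟩
  · by_cases h2 : (G.deleteEdges {s(a, b)}).Reachable a c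
    · exact ⟨b, c, fun h => hbe (h2.trans h.symm), fun h => h1 (hab.trans h)⟩
    · exact ⟨a, c, h2, h1⟩

/-- A rainbow coloring of a forest is injective on the edges. -/
theorem IsRainbowConnected.injOn_of_isAcyclic {V α : Type*} {G : SimpleGraph V} {c : Sym2 V → α}
    (hc : IsRainbowConnected G c) (hG : G.IsAcyclic) : Set.InjOn c G.edgeSet := by
  intro e he f hf hcef
  by_contra hef
  obtain ⟨u, w, hue, huf⟩ := exists_not_reachable_deleteEdges_of_isAcyclic hG he hf hef
  obtain ⟨p, -, hp⟩ := hc u w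
  exact hef (List.inj_on_of_nodup_map hp (mem_edges_of_not_reachable_deleteEdges hue p)
    (mem_edges_of_not_reachable_deleteEdges huf p) hcef)

theorem le_rc_of_isAcyclic {V : Type*} [Finite V] {G : SimpleGraph V}
    (hconn : G.Connected) (hG : G.IsAcyclic) : G.edgeSet.ncard ≤ rc G := by
  obtain ⟨c, hc⟩ : rc G ∈ {k : ℕ | ∃ c : Sym2 V → Fin k, IsRainbowConnected G c} :=
    Nat.sInf_mem ⟨_, exists_isRainbowConnected_of_connected hconn⟩
  have h := Set.ncard_le_ncard_of_injOn c (t := Set.univ) (fun _ _ => Set.mem_univ _)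
    (hc.injOn_of_isAcyclic hG)
  simpa [Set.ncard_univ] using h

/-- For every nontrivial connected graph with m edges, rc(G) ≠ m − 1. -/
theorem stmt_1 {V : Type*} [Fintype V] (G : SimpleGraph V)
    (hconn : G.Connected) (hV : Nontrivial V) :
    rc G ≠ G.edgeSet.ncard - 1 := by
  by_cases hG : G.IsAcyclic
  · have h := le_rc_of_isAcyclic hconn hG
    have hpos : 0 < G.edgeSet.ncard := by
      obtain ⟨v⟩ := hconn.nonempty
      obtain ⟨w, hw⟩ := hconn.preconnected.exists_adj_of_nontrivial v
      exact (Set.ncard_pos (Set.toFinite _)).2 ⟨s(v, w), hw⟩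
    omega
  · have h := rc_add_two_le_of_not_isAcyclic hconn hG
    omega
end

section
/- A nontrivial connected graph G with m edges is not a tree if and only if rc(G) ≤ m − 2. -/
namespace SimpleGraph

variable {V α : Type*} {G : SimpleGraph V}

lemma isRainbowConnected_of_injOn {c : Sym2 V → α}
    (h : ∀ u w, ∃ S : Set (Sym2 V),
      (G.deleteEdges S).Reachable u w ∧ Set.InjOn c (G.edgeSet \ S)) :
    IsRainbowConnected G c := by
  intro u w
  obtain ⟨S, hr, hinj⟩ := h u w
  obtain ⟨p, hp⟩ := hr.exists_isPath
  refine ⟨p.mapLe (deleteEdges_le S), hp.mapLe _, ?_⟩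
  have hS : ∀ e ∈ p.edges, e ∈ G.edgeSet \ S := fun e he ↦ by
    simpa only [edgeSet_deleteEdges] using p.edges_subset_edgeSet he
  simpa only [Walk.edges_mapLe_eq_edges] using
    hp.isTrail.edges_nodup.map_on fun x hx y hy ↦ hinj.eq_iff (hS x hx) (hS y hy) |>.mp

lemma Connected.exists_mem_edgeSet [Nontrivial V] (hG : G.Connected) : ∃ e, e ∈ G.edgeSet := by
  obtain ⟨v⟩ := hG.nonempty
  obtain ⟨w, hw⟩ := hG.preconnected.exists_adj_of_nontrivial v
  exact ⟨s(v, w), hw⟩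

lemma exists_isRainbowConnected_fin [Finite V] [Nontrivial V] (hG : G.Connected)
    {c : Sym2 V → α} (hc : IsRainbowConnected G c) :
    ∃ c' : Sym2 V → Fin (c '' G.edgeSet).ncard, IsRainbowConnected G c' := by
  classical
  obtain ⟨e₀, he₀⟩ := hG.exists_mem_edgeSet
  have : Finite (c '' G.edgeSet) := Set.toFinite _
  let φ : (c '' G.edgeSet) ≃ Fin (c '' G.edgeSet).ncard := Finite.equivFinOfCardEq rfl
  refine ⟨fun e ↦ φ (if h : e ∈ G.edgeSet then ⟨c e, e, h, rfl⟩ else ⟨c e₀, e₀, he₀, rfl⟩),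
    fun u w ↦ ?_⟩
  obtain ⟨p, hp, hnd⟩ := hc u w
  refine ⟨p, hp, List.Nodup.of_map (fun i ↦ (φ.symm i : α)) ?_⟩
  rw [List.map_map]
  convert hnd using 1
  refine List.map_congr_left fun e he ↦ ?_
  simp [p.edges_subset_edgeSet he]

lemma rc_le_ncard_image [Finite V] [Nontrivial V] (hG : G.Connected)
    {c : Sym2 V → α} (hc : IsRainbowConnected G c) : rc G ≤ (c '' G.edgeSet).ncard :=
  Nat.sInf_le (exists_isRainbowConnected_fin hG hc)

lemma Connected.isRainbowConnected_id (hG : G.Connected) :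
    IsRainbowConnected G (id : Sym2 V → Sym2 V) :=
  isRainbowConnected_of_injOn fun u w ↦
    ⟨∅, by simpa using hG.preconnected u w, Function.injective_id.injOn⟩

lemma exists_isRainbowConnected_rc [Finite V] [Nontrivial V] (hG : G.Connected) :
    ∃ c : Sym2 V → Fin (rc G), IsRainbowConnected G c :=
  Nat.sInf_mem (s := {k : ℕ | ∃ c : Sym2 V → Fin k, IsRainbowConnected G c})
    ⟨_, exists_isRainbowConnected_fin hG hG.isRainbowConnected_id⟩

lemma IsAcyclic.injOn_of_isRainbowConnected (hG : G.IsAcyclic) {c : Sym2 V → α}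
    (hc : IsRainbowConnected G c) : Set.InjOn c G.edgeSet := by
  rintro ⟨a, b⟩ hab ⟨x, y⟩ hxy hcol
  by_contra hne
  have key {a b u w : V} (p : G.Walk u w)
      (h : ¬ (G.deleteEdges {s(a, b)}).Reachable u w) : s(a, b) ∈ p.edges := by
    by_contra hp
    exact h (reachable_deleteEdges_iff_exists_walk.mpr ⟨p, hp⟩)
  have bridge {a b : V} (h : G.Adj a b) (z : V) :
      ∃ u, (u = a ∨ u = b) ∧ ¬ (G.deleteEdges {s(a, b)}).Reachable u z := by
    by_contra! H
    exact isBridge_iff.mp (isAcyclic_iff_forall_isBridge.mp hG h)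
      ((H a (.inl rfl)).trans (H b (.inr rfl)).symm)
  obtain ⟨u, -, hux⟩ := bridge hab x
  obtain ⟨w, hw, hwu⟩ := bridge hxy u
  have hxw : (G.deleteEdges {s(a, b)}).Reachable w x := by
    rcases hw with rfl | rfl
    · rfl
    · refine Adj.reachable (Adj.symm ?_)
      exact deleteEdges_adj.mpr ⟨hxy, fun h ↦ hne h.symm⟩
  obtain ⟨p, -, hp⟩ := hc u w
  exact hne (List.inj_on_of_nodup_map hp (key p fun h ↦ hux (h.trans hxw))
    (key p fun h ↦ hwu h.symm) hcol)

lemma Connected.exists_reachable_deleteEdges (hG : G.Connected) {S : Set (Sym2 V)} {X : Set V}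
    (hX : X.Nonempty) (hS : ∀ e ∈ S, ∀ v ∈ e, v ∈ X) (u : V) :
    ∃ x ∈ X, (G.deleteEdges S).Reachable u x := by
  obtain ⟨z, hz⟩ := hX
  obtain ⟨p⟩ := hG.preconnected u z
  induction p with
  | nil => exact ⟨_, hz, .rfl⟩
  | @cons u v _ h p ih =>
    by_cases he : s(u, v) ∈ S
    · exact ⟨u, hS _ he u (by simp), .rfl⟩
    · obtain ⟨x, hx, hr⟩ := ih hz
      exact ⟨x, hx, (Adj.reachable (deleteEdges_adj.mpr ⟨h, he⟩)).trans hr⟩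

lemma rc_le_of_maps_diff_pair [Finite V] [Nontrivial V] (hG : G.Connected)
    {c : Sym2 V → Sym2 V} (hc : IsRainbowConnected G c) {e f : Sym2 V}
    (he : e ∈ G.edgeSet) (hf : f ∈ G.edgeSet) (hef : e ≠ f)
    (hmaps : Set.MapsTo c G.edgeSet (G.edgeSet \ {e, f})) :
    rc G ≤ G.edgeSet.ncard - 2 := by
  refine (rc_le_ncard_image hG hc).trans ((Set.ncard_le_ncard hmaps.image_subset).trans_eq ?_)
  rw [Set.ncard_sdiff (by simp [Set.insert_subset_iff, he, hf]), Set.ncard_pair hef]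

lemma isRainbowConnected_of_reachable_of_subset {c : Sym2 V → α} {S : Set (Sym2 V)} {X : Set V}
    (hG : G.Connected) (hX : X.Nonempty) (hS : ∀ e ∈ S, ∀ v ∈ e, v ∈ X)
    (h : ∀ x ∈ X, ∀ y ∈ X, ∃ T ⊆ S,
      (G.deleteEdges T).Reachable x y ∧ Set.InjOn c (G.edgeSet \ T)) :
    IsRainbowConnected G c := by
  refine isRainbowConnected_of_injOn fun u w ↦ ?_
  obtain ⟨x, hx, hux⟩ := hG.exists_reachable_deleteEdges hX hS u
  obtain ⟨y, hy, hwy⟩ := hG.exists_reachable_deleteEdges hX hS w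
  obtain ⟨T, hT, hxy, hinj⟩ := h x hx y hy
  have hle := deleteEdges_anti (G := G) hT
  exact ⟨T, ((hux.mono hle).trans hxy).trans (hwy.mono hle).symm, hinj⟩

lemma rc_le_of_triangle [Finite V] [Nontrivial V] (hG : G.Connected) {x y z : V}
    (hxy : G.Adj x y) (hyz : G.Adj y z) (hzx : G.Adj z x) :
    rc G ≤ G.edgeSet.ncard - 2 := by
  classical
  have h₁ : s(x, y) ≠ s(y, z) := by simp [hxy.ne, hzx.ne']
  have h₂ : s(y, z) ≠ s(z, x) := by simp [hyz.ne, hxy.ne']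
  have h₃ : s(x, y) ≠ s(z, x) := by simp [hzx.ne', hyz.ne]
  let c : Sym2 V → Sym2 V := fun e ↦ if e = s(y, z) ∨ e = s(z, x) then s(x, y) else e
  refine rc_le_of_maps_diff_pair (c := c) hG ?_ hyz hzx h₂ ?_
  · refine isRainbowConnected_of_reachable_of_subset (S := {s(x, y), s(y, z), s(z, x)})
      (X := {x, y, z}) hG ⟨x, by simp⟩ (by simp) ?_
    have rxy : (G.deleteEdges {s(y, z), s(z, x)}).Reachable x y :=
      Adj.reachable (deleteEdges_adj.mpr ⟨hxy, by simp [h₁, h₃]⟩)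
    have ryz : (G.deleteEdges {s(x, y), s(z, x)}).Reachable y z :=
      Adj.reachable (deleteEdges_adj.mpr ⟨hyz, by simp [h₁.symm, h₂]⟩)
    have rzx : (G.deleteEdges {s(x, y), s(y, z)}).Reachable z x :=
      Adj.reachable (deleteEdges_adj.mpr ⟨hzx, by simp [h₂.symm, h₃.symm]⟩)
    have ixy : Set.InjOn c (G.edgeSet \ {s(y, z), s(z, x)}) := by
      intro a ha b hb; grind
    have iyz : Set.InjOn c (G.edgeSet \ {s(x, y), s(z, x)}) := by
      intro a ha b hb; grind
    have izx : Set.InjOn c (G.edgeSet \ {s(x, y), s(y, z)}) := by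
      intro a ha b hb; grind
    rintro a (rfl | rfl | rfl) b (rfl | rfl | rfl)
    all_goals first
      | exact ⟨_, by grind, .rfl, ixy⟩
      | exact ⟨_, by grind, rxy, ixy⟩
      | exact ⟨_, by grind, rxy.symm, ixy⟩
      | exact ⟨_, by grind, ryz, iyz⟩
      | exact ⟨_, by grind, ryz.symm, iyz⟩
      | exact ⟨_, by grind, rzx, izx⟩
      | exact ⟨_, by grind, rzx.symm, izx⟩
  · intro e he
    simp only [c]
    split_ifs with h
    · exact ⟨hxy, by simp [h₁, h₃]⟩
    · exact ⟨he, by simpa using h⟩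

lemma rc_le_of_isTrail [Finite V] [Nontrivial V] (hG : G.Connected) {v₀ v₁ v₂ v₃ v₄ : V}
    (h₀ : G.Adj v₀ v₁) (h₁ : G.Adj v₁ v₂) (h₂ : G.Adj v₂ v₃) (h₃ : G.Adj v₃ v₄)
    (p : G.Walk v₄ v₀) (hp : (Walk.cons h₀ (.cons h₁ (.cons h₂ (.cons h₃ p)))).IsTrail) :
    rc G ≤ G.edgeSet.ncard - 2 := by
  classical
  have hnd := hp.edges_nodup
  simp only [Walk.edges_cons] at hnd
  obtain ⟨e₀, he₀⟩ : ∃ e, e = s(v₀, v₁) := ⟨_, rfl⟩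
  obtain ⟨e₁, he₁⟩ : ∃ e, e = s(v₁, v₂) := ⟨_, rfl⟩
  obtain ⟨e₂, he₂⟩ : ∃ e, e = s(v₂, v₃) := ⟨_, rfl⟩
  obtain ⟨e₃, he₃⟩ : ∃ e, e = s(v₃, v₄) := ⟨_, rfl⟩
  have m₀ : e₀ ∈ G.edgeSet := he₀ ▸ h₀
  have m₁ : e₁ ∈ G.edgeSet := he₁ ▸ h₁
  have m₂ : e₂ ∈ G.edgeSet := he₂ ▸ h₂
  have m₃ : e₃ ∈ G.edgeSet := he₃ ▸ h₃
  rw [← he₀, ← he₁, ← he₂, ← he₃] at hnd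
  simp only [List.nodup_cons, List.mem_cons, not_or] at hnd
  obtain ⟨⟨d₀₁, d₀₂, d₀₃, n₀⟩, ⟨d₁₂, d₁₃, n₁⟩, ⟨d₂₃, n₂⟩, n₃, -⟩ := hnd
  let c : Sym2 V → Sym2 V := fun e ↦ if e = e₂ then e₀ else if e = e₃ then e₁ else e
  refine rc_le_of_maps_diff_pair (c := c) hG ?_ m₂ m₃ d₂₃ ?_
  · refine isRainbowConnected_of_reachable_of_subset (S := {e₀, e₁, e₂, e₃})
      (X := {v₀, v₁, v₂, v₃, v₄}) hG ⟨v₀, by simp⟩ (by simp [he₀, he₁, he₂, he₃]) ?_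
    have inj {a b : Sym2 V} (ha : a = e₀ ∨ a = e₂) (hb : b = e₁ ∨ b = e₃) :
        Set.InjOn c (G.edgeSet \ {a, b}) := by
      intro x hx y hy
      grind
    have step {T : Set (Sym2 V)} {a b : V} (h : G.Adj a b) (hT : s(a, b) ∉ T) :
        (G.deleteEdges T).Reachable a b := Adj.reachable (deleteEdges_adj.mpr ⟨h, hT⟩)
    have back {a b : Sym2 V} (ha : a = e₀ ∨ a = e₂) (hb : b = e₁ ∨ b = e₃) :
        (G.deleteEdges {a, b}).Reachable v₄ v₀ :=
      ⟨p.toDeleteEdges _ (by grind)⟩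
    have r₀₁ : ∀ v ∈ ({v₂, v₃, v₄, v₀} : Set V), (G.deleteEdges {e₀, e₁}).Reachable v₄ v := by
      have s₂ := step (T := {e₀, e₁}) h₂ (by grind)
      have s₃ := step (T := {e₀, e₁}) h₃ (by grind)
      rintro v (rfl | rfl | rfl | rfl)
      exacts [(s₂.trans s₃).symm, s₃.symm, .rfl, back (.inl rfl) (.inl rfl)]
    have r₂₁ : ∀ v ∈ ({v₃, v₄, v₀, v₁} : Set V), (G.deleteEdges {e₂, e₁}).Reachable v₄ v := by
      have s₃ := step (T := {e₂, e₁}) h₃ (by grind)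
      have s₀ := step (T := {e₂, e₁}) h₀ (by grind)
      have hb := back (.inr rfl) (.inl rfl)
      rintro v (rfl | rfl | rfl | rfl)
      exacts [s₃.symm, .rfl, hb, hb.trans s₀]
    have r₂₃ : ∀ v ∈ ({v₄, v₀, v₁, v₂} : Set V), (G.deleteEdges {e₂, e₃}).Reachable v₄ v := by
      have s₀ := step (T := {e₂, e₃}) h₀ (by grind)
      have s₁ := step (T := {e₂, e₃}) h₁ (by grind)
      have hb := back (.inr rfl) (.inr rfl)
      rintro v (rfl | rfl | rfl | rfl)
      exacts [.rfl, hb, hb.trans s₀, (hb.trans s₀).trans s₁]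
    have r₀₃ : ∀ v ∈ ({v₁, v₂, v₃} : Set V), (G.deleteEdges {e₀, e₃}).Reachable v₁ v := by
      have s₁ := step (T := {e₀, e₃}) h₁ (by grind)
      have s₂ := step (T := {e₀, e₃}) h₂ (by grind)
      rintro v (rfl | rfl | rfl)
      exacts [.rfl, s₁, s₁.trans s₂]
    intro a ha b hb
    have hcover : (a ∈ ({v₂, v₃, v₄, v₀} : Set V) ∧ b ∈ ({v₂, v₃, v₄, v₀} : Set V)) ∨
        (a ∈ ({v₃, v₄, v₀, v₁} : Set V) ∧ b ∈ ({v₃, v₄, v₀, v₁} : Set V)) ∨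
        (a ∈ ({v₄, v₀, v₁, v₂} : Set V) ∧ b ∈ ({v₄, v₀, v₁, v₂} : Set V)) ∨
        (a ∈ ({v₁, v₂, v₃} : Set V) ∧ b ∈ ({v₁, v₂, v₃} : Set V)) := by
      rcases ha with rfl | rfl | rfl | rfl | rfl <;>
        rcases hb with rfl | rfl | rfl | rfl | rfl <;> simp
    rcases hcover with h | h | h | h
    · exact ⟨_, by grind, (r₀₁ a h.1).symm.trans (r₀₁ b h.2), inj (.inl rfl) (.inl rfl)⟩
    · exact ⟨_, by grind, (r₂₁ a h.1).symm.trans (r₂₁ b h.2), inj (.inr rfl) (.inl rfl)⟩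
    · exact ⟨_, by grind, (r₂₃ a h.1).symm.trans (r₂₃ b h.2), inj (.inr rfl) (.inr rfl)⟩
    · exact ⟨_, by grind, (r₀₃ a h.1).symm.trans (r₀₃ b h.2), inj (.inl rfl) (.inr rfl)⟩
  · intro e he
    grind

lemma rc_le_of_not_isAcyclic [Finite V] [Nontrivial V] (hG : G.Connected)
    (h : ¬ G.IsAcyclic) : rc G ≤ G.edgeSet.ncard - 2 := by
  simp only [IsAcyclic, not_forall, not_not] at h
  obtain ⟨v, p, hp⟩ := h
  have ht := hp.isTrail
  have hl := hp.three_le_length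
  match p, ht, hl with
  | .cons h₀ (.cons h₁ (.cons h₂ .nil)), _, _ => exact rc_le_of_triangle hG h₀ h₁ h₂
  | .cons h₀ (.cons h₁ (.cons h₂ (.cons h₃ p))), ht, _ => exact rc_le_of_isTrail hG h₀ h₁ h₂ h₃ p ht

end SimpleGraph

/-- A nontrivial connected graph with m edges is not a tree
if and only if rc(G) ≤ m − 2. -/
theorem stmt_2 {V : Type*} [Fintype V] (G : SimpleGraph V)
    (hconn : G.Connected) (hV : Nontrivial V) :
    ¬ G.IsAcyclic ↔ rc G ≤ G.edgeSet.ncard - 2 := by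
  refine ⟨G.rc_le_of_not_isAcyclic hconn, fun hle hG ↦ ?_⟩
  obtain ⟨c, hc⟩ := SimpleGraph.exists_isRainbowConnected_rc hconn
  have hcard : G.edgeSet.ncard ≤ rc G := by
    rw [← (hG.injOn_of_isRainbowConnected hc).ncard_image]
    simpa using Set.ncard_le_card (c '' G.edgeSet)
  have hpos : 0 < G.edgeSet.ncard :=
    (Set.ncard_pos (Set.toFinite _)).mpr hconn.exists_mem_edgeSet
  omega
end

section
/- If a connected graph G with m edges contains a cycle of length k with k ≥ 4, then rc(G) ≤ m − ⌊k/2⌋. -/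
namespace SimpleGraph.Walk

variable {V : Type*} {G : SimpleGraph V}

/-- From any vertex one can reach a set of vertices met by a walk, using only edges
that do not lie inside the set. -/
lemma exists_walk_to_set_avoiding {u v : V} (w : G.Walk u v) {S : Set V} (hv : v ∈ S) :
    ∃ a ∈ S, ∃ q : G.Walk u a, ∀ e ∈ q.edges, ∃ y ∈ e, y ∉ S := by
  induction w with
  | nil => exact ⟨_, hv, nil, by simp⟩
  | @cons u v' _ hadj _ ih =>
    by_cases hu : u ∈ S
    · exact ⟨u, hu, nil, by simp⟩
    · obtain ⟨a, ha, q, hq⟩ := ih hv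
      refine ⟨a, ha, cons hadj q, fun e he => ?_⟩
      rw [edges_cons, List.mem_cons] at he
      rcases he with rfl | he
      · exact ⟨u, Sym2.mem_mk_left _ _, hu⟩
      · exact hq e he

lemma exists_walk_getVert_inner {u v : V} (p : G.Walk u v) {i j : ℕ} (hij : i ≤ j) :
    ∃ q : G.Walk (p.getVert i) (p.getVert j),
      ∀ e ∈ q.edges, ∃ t, ∃ ht : t < p.edges.length, p.edges[t] = e ∧ i ≤ t ∧ t < j := by
  have hend : (p.drop i).getVert (j - i) = p.getVert j := by
    rw [drop_getVert]; congr 1; omega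
  refine ⟨((p.drop i).take (j - i)).copy rfl hend, fun e he => ?_⟩
  rw [edges_copy, edges_take, edges_drop, List.mem_take_iff_getElem] at he
  obtain ⟨t, ht, rfl⟩ := he
  rw [List.length_drop] at ht
  exact ⟨i + t, by omega, by simp, by omega, by omega⟩

lemma exists_walk_getVert_outer {x : V} (p : G.Walk x x) (i j : ℕ) :
    ∃ q : G.Walk (p.getVert i) (p.getVert j),
      ∀ e ∈ q.edges, ∃ t, ∃ ht : t < p.edges.length, p.edges[t] = e ∧ (t < i ∨ j ≤ t) := by
  refine ⟨((p.drop j).append (p.take i)).reverse, fun e he => ?_⟩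
  rw [edges_reverse, List.mem_reverse, edges_append, edges_take, edges_drop, List.mem_append,
    List.mem_take_iff_getElem, List.mem_drop_iff_getElem] at he
  rcases he with ⟨t, ht, rfl⟩ | ⟨t, ht, rfl⟩
  · exact ⟨j + t, by omega, rfl, by omega⟩
  · exact ⟨t, by omega, rfl, by omega⟩

/-- Colouring the edges of a closed trail periodically with period half its length (rounded up),
any two of its vertices are joined by an arc with distinctly coloured edges. -/
lemma IsTrail.exists_arc_injOn [DecidableEq V] {x : V} {p : G.Walk x x} (hp : p.IsTrail)
    {a b : V} (ha : a ∈ p.support) (hb : b ∈ p.support) :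
    ∃ q : G.Walk a b, q.edges ⊆ p.edges ∧
      Set.InjOn (fun e => p.edges.idxOf e % (p.length - p.length / 2)) {e | e ∈ q.edges} := by
  obtain ⟨i, rfl, hi⟩ := mem_support_iff_exists_getVert.1 ha
  obtain ⟨j, rfl, hj⟩ := mem_support_iff_exists_getVert.1 hb
  wlog hij : i ≤ j generalizing i j
  · obtain ⟨q, hq, hinj⟩ := this j hj hb i hi ha (by omega)
    exact ⟨q.reverse, by simpa using hq, by simpa using hinj⟩
  have hlen := p.length_edges
  have key : ∀ (P : ℕ → Prop) (q : G.Walk (p.getVert i) (p.getVert j)),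
      (∀ e ∈ q.edges, ∃ t, ∃ ht : t < p.edges.length, p.edges[t] = e ∧ P t) →
      (∀ s t, s < t → t < p.length → P s → P t →
        s % (p.length - p.length / 2) ≠ t % (p.length - p.length / 2)) →
      q.edges ⊆ p.edges ∧ Set.InjOn
        (fun e => p.edges.idxOf e % (p.length - p.length / 2)) {e | e ∈ q.edges} := by
    intro P q hq hP
    refine ⟨fun e he => ?_, fun e he f hf hef => ?_⟩
    · obtain ⟨t, ht, rfl, -⟩ := hq e he
      exact List.getElem_mem ht
    · obtain ⟨s, hs, rfl, hPs⟩ := hq e he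
      obtain ⟨t, ht, rfl, hPt⟩ := hq f hf
      simp only [hp.edges_nodup.idxOf_getElem] at hef
      rcases lt_trichotomy s t with hst | rfl | hst
      · exact absurd hef (hP s t hst (by omega) hPs hPt)
      · rfl
      · exact absurd hef.symm (hP t s hst (by omega) hPt hPs)
  have hmod : ∀ s t h : ℕ, s < t → t < s + 2 * h → t ≠ s + h → s % h ≠ t % h := by
    intro s t h hst hlt hne heq
    obtain ⟨c, hc⟩ := (Nat.modEq_iff_dvd' hst.le).1 heq
    have hc1 : c < 2 := by
      by_contra! h2
      have := Nat.mul_le_mul_left h h2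
      omega
    interval_cases c <;> omega
  by_cases hd : j - i ≤ p.length / 2
  · obtain ⟨q, hq⟩ := p.exists_walk_getVert_inner hij
    exact ⟨q, key _ q hq fun s t hst ht hs ht' => hmod s t _ hst (by omega) (by omega)⟩
  · obtain ⟨q, hq⟩ := p.exists_walk_getVert_outer i j
    exact ⟨q, key _ q hq fun s t hst ht hs ht' => hmod s t _ hst (by omega) (by omega)⟩

/-- If a colouring is injective on the edges of a walk, then its endpoints are joined by a
rainbow path. -/
lemma exists_isPath_nodup_map_edges {α : Type*} {u v : V} (w : G.Walk u v) {c : Sym2 V → α}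
    (hc : Set.InjOn c {e | e ∈ w.edges}) :
    ∃ p : G.Walk u v, p.IsPath ∧ (p.edges.map c).Nodup := by
  classical
  refine ⟨w.bypass, w.bypass_isPath, ?_⟩
  refine List.Nodup.map_on (fun e he f hf h => hc ?_ ?_ h) w.bypass_isPath.isTrail.edges_nodup
  · exact w.edges_bypass_subset_edges he
  · exact w.edges_bypass_subset_edges hf

end SimpleGraph.Walk

open SimpleGraph in
/-- If a connected graph with m edges contains a cycle of length
k ≥ 4, then rc(G) ≤ m − ⌊k/2⌋. -/
theorem stmt_3 {V : Type*} [Fintype V] (G : SimpleGraph V)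
    (hconn : G.Connected) (k : ℕ) (hk : 4 ≤ k)
    (hcyc : ∃ (x : V) (p : G.Walk x x), p.IsCycle ∧ p.length = k) :
    rc G ≤ G.edgeSet.ncard - k / 2 := by
  classical
  obtain ⟨x, p, hp, rfl⟩ := hcyc
  have hcard : p.edges.toFinset.card = p.length := by
    rw [List.toFinset_card_of_nodup hp.edges_nodup, p.length_edges]
  have hsub : p.edges.toFinset ⊆ G.edgeFinset := fun e he =>
    mem_edgeFinset.2 (p.edges_subset_edgeSet (List.mem_toFinset.1 he))
  have hm : G.edgeSet.ncard = G.edgeFinset.card := by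
    rw [← coe_edgeFinset, Set.ncard_coe_finset]
  have hle := Finset.card_le_card hsub
  let L := (G.edgeFinset \ p.edges.toFinset).toList
  have hL : L.length = G.edgeSet.ncard - p.length := by
    rw [Finset.length_toList, Finset.card_sdiff_of_subset hsub, hcard, hm]
  have hmemL : ∀ e ∈ G.edgeSet, e ∉ p.edges → e ∈ L := by
    intro e he hne
    simp [L, hne, he]
  let h := p.length - p.length / 2
  let c : Sym2 V → ℕ := fun e => if e ∈ p.edges then p.edges.idxOf e % h else h + L.idxOf e
  have hc_in : ∀ e ∈ p.edges, c e < h := fun e he => by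
    simp only [c, if_pos he]
    exact Nat.mod_lt _ (by omega)
  have hc_out : ∀ e, e ∉ p.edges → c e = h + L.idxOf e := fun e he => if_neg he
  have hc_lt : ∀ e ∈ G.edgeSet, c e < G.edgeSet.ncard - p.length / 2 := by
    intro e he
    by_cases hpe : e ∈ p.edges
    · have := hc_in e hpe
      omega
    · have := List.idxOf_lt_length_iff.2 (hmemL e he hpe)
      rw [hc_out e hpe]
      omega
  refine Nat.sInf_le ⟨fun e => ⟨c e % (G.edgeSet.ncard - p.length / 2),
    Nat.mod_lt _ (by omega)⟩, fun u w => ?_⟩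
  obtain ⟨q₁⟩ := hconn.preconnected u x
  obtain ⟨q₂⟩ := hconn.preconnected w x
  obtain ⟨a, ha, r₁, hr₁⟩ := q₁.exists_walk_to_set_avoiding
    (S := {y | y ∈ p.support}) p.start_mem_support
  obtain ⟨b, hb, r₂, hr₂⟩ := q₂.exists_walk_to_set_avoiding
    (S := {y | y ∈ p.support}) p.start_mem_support
  obtain ⟨q, hq, hinj⟩ := hp.isTrail.exists_arc_injOn ha hb
  have hmem : ∀ e ∈ ((r₁.append q).append r₂.reverse).edges, e ∈ p.edges → e ∈ q.edges := by
    intro e he hpe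
    simp only [Walk.edges_append, Walk.edges_reverse, List.mem_append, List.mem_reverse] at he
    have hsupp : ∀ y ∈ e, y ∈ p.support := fun y hy => Walk.mem_support_of_mem_edges hpe hy
    rcases he with (he | he) | he
    · obtain ⟨y, hy, hyn⟩ := hr₁ e he
      exact absurd (hsupp y hy) hyn
    · exact he
    · obtain ⟨y, hy, hyn⟩ := hr₂ e he
      exact absurd (hsupp y hy) hyn
  refine ((r₁.append q).append r₂.reverse).exists_isPath_nodup_map_edges fun e he f hf hef => ?_
  have heG := Walk.edges_subset_edgeSet _ he
  have hfG := Walk.edges_subset_edgeSet _ hf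
  have hef : c e = c f := by
    simpa only [Fin.mk.injEq, Nat.mod_eq_of_lt (hc_lt e heG), Nat.mod_eq_of_lt (hc_lt f hfG)]
      using hef
  by_cases hpe : e ∈ p.edges <;> by_cases hpf : f ∈ p.edges
  · refine hinj (hmem e he hpe) (hmem f hf hpf) ?_
    simpa only [c, if_pos hpe, if_pos hpf] using hef
  · have := hc_in e hpe
    have := hc_out f hpf
    omega
  · have := hc_in f hpf
    have := hc_out e hpe
    omega
  · rw [hc_out e hpe, hc_out f hpf] at hef
    exact (List.idxOf_inj (hmemL e heG hpe)).1 (by omega)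
end

section
/- If a connected graph G with m edges contains two edge-disjoint 2-connected subgraphs, then rc(G) ≤ m − 4. -/
/-- A subgraph is 2-connected if it has at least 3 vertices, is connected,
and deleting any single vertex leaves it connected (no cut vertex). -/
def IsTwoConnectedSubgraph {V : Type*} {G : SimpleGraph V} (H : G.Subgraph) : Prop :=
  3 ≤ H.verts.ncard ∧ H.coe.Connected ∧
    ∀ v ∈ H.verts, ((H.deleteVerts {v}).coe).Connected

/-- The set of edges traversed by a walk. -/
def walkEdges {V : Type*} {G : SimpleGraph V} {u w : V} (p : G.Walk u w) : Set (Sym2 V) :=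
  {e | e ∈ p.edges}

/-- The edges in `F`, whose endpoints lie in `S`, can be recolored by `f` without using the two
distinct edges `a` and `b` of `F` as colors, so that any two vertices of `S` are joined by a rainbow
walk inside `F`. -/
structure IsSavingBlock {V : Type*} (G : SimpleGraph V) (S : Set V) (F : Set (Sym2 V))
    (f : Sym2 V → Sym2 V) (a b : Sym2 V) : Prop where
  mem_of_mem : ∀ e ∈ F, ∀ x ∈ e, x ∈ S
  left_mem : a ∈ F
  right_mem : b ∈ F
  ne : a ≠ b
  mapsTo : ∀ e ∈ F, f e ∈ F ∧ f e ≠ a ∧ f e ≠ b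
  exists_walk : ∀ u ∈ S, ∀ w ∈ S, ∃ q : G.Walk u w,
    walkEdges q ⊆ F ∧ Set.InjOn f (walkEdges q)

section

open SimpleGraph

variable {V : Type*} {G : SimpleGraph V}

/-- A walk that meets `S` has an initial part reaching `S` without using edges inside `S`. -/
lemma exists_walk_to_set (S : Set V) (F : Set (Sym2 V)) (hF : ∀ e ∈ F, ∀ x ∈ e, x ∈ S)
    {u w : V} (p : G.Walk u w) (hp : ∃ x ∈ p.support, x ∈ S) :
    ∃ x ∈ S, ∃ q : G.Walk u x, walkEdges q ⊆ walkEdges p \ F := by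
  induction p with
  | nil =>
    obtain ⟨x, hx, hxS⟩ := hp
    obtain rfl : x = _ := by simpa using hx
    exact ⟨x, hxS, Walk.nil, by simp [walkEdges]⟩
  | @cons u v w h p ih =>
    by_cases hu : u ∈ S
    · exact ⟨u, hu, Walk.nil, by simp [walkEdges]⟩
    · obtain ⟨x, hx, hxS⟩ := hp
      have hx' : x ∈ p.support := by
        rcases List.mem_cons.1 (Walk.support_cons h p ▸ hx) with rfl | h'
        · exact absurd hxS hu
        · exact h'
      obtain ⟨y, hy, q, hq⟩ := ih ⟨x, hx', hxS⟩
      refine ⟨y, hy, Walk.cons h q, ?_⟩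
      intro e he
      rcases List.mem_cons.1 (Walk.edges_cons h q ▸ he : e ∈ s(u, v) :: q.edges) with rfl | he
      · exact ⟨by simp [walkEdges], fun hmem => hu (hF _ hmem u (by simp))⟩
      · exact ⟨List.mem_cons_of_mem _ (hq he).1, (hq he).2⟩

/-- A walk can be rerouted through a rainbow connected block so that its edges in the block
have distinct colors. -/
lemma exists_reroute {α : Type*} (c : Sym2 V → α) (S : Set V) (F : Set (Sym2 V))
    (hF : ∀ e ∈ F, ∀ x ∈ e, x ∈ S)
    (hS : ∀ u ∈ S, ∀ w ∈ S, ∃ q : G.Walk u w,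
      walkEdges q ⊆ F ∧ Set.InjOn c (walkEdges q))
    {u w : V} (p : G.Walk u w) :
    ∃ q : G.Walk u w, walkEdges q ⊆ F ∪ walkEdges p ∧ Set.InjOn c (walkEdges q ∩ F) := by
  by_cases hp : ∃ x ∈ p.support, x ∈ S
  · obtain ⟨x, hx, A, hA⟩ := exists_walk_to_set S F hF p hp
    obtain ⟨y, hy, B, hB⟩ := exists_walk_to_set S F hF p.reverse (by simpa using hp)
    obtain ⟨q, hqF, hqc⟩ := hS x hx y hy
    have key : ∀ e ∈ walkEdges (A.append (q.append B.reverse)),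
        e ∈ walkEdges q ∨ e ∈ walkEdges p \ F := by
      intro e he
      simp only [walkEdges, Set.mem_ofPred_eq, Walk.edges_append, List.mem_append,
        Walk.edges_reverse, List.mem_reverse] at he
      rcases he with he | he | he
      · exact Or.inr (hA he)
      · exact Or.inl he
      · have := hB he
        exact Or.inr ⟨by simpa [walkEdges] using this.1, this.2⟩
    refine ⟨A.append (q.append B.reverse), fun e he => ?_, hqc.mono fun e he => ?_⟩
    · exact (key e he).imp (fun h => hqF h) (fun h => h.1)
    · exact (key e he.1).resolve_right fun h => h.2 he.2
  · refine ⟨p, Set.subset_union_right, ?_⟩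
    rintro e ⟨he, heF⟩
    obtain ⟨x, hx⟩ : ∃ x, x ∈ e := ⟨_, Sym2.out_fst_mem e⟩
    refine absurd ⟨x, ?_, hF e heF x hx⟩ hp
    exact Walk.mem_support_of_mem_edges he hx

/-- Two vertices of a cycle split it into two edge-disjoint arcs sharing only their ends. -/
lemma exists_arcs [DecidableEq V] {v : V} {p : G.Walk v v} (hp : p.IsCycle) {u w : V}
    (hu : u ∈ p.support) (hw : w ∈ p.support) :
    ∃ A B : G.Walk u w, walkEdges A ∪ walkEdges B = walkEdges p ∧
      Disjoint (walkEdges A) (walkEdges B) ∧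
      ∀ x ∈ A.support, x ∈ B.support → x = u ∨ x = w := by
  have hc := hp.rotate hu
  have hw' : w ∈ (p.rotate u hu).support := by simpa using hw
  set c := p.rotate u hu with hcdef
  have hsplit := c.take_spec hw'
  set A := c.takeUntil w hw'
  set B := c.dropUntil w hw'
  have hedges : c.edges = A.edges ++ B.edges := by rw [← hsplit, Walk.edges_append]
  refine ⟨A, B.reverse, ?_, ?_, ?_⟩
  · ext e
    have h1 : e ∈ c.edges ↔ e ∈ p.edges := (p.rotate_edges u hu).mem_iff
    simp only [walkEdges, Set.mem_union, Set.mem_ofPred_eq, Walk.edges_reverse, List.mem_reverse]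
    rw [← h1, hedges, List.mem_append]
  · have h := hc.isTrail.edges_nodup
    rw [hedges, List.nodup_append'] at h
    rw [Set.disjoint_left]
    intro e he he'
    exact h.2.2 he (by simpa [walkEdges] using he')
  · intro x hxA hxB
    rw [Walk.support_reverse, List.mem_reverse] at hxB
    have h := hc.support_nodup
    rw [← hsplit, Walk.tail_support_append, List.nodup_append'] at h
    rw [Walk.mem_support_iff] at hxA hxB
    rcases hxA with hxA | hxA
    · exact Or.inl hxA
    · rcases hxB with hxB | hxB
      · exact Or.inr hxB
      · exact (h.2.2 hxA hxB).elim

lemma isSavingBlock_triangle {x y z : V} (hxy : G.Adj x y) (hyz : G.Adj y z) (hzx : G.Adj z x) :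
    IsSavingBlock G {x, y, z} {s(x, y), s(y, z), s(z, x)} (fun _ => s(x, y)) s(y, z) s(z, x) := by
  have h1 := hxy.ne
  have h2 := hyz.ne
  have h3 := hzx.ne
  refine ⟨?_, by simp, by simp, ?_, ?_, ?_⟩
  · rintro e (rfl | rfl | rfl) t ht <;> rcases Sym2.mem_iff.1 ht with rfl | rfl <;> simp
  · intro h; rw [Sym2.eq_iff] at h; grind
  · intro e _
    refine ⟨by simp, ?_, ?_⟩ <;> intro h <;> rw [Sym2.eq_iff] at h <;> grind
  · intro u hu w hw
    by_cases huw : u = w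
    · subst huw
      exact ⟨Walk.nil, by simp [walkEdges], by simp [walkEdges]⟩
    · have hadj : G.Adj u w ∧ s(u, w) ∈ ({s(x, y), s(y, z), s(z, x)} : Set (Sym2 V)) := by
        rcases hu with rfl | rfl | rfl <;> rcases hw with rfl | rfl | rfl <;>
          simp_all [G.adj_comm, Sym2.eq_swap]
      exact ⟨hadj.1.toWalk, by simpa [walkEdges] using hadj.2, by simp [walkEdges]⟩

open Classical in
lemma isSavingBlock_of_long_cycle {x₀ x₁ x₂ x₃ x₄ : V} (h₀ : G.Adj x₀ x₁) (h₁ : G.Adj x₁ x₂)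
    (h₂ : G.Adj x₂ x₃) (h₃ : G.Adj x₃ x₄) (p : G.Walk x₄ x₀)
    (hc : (Walk.cons h₀ (Walk.cons h₁ (Walk.cons h₂ (Walk.cons h₃ p)))).IsCycle) :
    IsSavingBlock G
      {x | x ∈ (Walk.cons h₀ (Walk.cons h₁ (Walk.cons h₂ (Walk.cons h₃ p)))).support}
      (walkEdges (Walk.cons h₀ (Walk.cons h₁ (Walk.cons h₂ (Walk.cons h₃ p)))))
      (fun e => if e = s(x₂, x₃) then s(x₀, x₁) else if e = s(x₃, x₄) then s(x₁, x₂) else e)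
      s(x₂, x₃) s(x₃, x₄) := by
  have hE := hc.isTrail.edges_nodup
  have hV := hc.support_nodup
  set c := Walk.cons h₀ (Walk.cons h₁ (Walk.cons h₂ (Walk.cons h₃ p))) with hcdef
  have hm₀ : s(x₀, x₁) ∈ walkEdges c := by simp [hcdef, walkEdges]
  have hm₁ : s(x₁, x₂) ∈ walkEdges c := by simp [hcdef, walkEdges]
  have hm₂ : s(x₂, x₃) ∈ walkEdges c := by simp [hcdef, walkEdges]
  have hm₃ : s(x₃, x₄) ∈ walkEdges c := by simp [hcdef, walkEdges]
  have hv₁₂ : x₁ ≠ x₂ := h₁.ne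
  have hv₂₃ : x₂ ≠ x₃ := h₂.ne
  have hv₁₃ : x₁ ≠ x₃ := by
    rintro rfl
    simp [hcdef] at hV
  simp only [hcdef, Walk.edges_cons, List.nodup_cons, List.mem_cons, not_or] at hE
  obtain ⟨⟨e01, e02, e03, -⟩, ⟨e12, e13, -⟩, ⟨e23, -⟩, -⟩ := hE
  generalize hd₀ : s(x₀, x₁) = d₀ at *
  generalize hd₁ : s(x₁, x₂) = d₁ at *
  generalize hd₂ : s(x₂, x₃) = d₂ at *
  generalize hd₃ : s(x₃, x₄) = d₃ at *
  refine ⟨?_, hm₂, hm₃, e23, ?_, ?_⟩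
  · intro e he x hx
    exact Walk.mem_support_of_mem_edges he hx
  · intro e he
    grind
  · intro u hu w hw
    obtain ⟨A, B, hAB, hdis, hsup⟩ := exists_arcs hc hu hw
    rw [Set.disjoint_left] at hdis
    have shared : ∀ x : V, ∀ e ∈ walkEdges A, ∀ e' ∈ walkEdges B, x ∈ e → x ∈ e' →
        x = u ∨ x = w := fun x e he e' he' hx hx' =>
      hsup x (Walk.mem_support_of_mem_edges he hx)
        (Walk.mem_support_of_mem_edges he' hx')
    have m10 : x₁ ∈ d₀ := by simp [← hd₀]
    have m11 : x₁ ∈ d₁ := by simp [← hd₁]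
    have m21 : x₂ ∈ d₁ := by simp [← hd₁]
    have m22 : x₂ ∈ d₂ := by simp [← hd₂]
    have m32 : x₃ ∈ d₂ := by simp [← hd₂]
    have m33 : x₃ ∈ d₃ := by simp [← hd₃]
    have rep : ∀ T : Set (Sym2 V), ¬ Set.InjOn
        (fun e => if e = d₂ then d₀ else if e = d₃ then d₁ else e) T →
        (d₀ ∈ T ∧ d₂ ∈ T) ∨ (d₁ ∈ T ∧ d₃ ∈ T) := by
      intro T hT
      simp only [Set.InjOn, not_forall] at hT
      obtain ⟨e, he, e', he', hee, hne⟩ := hT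
      grind
    by_cases hA : Set.InjOn (fun e => if e = d₂ then d₀ else if e = d₃ then d₁ else e)
        (walkEdges A)
    · exact ⟨A, hAB ▸ Set.subset_union_left, hA⟩
    · refine ⟨B, hAB ▸ Set.subset_union_right, ?_⟩
      by_contra hB
      rcases rep _ hA with ⟨a1, a2⟩ | ⟨a1, a2⟩ <;> rcases rep _ hB with ⟨b1, b2⟩ | ⟨b1, b2⟩
      · exact hdis a1 b1
      · have t1 := shared x₁ _ a1 _ b1 m10 m11
        have t2 := shared x₂ _ a2 _ b1 m22 m21
        have t3 := shared x₃ _ a2 _ b2 m32 m33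
        grind
      · have t1 := shared x₁ _ a1 _ b1 m11 m10
        have t2 := shared x₂ _ a1 _ b2 m21 m22
        have t3 := shared x₃ _ a2 _ b2 m33 m32
        grind
      · exact hdis a1 b1

lemma exists_isSavingBlock_of_isCycle {v : V} {p : G.Walk v v} (hp : p.IsCycle) :
    ∃ S F f a b, F ⊆ walkEdges p ∧ IsSavingBlock G S F f a b := by
  have h3 := hp.three_le_length
  match p, hp, h3 with
  | .cons h₀ (.cons h₁ (.cons h₂ .nil)), _, _ =>
    refine ⟨_, _, _, _, _, ?_, isSavingBlock_triangle h₀ h₁ h₂⟩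
    rintro e (rfl | rfl | rfl) <;> simp [walkEdges]
  | .cons h₀ (.cons h₁ (.cons h₂ (.cons h₃ q))), hp, _ =>
    exact ⟨_, _, _, _, _, subset_rfl, isSavingBlock_of_long_cycle h₀ h₁ h₂ h₃ q hp⟩

/-- Two vertices other than `x` of a subgraph without cut vertex are joined avoiding `x`. -/
lemma IsTwoConnectedSubgraph.exists_walk_avoiding {H : G.Subgraph}
    (hH : IsTwoConnectedSubgraph H) {x : V} (hx : x ∈ H.verts) (u w : H.verts)
    (hu : (u : V) ≠ x) (hw : (w : V) ≠ x) :
    ∃ q : H.coe.Walk u w, ∀ y ∈ q.support, (y : V) ≠ x := by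
  let φ : (H.deleteVerts {x}).coe →g H.coe := Subgraph.inclusion Subgraph.deleteVerts_le
  have lift : ∀ u w, ∃ q : H.coe.Walk (φ u) (φ w), ∀ y ∈ q.support, (y : V) ≠ x := by
    intro u w
    obtain ⟨q⟩ := (hH.2.2 x hx).preconnected u w
    refine ⟨q.map φ, fun y hy => ?_⟩
    rw [Walk.support_map, List.mem_map] at hy
    obtain ⟨z, -, rfl⟩ := hy
    exact z.2.2
  exact lift ⟨u, u.2, hu⟩ ⟨w, w.2, hw⟩

lemma IsTwoConnectedSubgraph.exists_isCycle {H : G.Subgraph} (hH : IsTwoConnectedSubgraph H) :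
    ∃ (v : V) (p : G.Walk v v), p.IsCycle ∧ walkEdges p ⊆ H.edgeSet := by
  have hcyc : ¬ H.coe.IsAcyclic := by
    intro hac
    have : Finite H.verts := Set.finite_of_ncard_pos (by have := hH.1; omega)
    have hnt : H.verts.Nontrivial := Set.one_lt_ncard_iff_nontrivial.1 (by
      have := hH.1; omega)
    have : Nontrivial H.verts := hnt.coe_sort
    obtain ⟨v⟩ := hH.2.1.nonempty
    obtain ⟨a, hva⟩ := hH.2.1.preconnected.exists_adj_of_nontrivial v
    obtain ⟨z, hz, hzn⟩ : ∃ z ∈ H.verts, z ∉ ({(v : V), (a : V)} : Set V) := by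
      by_contra! hcon
      have h1 := Set.ncard_le_ncard (s := H.verts) (t := {(v : V), (a : V)}) hcon
        (Set.toFinite _)
      rw [Set.ncard_pair fun h => hva.ne (Subtype.ext h)] at h1
      have := hH.1
      omega
    simp only [Set.mem_insert_iff, Set.mem_singleton_iff, not_or] at hzn
    have hne : (v : V) ≠ a := fun h => hva.ne (Subtype.ext h)
    obtain ⟨q₁, hq₁⟩ := hH.exists_walk_avoiding a.2 v ⟨z, hz⟩ hne hzn.2
    obtain ⟨q₂, hq₂⟩ := hH.exists_walk_avoiding v.2 ⟨z, hz⟩ a hzn.1 hne.symm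
    have hbr := isAcyclic_iff_forall_adj_isBridge.1 hac hva
    rw [isBridge_iff_forall_walk_mem_edges] at hbr
    have := hbr (q₁.append q₂)
    rw [Walk.edges_append, List.mem_append] at this
    rcases this with h | h
    · exact hq₁ _ (Walk.snd_mem_support_of_mem_edges _ h) rfl
    · exact hq₂ _ (Walk.fst_mem_support_of_mem_edges _ h) rfl
  simp only [IsAcyclic, not_forall, not_not] at hcyc
  obtain ⟨v, p, hp⟩ := hcyc
  refine ⟨_, p.map H.hom, hp.map H.hom_injective, ?_⟩
  intro e he
  simp only [walkEdges, Set.mem_ofPred_eq, Walk.edges_map, List.mem_map] at he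
  obtain ⟨e', he', rfl⟩ := he
  have := p.edges_subset_edgeSet he'
  induction e' with
  | _ x y => simpa using this

lemma rc_le_of_isRainbowConnected {α : Type*} {T : Set α}
    (hT : T.Finite) (hne : T.Nonempty) (c : Sym2 V → α) (hmaps : ∀ e ∈ G.edgeSet, c e ∈ T)
    (hc : IsRainbowConnected G c) : rc G ≤ T.ncard := by
  have := hT.to_subtype
  have hpos : 0 < T.ncard := (Set.ncard_pos hT).2 hne
  obtain ⟨g⟩ : Nonempty (T ≃ Fin T.ncard) := ⟨Finite.equivFinOfCardEq rfl⟩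
  classical
  let c' : Sym2 V → Fin T.ncard := fun e => if h : c e ∈ T then g ⟨c e, h⟩ else ⟨0, hpos⟩
  refine Nat.sInf_le ⟨c', fun u w => ?_⟩
  obtain ⟨p, hp, hcp⟩ := hc u w
  refine ⟨p, hp, ?_⟩
  rw [List.nodup_map_iff_inj_on hp.isTrail.edges_nodup] at hcp ⊢
  intro e he e' he' h
  have h1 := hmaps e (p.edges_subset_edgeSet he)
  have h2 := hmaps e' (p.edges_subset_edgeSet he')
  simp only [c', h1, h2, dif_pos, EmbeddingLike.apply_eq_iff_eq, Subtype.mk.injEq] at h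
  exact hcp e he e' he' h

open Classical in
/-- Recoloring two disjoint saving blocks of a connected graph leaves it rainbow connected. -/
lemma isRainbowConnected_of_isSavingBlock (hconn : G.Connected) {S₁ S₂ : Set V}
    {F₁ F₂ : Set (Sym2 V)} {f₁ f₂ : Sym2 V → Sym2 V} {a₁ b₁ a₂ b₂ : Sym2 V}
    (h₁ : IsSavingBlock G S₁ F₁ f₁ a₁ b₁) (h₂ : IsSavingBlock G S₂ F₂ f₂ a₂ b₂)
    (hdisj : Disjoint F₁ F₂) :
    IsRainbowConnected G (fun e => if e ∈ F₁ then f₁ e else if e ∈ F₂ then f₂ e else e) := by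
  rw [Set.disjoint_left] at hdisj
  set c : Sym2 V → Sym2 V := fun e => if e ∈ F₁ then f₁ e else if e ∈ F₂ then f₂ e else e with hcdef
  have hc₁ : Set.EqOn f₁ c F₁ := fun e he => by simp [hcdef, he]
  have hc₂ : Set.EqOn f₂ c F₂ := fun e he => by
    have : e ∉ F₁ := fun h => hdisj h he
    simp [hcdef, he, this]
  have hw₁ : ∀ u ∈ S₁, ∀ w ∈ S₁, ∃ q : G.Walk u w,
      walkEdges q ⊆ F₁ ∧ Set.InjOn c (walkEdges q) := fun u hu w hw => by
    obtain ⟨q, hq, hinj⟩ := h₁.exists_walk u hu w hw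
    exact ⟨q, hq, (hc₁.mono hq).injOn_iff.1 hinj⟩
  have hw₂ : ∀ u ∈ S₂, ∀ w ∈ S₂, ∃ q : G.Walk u w,
      walkEdges q ⊆ F₂ ∧ Set.InjOn c (walkEdges q) := fun u hu w hw => by
    obtain ⟨q, hq, hinj⟩ := h₂.exists_walk u hu w hw
    exact ⟨q, hq, (hc₂.mono hq).injOn_iff.1 hinj⟩
  intro u w
  obtain ⟨p⟩ := hconn.preconnected u w
  obtain ⟨q, -, hqc⟩ := exists_reroute c S₁ F₁ h₁.mem_of_mem hw₁ p
  obtain ⟨r, hr, hrc⟩ := exists_reroute c S₂ F₂ h₂.mem_of_mem hw₂ q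
  have hinj : Set.InjOn c (walkEdges r) := by
    intro e he e' he' hee
    have m₁ := h₁.mapsTo
    have m₂ := h₂.mapsTo
    by_cases k₁ : e ∈ F₁ <;> by_cases k₁' : e' ∈ F₁
    · exact hqc ⟨(hr he).resolve_left (hdisj k₁), k₁⟩ ⟨(hr he').resolve_left (hdisj k₁'), k₁'⟩ hee
    all_goals by_cases k₂ : e ∈ F₂ <;> by_cases k₂' : e' ∈ F₂
    all_goals first
      | exact hrc ⟨he, k₂⟩ ⟨he', k₂'⟩ hee
      | grind
  refine ⟨r.bypass, r.bypass_isPath, ?_⟩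
  rw [List.nodup_map_iff_inj_on r.bypass_isPath.isTrail.edges_nodup]
  intro e he e' he' hee
  exact hinj (r.edges_bypass_subset_edges he) (r.edges_bypass_subset_edges he') hee

end

/-- If a connected graph with m edges contains two edge-disjoint
2-connected subgraphs, then rc(G) ≤ m − 4. -/
theorem stmt_4 {V : Type*} [Fintype V] (G : SimpleGraph V)
    (hconn : G.Connected) (H₁ H₂ : G.Subgraph)
    (h₁ : IsTwoConnectedSubgraph H₁) (h₂ : IsTwoConnectedSubgraph H₂)
    (hdisj : Disjoint H₁.edgeSet H₂.edgeSet) :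
    rc G ≤ G.edgeSet.ncard - 4 := by
  classical
  obtain ⟨_, p₁, hp₁, hpH₁⟩ := h₁.exists_isCycle
  obtain ⟨_, p₂, hp₂, hpH₂⟩ := h₂.exists_isCycle
  obtain ⟨S₁, F₁, f₁, a₁, b₁, hF₁, hB₁⟩ := exists_isSavingBlock_of_isCycle hp₁
  obtain ⟨S₂, F₂, f₂, a₂, b₂, hF₂, hB₂⟩ := exists_isSavingBlock_of_isCycle hp₂
  have hd : Disjoint F₁ F₂ := hdisj.mono (hF₁.trans hpH₁) (hF₂.trans hpH₂)
  have hG₁ : F₁ ⊆ G.edgeSet := (hF₁.trans hpH₁).trans H₁.edgeSet_subset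
  have hG₂ : F₂ ⊆ G.edgeSet := (hF₂.trans hpH₂).trans H₂.edgeSet_subset
  have hc := isRainbowConnected_of_isSavingBlock hconn hB₁ hB₂ hd
  rw [Set.disjoint_left] at hd
  have l₁ := hB₁.left_mem
  have r₁ := hB₁.right_mem
  have l₂ := hB₂.left_mem
  have r₂ := hB₂.right_mem
  have n₁ := hB₁.ne
  have n₂ := hB₂.ne
  have m₁ := hB₁.mapsTo
  have m₂ := hB₂.mapsTo
  let D : Finset (Sym2 V) := {a₁, b₁, a₂, b₂}
  have hD : D.card = 4 := by
    refine Finset.card_eq_succ.2 ⟨a₁, {b₁, a₂, b₂}, ?_, rfl, ?_⟩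
    · grind
    · exact Finset.card_eq_three.2 ⟨b₁, a₂, b₂, by grind, by grind, by grind, rfl⟩
  have hDG : (D : Set (Sym2 V)) ⊆ G.edgeSet := by
    intro e he
    simp only [D, Finset.coe_insert, Finset.coe_singleton, Set.mem_insert_iff,
      Set.mem_singleton_iff] at he
    rcases he with rfl | rfl | rfl | rfl
    exacts [hG₁ l₁, hG₁ r₁, hG₂ l₂, hG₂ r₂]
  have hcard : (G.edgeSet \ D).ncard = G.edgeSet.ncard - 4 := by
    rw [Set.ncard_sdiff hDG, Set.ncard_coe_finset, hD]
  have hmaps : ∀ e ∈ G.edgeSet,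
      (if e ∈ F₁ then f₁ e else if e ∈ F₂ then f₂ e else e) ∈ G.edgeSet \ D := by
    intro e he
    simp only [D, Finset.coe_insert, Finset.coe_singleton, Set.mem_sdiff, Set.mem_insert_iff,
      Set.mem_singleton_iff]
    by_cases k₁ : e ∈ F₁
    · have := hG₁ (m₁ e k₁).1
      grind
    · by_cases k₂ : e ∈ F₂
      · have := hG₂ (m₂ e k₂).1
        grind
      · grind
  rw [← hcard]
  exact rc_le_of_isRainbowConnected (Set.toFinite _) ⟨_, hmaps a₁ (hG₁ l₁)⟩ _ hmaps hc
end

section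
/- Let G be a nontrivial connected graph and let H be a subdivision of G. Then rc(H) ≤ rc(G) + |E(H)| − |E(G)|. -/
/-- The graph obtained from `G` by subdividing the edge `uv`: the edge `uv` is
deleted, a new vertex (`none`) is added and joined to `u` and to `v`. -/
def subdivideEdge {V : Type} (G : SimpleGraph V) (u v : V) : SimpleGraph (Option V) :=
  SimpleGraph.fromRel (fun a b =>
    (∃ x y : V, a = some x ∧ b = some y ∧ G.Adj x y ∧ s(x, y) ≠ s(u, v))
    ∨ (a = none ∧ (b = some u ∨ b = some v)))

/-- `IsSubdivision G H` : `H` is obtained from `G` (up to isomorphism) by a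
possibly empty sequence of edge subdivisions. -/
inductive IsSubdivision : {V W : Type} → SimpleGraph V → SimpleGraph W → Prop
  | refl {V : Type} (G : SimpleGraph V) : IsSubdivision G G
  | step {V W W' : Type} {G : SimpleGraph V} {H : SimpleGraph W} {H' : SimpleGraph W'}
      (u v : W) (huv : H.Adj u v) (hsub : IsSubdivision G H)
      (iso : Nonempty (H' ≃g subdivideEdge H u v)) : IsSubdivision G H'

open SimpleGraph

theorem IsRainbowConnected.comp_injective {V α β : Type*} {G : SimpleGraph V} {c : Sym2 V → α}
    (h : IsRainbowConnected G c) {f : α → β} (hf : Function.Injective f) :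
    IsRainbowConnected G (f ∘ c) := by
  intro a b
  obtain ⟨p, hp, hc⟩ := h a b
  refine ⟨p, hp, ?_⟩
  rw [← List.map_map]
  exact hc.map hf

theorem IsRainbowConnected.of_iso {V W α : Type*} {G : SimpleGraph V} {H : SimpleGraph W}
    {c : Sym2 V → α} (h : IsRainbowConnected G c) (f : H ≃g G) :
    IsRainbowConnected H (c ∘ Sym2.map f) := by
  intro a b
  obtain ⟨p, hp, hc⟩ := h (f a) (f b)
  refine ⟨(p.map f.symm.toHom).copy (by simp) (by simp), ?_, ?_⟩
  · rw [Walk.isPath_copy]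
    exact hp.map f.symm.injective
  · have key : (c ∘ Sym2.map f) ∘ Sym2.map f.symm.toHom = c := by
      funext e
      induction e using Sym2.ind with
      | _ x y => simp
    rwa [Walk.edges_copy, Walk.edges_map, List.map_map, key]

/-- In a finite connected graph, finitely many colors suffice for rainbow connection. -/
theorem SimpleGraph.Connected.exists_isRainbowConnected {V : Type*} [Finite V]
    {G : SimpleGraph V} (h : G.Connected) :
    ∃ k, ∃ c : Sym2 V → Fin k, IsRainbowConnected G c := by
  have : Finite (Sym2 V) := Quot.finite _
  obtain ⟨k, ⟨f⟩⟩ := Finite.exists_equiv_fin (Sym2 V)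
  refine ⟨k, f, fun a b => ?_⟩
  obtain ⟨p, hp⟩ := (h.preconnected a b).exists_isPath
  exact ⟨p, hp, hp.isTrail.edges_nodup.map f.injective⟩

section SubdivideEdge

variable {V : Type} {G : SimpleGraph V} {u v : V}

@[simp]
theorem subdivideEdge_adj_some_some {a b : V} :
    (subdivideEdge G u v).Adj (some a) (some b) ↔ G.Adj a b ∧ s(a, b) ≠ s(u, v) := by
  have := G.adj_comm a b
  have : s(b, a) = s(a, b) := Sym2.eq_swap
  have : G.Adj a b → a ≠ b := fun h => h.ne
  simp [subdivideEdge, SimpleGraph.fromRel_adj]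
  grind

@[simp]
theorem subdivideEdge_adj_none_some {a : V} :
    (subdivideEdge G u v).Adj none (some a) ↔ a = u ∨ a = v := by
  simp [subdivideEdge, SimpleGraph.fromRel_adj]

theorem edgeSet_subdivideEdge :
    (subdivideEdge G u v).edgeSet =
      Sym2.map some '' (G.edgeSet \ {s(u, v)}) ∪ {s(none, some u), s(none, some v)} := by
  ext e
  induction e using Sym2.ind with
  | _ x y =>
    have key : ∀ a b : V, s(some a, some b) ∈ Sym2.map some '' (G.edgeSet \ {s(u, v)}) ↔
        s(a, b) ∈ G.edgeSet \ {s(u, v)} := fun a b => by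
      rw [← Sym2.map_mk, (Sym2.map.injective (Option.some_injective V)).mem_set_image]
    have key' : ∀ b : Option V, s(none, b) ∉ Sym2.map some '' (G.edgeSet \ {s(u, v)}) := by
      rintro b ⟨e, -, he⟩
      have : none ∈ Sym2.map (some : V → Option V) e := he ▸ Sym2.mem_mk_left _ _
      simp [Sym2.mem_map] at this
    rcases x with _ | a <;> rcases y with _ | b
    · simp [key']
    · simp [key']
    · rw [Sym2.eq_swap]
      simp [key']
    · rw [Set.mem_union, key]
      simp

theorem ncard_edgeSet_subdivideEdge [Finite V] (h : G.Adj u v) :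
    (subdivideEdge G u v).edgeSet.ncard = G.edgeSet.ncard + 1 := by
  have : Finite (Sym2 V) := Quot.finite _
  have : Finite (Sym2 (Option V)) := Quot.finite _
  have hd : Disjoint (Sym2.map some '' (G.edgeSet \ {s(u, v)}))
      {s(none, some u), s(none, some v)} := by
    rw [Set.disjoint_left]
    rintro _ ⟨e, -, rfl⟩ he
    have : none ∈ Sym2.map (some : V → Option V) e := by
      rcases he with he | he <;> exact he ▸ Sym2.mem_mk_left _ _
    simp [Sym2.mem_map] at this
  rw [edgeSet_subdivideEdge, Set.ncard_union_eq hd (Set.toFinite _) (Set.toFinite _),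
    Set.ncard_image_of_injective _ (Sym2.map.injective (Option.some_injective V)),
    Set.ncard_pair (by simpa using h.ne),
    ← Set.ncard_sdiff_singleton_add_one ((mem_edgeSet G).2 h) (Set.toFinite _)]

/-- The coloring of the subdivision in which the half at `u` of the edge `uv` inherits the color
of `uv`, the half at `v` gets the new color `none`, and other edges keep their color. -/
noncomputable def subdivideColoring {α : Type*} (v : V) (c : Sym2 V → α) (e : Sym2 (Option V)) :
    Option α :=
  open Classical in
  if e = s(none, some v) then none else some (c (e.map fun o => o.getD v))

variable {α : Type*} {c : Sym2 V → α}

@[simp]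
theorem subdivideColoring_some_some (a b : V) :
    subdivideColoring v c s(some a, some b) = some (c s(a, b)) := by
  simp [subdivideColoring]

@[simp]
theorem subdivideColoring_none_some_self :
    subdivideColoring v c s(none, some v) = none := by
  simp [subdivideColoring]

theorem subdivideColoring_none_some_of_ne (h : u ≠ v) :
    subdivideColoring v c s(none, some u) = some (c s(u, v)) := by
  simp [subdivideColoring, h, Sym2.eq_swap]

/-- A rainbow path lifts to a rainbow path of the subdivision, with control on the vertices and
colors used. -/
theorem exists_lift_subdivideEdge (huv : G.Adj u v) {a b : V} (p : G.Walk a b) (hp : p.IsPath)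
    (hc : (p.edges.map c).Nodup) :
    ∃ q : (subdivideEdge G u v).Walk (some a) (some b),
      q.IsPath ∧ (q.edges.map (subdivideColoring v c)).Nodup ∧
      (∀ x, some x ∈ q.support → x ∈ p.support) ∧
      (none ∈ q.support → s(u, v) ∈ p.edges) ∧
      (∀ i, some i ∈ q.edges.map (subdivideColoring v c) → i ∈ p.edges.map c) ∧
      (none ∈ q.edges.map (subdivideColoring v c) → s(u, v) ∈ p.edges) := by
  induction p with
  | nil => exact ⟨Walk.nil, by simp⟩
  | @cons a d b h p ih =>
    rw [Walk.cons_isPath_iff] at hp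
    rw [Walk.edges_cons, List.map_cons, List.nodup_cons] at hc
    obtain ⟨q, hq, hqc, h1, h2, h3, h4⟩ := ih hp.1 hc.2
    by_cases he : s(a, d) = s(u, v)
    · have hnot : s(u, v) ∉ p.edges := fun hm => hc.1 (he ▸ List.mem_map_of_mem hm)
      have hcol : some (c s(u, v)) ∉ q.edges.map (subdivideColoring v c) :=
        fun hm => hc.1 (he ▸ h3 _ hm)
      have hn1 : none ∉ q.support := fun hm => hnot (h2 hm)
      have hn2 : none ∉ q.edges.map (subdivideColoring v c) := fun hm => hnot (h4 hm)
      have hs : some a ∉ q.support := fun hm => hp.2 (h1 _ hm)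
      have hadj : ∀ x ∈ s(u, v), (subdivideEdge G u v).Adj none (some x) := by simp
      have ha := hadj a (he ▸ Sym2.mem_mk_left _ _)
      have hd := hadj d (he ▸ Sym2.mem_mk_right _ _)
      have hcols : (subdivideColoring v c s(some a, none) = some (c s(u, v)) ∧
          subdivideColoring v c s(none, some d) = none) ∨
          (subdivideColoring v c s(some a, none) = none ∧
          subdivideColoring v c s(none, some d) = some (c s(u, v))) := by
        rw [Sym2.eq_swap (a := some a)]
        rcases Sym2.eq_iff.1 he with ⟨rfl, rfl⟩ | ⟨rfl, rfl⟩
        · simp [subdivideColoring_none_some_of_ne huv.ne]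
        · simp [subdivideColoring_none_some_of_ne huv.ne]
      refine ⟨Walk.cons ha.symm (Walk.cons hd q), ?_, ?_, ?_, ?_, ?_, ?_⟩
      · simp [Walk.cons_isPath_iff, hq, hn1, hs]
      · simp only [Walk.edges_cons, List.map_cons, List.nodup_cons, List.mem_cons]
        rcases hcols with ⟨e1, e2⟩ | ⟨e1, e2⟩ <;> rw [e1, e2] <;> simp_all
      · simp only [Walk.support_cons, List.mem_cons]
        grind
      · simp [he]
      · simp only [Walk.edges_cons, List.map_cons, List.mem_cons, he]
        grind
      · simp [he]
    · have hadj : (subdivideEdge G u v).Adj (some a) (some d) := by simp [h, he]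
      have hs : some a ∉ q.support := fun hm => hp.2 (h1 _ hm)
      refine ⟨Walk.cons hadj q, ?_, ?_, ?_, ?_, ?_, ?_⟩
      · simp [Walk.cons_isPath_iff, hq, hs]
      · rw [Walk.edges_cons, List.map_cons, List.nodup_cons, subdivideColoring_some_some]
        exact ⟨fun hm => hc.1 (h3 _ hm), hqc⟩
      · simp only [Walk.support_cons, List.mem_cons]
        grind
      · simp only [Walk.support_cons, Walk.edges_cons, List.mem_cons]
        grind
      · simp only [Walk.edges_cons, List.map_cons, List.mem_cons, subdivideColoring_some_some]
        grind
      · simp only [Walk.edges_cons, List.map_cons, List.mem_cons, subdivideColoring_some_some]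
        grind

theorem IsRainbowConnected.subdivideEdge (h : IsRainbowConnected G c) (huv : G.Adj u v) :
    IsRainbowConnected (subdivideEdge G u v) (subdivideColoring v c) := by
  have hnone : ∀ b : V, ∃ q : (_root_.subdivideEdge G u v).Walk none (some b),
      q.IsPath ∧ (q.edges.map (subdivideColoring v c)).Nodup := by
    intro b
    obtain ⟨p, hp, hc⟩ := h v b
    by_cases he : s(u, v) ∈ p.edges
    · cases p with
      | nil => simp at he
      | @cons _ d _ hvd p =>
        rw [Walk.cons_isPath_iff] at hp
        rw [Walk.edges_cons, List.map_cons, List.nodup_cons] at hc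
        have hnot : s(u, v) ∉ p.edges := fun hm => hp.2 (p.snd_mem_support_of_mem_edges hm)
        obtain rfl : u = d := by
          rw [Walk.edges_cons, List.mem_cons] at he
          have := huv.ne
          simpa [hnot, this] using he
        obtain ⟨q, hq, hqc, -, h2, h3, -⟩ := exists_lift_subdivideEdge huv p hp.1 hc.2
        refine ⟨Walk.cons (by simp) q, ?_, ?_⟩
        · rw [Walk.cons_isPath_iff]
          exact ⟨hq, fun hm => hnot (h2 hm)⟩
        · rw [Walk.edges_cons, List.map_cons, List.nodup_cons,
            subdivideColoring_none_some_of_ne huv.ne, Sym2.eq_swap]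
          exact ⟨fun hm => hc.1 (h3 _ hm), hqc⟩
    · obtain ⟨q, hq, hqc, -, h2, -, h4⟩ := exists_lift_subdivideEdge huv p hp hc
      refine ⟨Walk.cons (by simp) q, ?_, ?_⟩
      · rw [Walk.cons_isPath_iff]
        exact ⟨hq, fun hm => he (h2 hm)⟩
      · rw [Walk.edges_cons, List.map_cons, List.nodup_cons, subdivideColoring_none_some_self]
        exact ⟨fun hm => he (h4 hm), hqc⟩
  rintro (_ | a) (_ | b)
  · exact ⟨Walk.nil, by simp⟩
  · exact hnone b
  · obtain ⟨q, hq, hqc⟩ := hnone a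
    refine ⟨q.reverse, hq.reverse, ?_⟩
    rwa [Walk.edges_reverse, List.map_reverse, List.nodup_reverse]
  · obtain ⟨p, hp, hc⟩ := h a b
    obtain ⟨q, hq, hqc, -⟩ := exists_lift_subdivideEdge huv p hp hc
    exact ⟨q, hq, hqc⟩

end SubdivideEdge

theorem IsSubdivision.exists_isRainbowConnected {V W : Type} {G : SimpleGraph V}
    {H : SimpleGraph W} (hsub : IsSubdivision G H) (hV : Finite V) {k : ℕ}
    (hG : ∃ c : Sym2 V → Fin k, IsRainbowConnected G c) :
    Finite W ∧ ∃ n, H.edgeSet.ncard = G.edgeSet.ncard + n ∧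
      ∃ c : Sym2 W → Fin (k + n), IsRainbowConnected H c := by
  induction hsub with
  | refl G => exact ⟨hV, 0, rfl, hG⟩
  | step u v huv _ iso ih =>
    obtain ⟨hW, n, hn, c, hc⟩ := ih hG
    obtain ⟨f⟩ := iso
    refine ⟨Finite.of_equiv _ f.toEquiv.symm, n + 1, ?_, _,
      ((hc.subdivideEdge huv).of_iso f).comp_injective (finSuccEquiv (k + n)).symm.injective⟩
    rw [← add_assoc, ← hn, ← ncard_edgeSet_subdivideEdge huv]
    exact Nat.card_congr f.mapEdgeSet

/-- If `H` is a subdivision of a nontrivial connected graph `G`,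
then rc(H) ≤ rc(G) + |E(H)| − |E(G)|. -/
theorem stmt_5 {V W : Type} [Fintype V] [Fintype W]
    (G : SimpleGraph V) (H : SimpleGraph W)
    (hconn : G.Connected) (hV : Nontrivial V)
    (hsub : IsSubdivision G H) :
    rc H ≤ rc G + (H.edgeSet.ncard - G.edgeSet.ncard) := by
  have hG : ∃ c : Sym2 V → Fin (rc G), IsRainbowConnected G c :=
    Nat.sInf_mem (s := {k | ∃ c : Sym2 V → Fin k, IsRainbowConnected G c})
      hconn.exists_isRainbowConnected
  obtain ⟨-, n, hn, hH⟩ := hsub.exists_isRainbowConnected inferInstance hG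
  rw [hn, Nat.add_sub_cancel_left]
  exact Nat.sInf_le hH
end

section
/- If G is a Θ-graph with m ≥ 6 edges, then rc(G) ≤ m − 4. -/
/-- `IsThetaGraph G a b c` : `G` consists of three internally disjoint paths
with common end vertices and lengths `a ≤ b ≤ c`, where `1 ≤ a` and `2 ≤ b`
(so that the graph is simple). It has `a + b + c` edges. -/
def IsThetaGraph {V : Type*} (G : SimpleGraph V) (a b c : ℕ) : Prop :=
  ∃ (u v : V) (P₁ P₂ P₃ : G.Walk u v),
    P₁.IsPath ∧ P₂.IsPath ∧ P₃.IsPath ∧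
    P₁.length = a ∧ P₂.length = b ∧ P₃.length = c ∧
    1 ≤ a ∧ a ≤ b ∧ b ≤ c ∧ 2 ≤ b ∧
    ({x | x ∈ P₁.support} ∩ {x | x ∈ P₂.support} = {u, v}) ∧
    ({x | x ∈ P₁.support} ∩ {x | x ∈ P₃.support} = {u, v}) ∧
    ({x | x ∈ P₂.support} ∩ {x | x ∈ P₃.support} = {u, v}) ∧
    (∀ x : V, x ∈ P₁.support ∨ x ∈ P₂.support ∨ x ∈ P₃.support) ∧
    G.edgeSet = {e | e ∈ P₁.edges} ∪ {e | e ∈ P₂.edges} ∪ {e | e ∈ P₃.edges}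

/-- Color the elements of `A` with one color, those of `B` with a second one, and all other
elements of `E` with pairwise distinct further colors. -/
theorem exists_coloring_two_classes {α : Type*} {E : Set α} (hE : E.Finite) {A B : List α}
    (hAB : (A ++ B).Nodup) (hsub : ∀ e ∈ A ++ B, e ∈ E) {k : ℕ}
    (hk : (A ++ B).length = k + 2) :
    ∃ c : α → Fin (E.ncard - k), ∀ e ∈ E, ∀ e' ∈ E, c e = c e' →
      e = e' ∨ (e ∈ A ∧ e' ∈ A) ∨ (e ∈ B ∧ e' ∈ B) := by
  classical
  have hcard : ((A ++ B).toFinset).card = k + 2 := by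
    rw [List.toFinset_card_of_nodup hAB, hk]
  have hss : (A ++ B).toFinset ⊆ hE.toFinset := fun e he => by
    simpa using hsub e (List.mem_toFinset.1 he)
  have hle : k + 2 ≤ E.ncard := by
    rw [Set.ncard_eq_toFinset_card E hE, ← hcard]
    exact Finset.card_le_card hss
  let R := hE.toFinset \ (A ++ B).toFinset
  have hR : R.card = E.ncard - (k + 2) := by
    rw [Finset.card_sdiff_of_subset hss, hcard, Set.ncard_eq_toFinset_card E hE]
  let g : R ≃ Fin (E.ncard - (k + 2)) := R.equivFinOfCardEq hR
  refine ⟨fun e => if e ∈ A then ⟨0, by omega⟩ else if e ∈ B then ⟨1, by omega⟩ else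
    if h : e ∈ R then ⟨(g ⟨e, h⟩ : ℕ) + 2, by have := (g ⟨e, h⟩).2; omega⟩ else ⟨0, by omega⟩, ?_⟩
  intro e he e' he' hc
  have mem_R : ∀ x ∈ E, x ∉ A → x ∉ B → x ∈ R := fun x hx hA hB => by simp [R, hx, hA, hB]
  have inj : ∀ (h : e ∈ R) (h' : e' ∈ R), (g ⟨e, h⟩ : ℕ) = g ⟨e', h'⟩ → e = e' :=
    fun h h' hg => congrArg Subtype.val (g.injective (Fin.ext hg))
  have hmem := mem_R e he
  have hmem' := mem_R e' he'
  by_cases h1 : e ∈ A <;> by_cases h2 : e' ∈ A <;> by_cases h3 : e ∈ B <;>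
    by_cases h4 : e' ∈ B <;> simp_all

namespace SimpleGraph.Walk

variable {V : Type*} {G : SimpleGraph V}

theorem IsPath.exists_end_edges {u v : V} {P : G.Walk u v} (hP : P.IsPath) (hl : 2 ≤ P.length) :
    ∃ f g : Sym2 V, f ∈ P.edges ∧ g ∈ P.edges ∧ u ∈ f ∧ v ∉ f ∧ v ∈ g ∧ u ∉ g ∧
      s(u, v) ∉ P.edges := by
  have first : ∀ {x y : V} (Q : G.Walk x y), Q.IsPath → 2 ≤ Q.length →
      ∃ f ∈ Q.edges, x ∈ f ∧ y ∉ f ∧ s(x, y) ∉ Q.edges := by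
    intro x y Q hQ hl
    cases Q with
    | nil => simp at hl
    | @cons _ p _ h Q =>
      rw [cons_isPath_iff] at hQ
      have hpy : y ≠ p := by
        rintro rfl
        have hnil := length_eq_zero_iff.2 (isPath_iff_nil.1 hQ.1)
        simp [hnil] at hl
      have hxy : y ≠ x := fun h => hQ.2 (h ▸ Q.end_mem_support)
      refine ⟨s(x, p), by simp, by simp, by simp [hxy, hpy], ?_⟩
      rw [edges_cons, List.mem_cons, not_or]
      exact ⟨by simp [hpy, h.ne], fun he => hQ.2 (Q.fst_mem_support_of_mem_edges he)⟩
  obtain ⟨f, hf, huf, hvf, huv⟩ := first P hP hl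
  obtain ⟨g, hg, hvg, hug, -⟩ := first P.reverse hP.reverse (by simpa using hl)
  exact ⟨f, g, hf, by simpa using hg, huf, hvf, hvg, hug, huv⟩

theorem notMem_edges_of_meet_at_ends {u v u' v' : V} {P : G.Walk u v} {Q : G.Walk u' v'}
    (hPQ : ∀ z ∈ P.support, z ∈ Q.support → z = u ∨ z = v) (huv : s(u, v) ∉ P.edges) :
    ∀ e ∈ P.edges, e ∉ Q.edges := by
  intro e hP hQ
  induction e with
  | h a b =>
    have hab := P.adj_of_mem_edges hP
    rcases hPQ a (P.fst_mem_support_of_mem_edges hP) (Q.fst_mem_support_of_mem_edges hQ)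
      with rfl | rfl <;>
    rcases hPQ b (P.snd_mem_support_of_mem_edges hP) (Q.snd_mem_support_of_mem_edges hQ)
      with rfl | rfl
    exacts [hab.ne rfl, huv hP, huv (Sym2.eq_swap ▸ hP), hab.ne rfl]

theorem IsPath.exists_initial_segment {u v x : V} {P : G.Walk u v} (hP : P.IsPath)
    (hx : x ∈ P.support) :
    ∃ p : G.Walk u x, p.IsPath ∧ p.edges ⊆ P.edges ∧ p.support ⊆ P.support ∧
      (v ∈ p.support → x = v) := by
  classical
  refine ⟨P.takeUntil x hx, hP.takeUntil hx, P.edges_takeUntil_subset_edges hx,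
    P.support_takeUntil_subset_support hx, fun hv => ?_⟩
  by_contra hne
  exact endpoint_notMem_support_takeUntil hP hx (Ne.symm hne) hv

theorem IsPath.exists_segment {u v x y : V} {P : G.Walk u v} (hP : P.IsPath)
    (hx : x ∈ P.support) (hy : y ∈ P.support) :
    ∃ p : G.Walk x y, p.IsPath ∧ p.edges ⊆ P.edges ∧
      (u ∈ p.support → x = u ∨ y = u) ∧ (v ∈ p.support → x = v ∨ y = v) := by
  classical
  have happ := hP.support_nodup
  rw [← P.take_spec hx, support_append] at happ
  rw [← P.take_spec hx, mem_support_append_iff] at hy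
  rcases hy with hy | hy
  · obtain ⟨q, hq, hqe, hqs, hqu⟩ :=
      (hP.takeUntil hx).reverse.exists_initial_segment (x := y) (by simpa using hy)
    refine ⟨q, hq, fun e he => P.edges_takeUntil_subset_edges hx (by simpa using hqe he),
      fun h => .inr (hqu h), fun h => ?_⟩
    by_contra! hne
    exact endpoint_notMem_support_takeUntil hP hx hne.1.symm (by simpa using hqs h)
  · obtain ⟨q, hq, hqe, hqs, hqv⟩ := (hP.dropUntil hx).exists_initial_segment hy
    refine ⟨q, hq, fun e he => P.edges_dropUntil_subset_edges hx (hqe he), fun h => ?_,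
      fun h => .inr (hqv h)⟩
    have hu := hqs h
    rw [← cons_tail_support, List.mem_cons] at hu
    rcases hu with hu | hu
    · exact .inl hu.symm
    · exact absurd rfl ((List.nodup_append.1 happ).2.2 u (start_mem_support _) u hu)

theorem IsPath.reverse_append {u x y : V} {p : G.Walk u x} {q : G.Walk u y} (hp : p.IsPath)
    (hq : q.IsPath) (h : ∀ z ∈ p.support, z ∈ q.support → z = u) :
    (p.reverse.append q).IsPath := by
  rw [isPath_def, support_append, List.nodup_append]
  have hq' := hq.support_nodup
  rw [← q.cons_tail_support, List.nodup_cons] at hq'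
  refine ⟨hp.reverse.support_nodup, hq'.2, ?_⟩
  rintro a ha _ hb rfl
  exact hq'.1 (h a (by simpa using ha) (List.mem_of_mem_tail hb) ▸ hb)

/-- Two paths leaving `u` and meeting only at `u` and possibly at `v` join their vertices other
than `v` by paths avoiding `v`. -/
theorem IsPath.exists_path_through_start {u v v' x y : V} {P : G.Walk u v} {Q : G.Walk u v'}
    (hP : P.IsPath) (hQ : Q.IsPath) (hPQ : ∀ z ∈ P.support, z ∈ Q.support → z = u ∨ z = v)
    (hx : x ∈ P.support) (hy : y ∈ Q.support) (hxv : x ≠ v) (hyv : y ≠ v') :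
    ∃ p : G.Walk x y, p.IsPath ∧
      ∀ e ∈ p.edges, (e ∈ P.edges ∧ v ∉ e) ∨ (e ∈ Q.edges ∧ v' ∉ e) := by
  obtain ⟨p, hp, hpe, hps, hpv⟩ := hP.exists_initial_segment hx
  obtain ⟨q, hq, hqe, hqs, hqv⟩ := hQ.exists_initial_segment hy
  refine ⟨p.reverse.append q, hp.reverse_append hq fun z hz hz' => ?_, fun e he => ?_⟩
  · rcases hPQ z (hps hz) (hqs hz') with h | rfl
    · exact h
    · exact absurd (hpv hz) hxv
  · rw [edges_append, List.mem_append, edges_reverse, List.mem_reverse] at he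
    exact he.imp (fun h => ⟨hpe h, fun hv => hxv (hpv (p.mem_support_of_mem_edges h hv))⟩)
      (fun h => ⟨hqe h, fun hv => hyv (hqv (q.mem_support_of_mem_edges h hv))⟩)

end SimpleGraph.Walk

open SimpleGraph

/-- `x` and `y` are joined by a path with at most one edge in `A` and at most one in `B`. -/
def JoinedByTransversal {V : Type*} (G : SimpleGraph V) (A B : List (Sym2 V)) (x y : V) : Prop :=
  ∃ (p : G.Walk x y) (α β : Sym2 V), p.IsPath ∧
    ∀ e ∈ p.edges, (e ∈ A → e = α) ∧ (e ∈ B → e = β)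

theorem JoinedByTransversal.symm {V : Type*} {G : SimpleGraph V} {A B : List (Sym2 V)} {x y : V}
    (h : JoinedByTransversal G A B x y) : JoinedByTransversal G A B y x := by
  obtain ⟨p, α, β, hp, h⟩ := h
  exact ⟨p.reverse, α, β, hp.reverse, fun e he => h e (by simpa using he)⟩

/-- Rainbow connectedness with `|E| - 4` colors, where the edges of `A` share one color, those of
`B` another one, and all other colors are used once. -/
theorem rc_le_of_two_classes {V : Type*} [Finite V] {G : SimpleGraph V} {A B : List (Sym2 V)}
    (hAB : (A ++ B).Nodup) (hsub : ∀ e ∈ A ++ B, e ∈ G.edgeSet) (hlen : (A ++ B).length = 6)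
    (hpath : ∀ x y : V, JoinedByTransversal G A B x y) :
    rc G ≤ G.edgeSet.ncard - 4 := by
  obtain ⟨c, hc⟩ := exists_coloring_two_classes G.edgeSet.toFinite hAB hsub (k := 4) hlen
  refine Nat.sInf_le ⟨c, fun x y => ?_⟩
  obtain ⟨p, α, β, hp, h⟩ := hpath x y
  refine ⟨p, hp, hp.isTrail.edges_nodup.map_on fun e he e' he' hee => ?_⟩
  rcases hc e (p.edges_subset_edgeSet he) e' (p.edges_subset_edgeSet he') hee with
    heq | ⟨h1, h2⟩ | ⟨h1, h2⟩
  · exact heq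
  · rw [(h e he).1 h1, (h e' he').1 h2]
  · rw [(h e he).2 h1, (h e' he').2 h2]

theorem rc_le_of_three_long_paths {V : Type*} [Finite V] {G : SimpleGraph V} {u v : V}
    {P₁ P₂ P₃ : G.Walk u v} (h₁ : P₁.IsPath) (h₂ : P₂.IsPath) (h₃ : P₃.IsPath)
    (hl₁ : 2 ≤ P₁.length) (hl₂ : 2 ≤ P₂.length) (hl₃ : 2 ≤ P₃.length)
    (h₁₂ : ∀ z ∈ P₁.support, z ∈ P₂.support → z = u ∨ z = v)
    (h₁₃ : ∀ z ∈ P₁.support, z ∈ P₃.support → z = u ∨ z = v)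
    (h₂₃ : ∀ z ∈ P₂.support, z ∈ P₃.support → z = u ∨ z = v)
    (hcov : ∀ x : V, x ∈ P₁.support ∨ x ∈ P₂.support ∨ x ∈ P₃.support) :
    rc G ≤ G.edgeSet.ncard - 4 := by
  obtain ⟨f₁, g₁, hf₁, hg₁, huf₁, hvf₁, hvg₁, hug₁, huv₁⟩ := h₁.exists_end_edges hl₁
  obtain ⟨f₂, g₂, hf₂, hg₂, huf₂, hvf₂, hvg₂, hug₂, huv₂⟩ := h₂.exists_end_edges hl₂
  obtain ⟨f₃, g₃, hf₃, hg₃, huf₃, hvf₃, hvg₃, hug₃, huv₃⟩ := h₃.exists_end_edges hl₃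
  have d₁₂ := Walk.notMem_edges_of_meet_at_ends h₁₂ huv₁
  have d₁₃ := Walk.notMem_edges_of_meet_at_ends h₁₃ huv₁
  have d₂₃ := Walk.notMem_edges_of_meet_at_ends h₂₃ huv₂
  obtain ⟨A, hA'⟩ : ∃ A, A = [f₁, g₂, f₃, g₃] := ⟨_, rfl⟩
  obtain ⟨B, hB'⟩ : ∃ B, B = [g₁, f₂] := ⟨_, rfl⟩
  have hA : ∀ e, e ∈ A ↔ e = f₁ ∨ e = g₂ ∨ e = f₃ ∨ e = g₃ := by simp [hA']
  have hB : ∀ e, e ∈ B ↔ e = g₁ ∨ e = f₂ := by simp [hB']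
  refine rc_le_of_two_classes (A := A) (B := B) ?_ ?_ (by simp [hA', hB']) ?_
  · simp only [hA', hB', List.cons_append, List.nil_append, List.nodup_cons, List.mem_cons,
      List.not_mem_nil, or_false, not_or, List.nodup_nil, not_false_eq_true, and_true]
    refine ⟨⟨?_, ?_, ?_, ?_, ?_⟩, ⟨?_, ?_, ?_, ?_⟩, ⟨?_, ?_, ?_⟩, ⟨?_, ?_⟩, ?_⟩ <;> grind
  · intro e he
    simp only [hA', hB', List.cons_append, List.nil_append, List.mem_cons, List.not_mem_nil,
      or_false] at he
    rcases he with rfl | rfl | rfl | rfl | rfl | rfl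
    exacts [P₁.edges_subset_edgeSet hf₁, P₂.edges_subset_edgeSet hg₂, P₃.edges_subset_edgeSet hf₃,
      P₃.edges_subset_edgeSet hg₃, P₁.edges_subset_edgeSet hg₁, P₂.edges_subset_edgeSet hf₂]
  clear hA' hB'
  have same₁ : ∀ x ∈ P₁.support, ∀ y ∈ P₁.support, JoinedByTransversal G A B x y := by
    intro x hx y hy
    obtain ⟨p, hp, hpe, -⟩ := h₁.exists_segment hx hy
    refine ⟨p, f₁, g₁, hp, fun e he => ?_⟩
    have := hpe he
    grind
  have same₂ : ∀ x ∈ P₂.support, ∀ y ∈ P₂.support, JoinedByTransversal G A B x y := by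
    intro x hx y hy
    obtain ⟨p, hp, hpe, -⟩ := h₂.exists_segment hx hy
    refine ⟨p, g₂, f₂, hp, fun e he => ?_⟩
    have := hpe he
    grind
  have same₃ : ∀ x ∈ P₃.support, ∀ y ∈ P₃.support, JoinedByTransversal G A B x y := by
    intro x hx y hy
    by_cases hxy : (x = u ∨ x = v) ∧ (y = u ∨ y = v)
    · have hx₁ : x ∈ P₁.support := by rcases hxy.1 with rfl | rfl <;> simp
      have hy₁ : y ∈ P₁.support := by rcases hxy.2 with rfl | rfl <;> simp
      exact same₁ x hx₁ y hy₁
    obtain ⟨p, hp, hpe, hpu, hpv⟩ := h₃.exists_segment hx hy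
    by_cases hup : u ∈ p.support
    · refine ⟨p, f₃, g₁, hp, fun e he => ?_⟩
      have := hpe he
      have : v ∈ e → v ∈ p.support := p.mem_support_of_mem_edges he
      grind
    · refine ⟨p, g₃, g₁, hp, fun e he => ?_⟩
      have := hpe he
      have : u ∈ e → u ∈ p.support := p.mem_support_of_mem_edges he
      grind
  have cross₁₂ : ∀ x ∈ P₁.support, ∀ y ∈ P₂.support, JoinedByTransversal G A B x y := by
    intro x hx y hy
    by_cases hx' : x = u ∨ x = v
    · exact same₂ x (by rcases hx' with rfl | rfl <;> simp) y hy
    by_cases hy' : y = u ∨ y = v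
    · exact same₁ x hx y (by rcases hy' with rfl | rfl <;> simp)
    push Not at hx' hy'
    obtain ⟨p, hp, hpe⟩ := h₁.exists_path_through_start h₂ h₁₂ hx hy hx'.2 hy'.2
    refine ⟨p, f₁, f₂, hp, fun e he => ?_⟩
    have := hpe e he
    grind
  have cross₁₃ : ∀ x ∈ P₁.support, ∀ y ∈ P₃.support, JoinedByTransversal G A B x y := by
    intro x hx y hy
    by_cases hx' : x = u ∨ x = v
    · exact same₃ x (by rcases hx' with rfl | rfl <;> simp) y hy
    by_cases hy' : y = u ∨ y = v
    · exact same₁ x hx y (by rcases hy' with rfl | rfl <;> simp)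
    push Not at hx' hy'
    obtain ⟨p, hp, hpe⟩ := h₁.reverse.exists_path_through_start h₃.reverse (x := x) (y := y)
      (fun z hz hz' => (h₁₃ z (by simpa using hz) (by simpa using hz')).symm)
      (by simpa using hx) (by simpa using hy) hx'.1 hy'.1
    simp only [Walk.edges_reverse, List.mem_reverse] at hpe
    refine ⟨p, g₃, g₁, hp, fun e he => ?_⟩
    have := hpe e he
    grind
  have cross₂₃ : ∀ x ∈ P₂.support, ∀ y ∈ P₃.support, JoinedByTransversal G A B x y := by
    intro x hx y hy
    by_cases hx' : x = u ∨ x = v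
    · exact same₃ x (by rcases hx' with rfl | rfl <;> simp) y hy
    by_cases hy' : y = u ∨ y = v
    · exact same₂ x hx y (by rcases hy' with rfl | rfl <;> simp)
    push Not at hx' hy'
    obtain ⟨p, hp, hpe⟩ := h₂.exists_path_through_start h₃ h₂₃ hx hy hx'.2 hy'.2
    refine ⟨p, f₃, f₂, hp, fun e he => ?_⟩
    have := hpe e he
    grind
  intro x y
  rcases hcov x with hx | hx | hx <;> rcases hcov y with hy | hy | hy
  exacts [same₁ x hx y hy, cross₁₂ x hx y hy, cross₁₃ x hx y hy, (cross₁₂ y hy x hx).symm,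
    same₂ x hx y hy, cross₂₃ x hx y hy, (cross₁₃ y hy x hx).symm, (cross₂₃ y hy x hx).symm,
    same₃ x hx y hy]

theorem rc_le_of_adj_of_two_paths {V : Type*} [Finite V] {G : SimpleGraph V} {u v y : V}
    {P : G.Walk u v} {Q : G.Walk y v} (huv : G.Adj u v) (huy : G.Adj u y) (hP : P.IsPath)
    (hQ : Q.IsPath) (huQ : u ∉ Q.support) (hlP : 2 ≤ P.length) (hlQ : 2 ≤ Q.length)
    (hPQ : ∀ z ∈ P.support, z ∈ Q.support → z = v)
    (hcov : ∀ x : V, x ∈ P.support ∨ x ∈ Q.support) :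
    rc G ≤ G.edgeSet.ncard - 4 := by
  obtain ⟨f, g, hf, hg, huf, hvf, hvg, hug, huvP⟩ := hP.exists_end_edges hlP
  obtain ⟨f', g', hf', hg', hyf', hvf', hvg', hyg', hyvQ⟩ := hQ.exists_end_edges hlQ
  have huQe : ∀ e ∈ Q.edges, u ∉ e := fun e he hu => huQ (Q.mem_support_of_mem_edges he hu)
  have hvy : v ≠ y := fun h => hvf' (h ▸ hyf')
  have hyP : y ∉ P.support := fun h => hvy (hPQ y h (by simp)).symm
  have hyPe : ∀ e ∈ P.edges, y ∉ e := fun e he hy => hyP (P.mem_support_of_mem_edges he hy)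
  have dPQ := Walk.notMem_edges_of_meet_at_ends (fun z hz hz' => .inr (hPQ z hz hz')) huvP
  obtain ⟨d, hd⟩ : ∃ d, d = s(u, v) := ⟨_, rfl⟩
  obtain ⟨k, hk⟩ : ∃ k, k = s(u, y) := ⟨_, rfl⟩
  have hud : u ∈ d := by simp [hd]
  have hyd : y ∉ d := by simp [hd, huy.ne', hvy.symm]
  have huk : u ∈ k := by simp [hk]
  have hyk : y ∈ k := by simp [hk]
  have hdG : d ∈ G.edgeSet := hd ▸ huv
  have hkG : k ∈ G.edgeSet := hk ▸ huy
  rw [← hd] at huvP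
  obtain ⟨A, hA'⟩ : ∃ A, A = [d, f, f', g'] := ⟨_, rfl⟩
  obtain ⟨B, hB'⟩ : ∃ B, B = [g, k] := ⟨_, rfl⟩
  have hA : ∀ e, e ∈ A ↔ e = d ∨ e = f ∨ e = f' ∨ e = g' := by simp [hA']
  have hB : ∀ e, e ∈ B ↔ e = g ∨ e = k := by simp [hB']
  refine rc_le_of_two_classes (A := A) (B := B) ?_ ?_ (by simp [hA', hB']) ?_
  · simp only [hA', hB', List.cons_append, List.nil_append, List.nodup_cons, List.mem_cons,
      List.not_mem_nil, or_false, not_or, List.nodup_nil, not_false_eq_true, and_true]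
    refine ⟨⟨?_, ?_, ?_, ?_, ?_⟩, ⟨?_, ?_, ?_, ?_⟩, ⟨?_, ?_, ?_⟩, ⟨?_, ?_⟩, ?_⟩ <;> grind
  · intro e he
    simp only [hA', hB', List.cons_append, List.nil_append, List.mem_cons, List.not_mem_nil,
      or_false] at he
    rcases he with rfl | rfl | rfl | rfl | rfl | rfl
    exacts [hdG, P.edges_subset_edgeSet hf, Q.edges_subset_edgeSet hf', Q.edges_subset_edgeSet hg',
      P.edges_subset_edgeSet hg, hkG]
  clear hA' hB'
  have sameP : ∀ x ∈ P.support, ∀ w ∈ P.support, JoinedByTransversal G A B x w := by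
    intro x hx w hw
    obtain ⟨r, hr, hre, -⟩ := hP.exists_segment hx hw
    refine ⟨r, f, g, hr, fun e he => ?_⟩
    have := hre he
    grind
  have start : ∀ w ∈ Q.support, JoinedByTransversal G A B u w := by
    intro w hw
    by_cases hwv : w = v
    · subst hwv
      exact sameP u (by simp) w (by simp)
    obtain ⟨r, hr, hre, hrs, hrv⟩ := hQ.exists_initial_segment hw
    refine ⟨.cons huy r, f', k, hr.cons fun h => huQ (hrs h), fun e he => ?_⟩
    rw [Walk.edges_cons, List.mem_cons, ← hk] at he
    have : e ∈ r.edges → e ∈ Q.edges := fun h => hre h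
    have : e ∈ r.edges → v ∈ e → v ∈ r.support := fun h => r.mem_support_of_mem_edges h
    grind
  have second : ∀ x ∈ P.support, x ≠ v → JoinedByTransversal G A B x y := by
    intro x hx hxv
    obtain ⟨r, hr, hre, hrs, hrv⟩ := hP.exists_initial_segment hx
    suffices h : JoinedByTransversal G A B y x from h.symm
    refine ⟨.cons huy.symm r, f, k, hr.cons fun h => hyP (hrs h), fun e he => ?_⟩
    rw [Walk.edges_cons, List.mem_cons, Sym2.eq_swap, ← hk] at he
    have : e ∈ r.edges → e ∈ P.edges := fun h => hre h
    have : e ∈ r.edges → v ∈ e → v ∈ r.support := fun h => r.mem_support_of_mem_edges h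
    grind
  have yv : JoinedByTransversal G A B y v := by
    refine ⟨.cons huy.symm (.cons huv .nil), d, k, by
      simp [huv.ne, huy.ne', hvy.symm], fun e he => ?_⟩
    simp only [Walk.edges_cons, Walk.edges_nil, List.mem_cons, List.not_mem_nil, or_false] at he
    rw [Sym2.eq_swap, ← hk, ← hd] at he
    grind
  have sameQ : ∀ x ∈ Q.support, ∀ w ∈ Q.support, JoinedByTransversal G A B x w := by
    intro x hx w hw
    obtain ⟨r, hr, hre, hry, hrv⟩ := hQ.exists_segment hx hw
    by_cases hyr : y ∈ r.support
    · by_cases hvr : v ∈ r.support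
      · rcases hry hyr with rfl | rfl <;> rcases hrv hvr with rfl | rfl
        exacts [absurd rfl hvy, yv, yv.symm, absurd rfl hvy]
      refine ⟨r, f', g, hr, fun e he => ?_⟩
      have := hre he
      have : v ∈ e → v ∈ r.support := r.mem_support_of_mem_edges he
      grind
    · refine ⟨r, g', g, hr, fun e he => ?_⟩
      have := hre he
      have : y ∈ e → y ∈ r.support := r.mem_support_of_mem_edges he
      grind
  have cross : ∀ x ∈ P.support, ∀ w ∈ Q.support, JoinedByTransversal G A B x w := by
    intro x hx w hw
    by_cases hxu : x = u
    · exact hxu ▸ start w hw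
    by_cases hxv : x = v
    · exact sameQ x (by simp [hxv]) w hw
    by_cases hwy : w = y
    · exact hwy ▸ second x hx hxv
    obtain ⟨r, hr, hre⟩ := hP.reverse.exists_path_through_start hQ.reverse (x := x) (y := w)
      (fun z hz hz' => .inl (hPQ z (by simpa using hz) (by simpa using hz')))
      (by simpa using hx) (by simpa using hw) hxu hwy
    simp only [Walk.edges_reverse, List.mem_reverse] at hre
    refine ⟨r, g', g, hr, fun e he => ?_⟩
    have := hre e he
    grind
  intro x w
  rcases hcov x with hx | hx <;> rcases hcov w with hw | hw
  exacts [sameP x hx w hw, cross x hx w hw, (cross w hw x hx).symm, sameQ x hx w hw]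

/-- If `G` is a Θ-graph with m ≥ 6 edges, then rc(G) ≤ m − 4. -/
theorem stmt_7 {V : Type*} [Fintype V] (G : SimpleGraph V) (a b c : ℕ)
    (hθ : IsThetaGraph G a b c) (hm : 6 ≤ G.edgeSet.ncard) :
    rc G ≤ G.edgeSet.ncard - 4 := by
  obtain ⟨u, v, P₁, P₂, P₃, h₁, h₂, h₃, rfl, rfl, rfl, ha, hab, hbc, hb, h₁₂, h₁₃, h₂₃, hcov, hE⟩ :=
    hθ
  have meet : ∀ {P Q : G.Walk u v}, {x | x ∈ P.support} ∩ {x | x ∈ Q.support} = {u, v} →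
      ∀ z ∈ P.support, z ∈ Q.support → z = u ∨ z = v := fun h z hz hz' => by
    have : z ∈ ({u, v} : Set V) := h ▸ ⟨hz, hz'⟩
    simpa using this
  by_cases h2 : 2 ≤ P₁.length
  · exact rc_le_of_three_long_paths h₁ h₂ h₃ h2 hb (hb.trans hbc) (meet h₁₂) (meet h₁₃) (meet h₂₃)
      hcov
  have hlen : P₁.length = 1 := by omega
  have huv : G.Adj u v := Walk.adj_of_length_eq_one hlen
  have h3 : 3 ≤ P₃.length := by
    classical
    have hle : G.edgeSet.ncard ≤ P₁.length + P₂.length + P₃.length := by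
      have : G.edgeSet = ((P₁.edges ++ P₂.edges ++ P₃.edges).toFinset : Set (Sym2 V)) := by
        rw [hE]; ext e; simp [or_assoc]
      rw [this, Set.ncard_coe_finset]
      exact (List.toFinset_card_le _).trans (by simp [add_assoc])
    omega
  have hcov' : ∀ x, x ∈ P₂.support ∨ x ∈ P₃.support := by
    intro x
    rcases hcov x with hx | hx
    · left
      cases P₁ with
      | nil => simp at hlen
      | cons h p =>
        cases p with
        | nil =>
          simp only [Walk.support_cons, Walk.support_nil, List.mem_cons, List.not_mem_nil,
            or_false] at hx
          rcases hx with rfl | rfl <;> simp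
        | cons => simp at hlen
    · exact hx
  cases P₃ with
  | nil => simp at h3
  | cons huy Q =>
    rw [Walk.cons_isPath_iff] at h₃
    refine rc_le_of_adj_of_two_paths huv huy h₂ h₃.1 h₃.2 hb (by simpa using h3) ?_ ?_
    · intro z hz hzQ
      rcases meet h₂₃ z hz (by simp [hzQ]) with rfl | rfl
      · exact absurd hzQ h₃.2
      · rfl
    · intro x
      rcases hcov' x with hx | hx
      · exact .inl hx
      · rw [Walk.support_cons, List.mem_cons] at hx
        exact hx.imp (fun h => by simp [h]) id
end

section
/- Let G be a connected unicyclic graph with m edges whose unique cycle C = v₁v₂v₃v₁ has length 3 (girth 3). If either l(vᵢ) ≥ 1 for all i ∈ {1,2,3}, or l(vᵢ) ≥ 3 for some i ∈ {1,2,3}, then rc(G) = m − 3. -/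
/-- The set of edges of the cycle `v 0 — v 1 — ⋯ — v (s-1) — v 0`. -/
def cycleEdges {V : Type*} {s : ℕ} (v : ZMod s → V) : Set (Sym2 V) :=
  {e | ∃ i : ZMod s, e = s(v i, v (i + 1))}

/-- `numLeaves G v i` is `l(vᵢ)`: the number of leaves of the tree `T(vᵢ)`
attached at the cycle vertex `vᵢ`, i.e. the number of vertices, other than the
root `vᵢ`, of degree 1 in the component of `G − E(C)` containing `vᵢ`. -/
noncomputable def numLeaves {V : Type*} [Fintype V] (G : SimpleGraph V) {s : ℕ}
    (v : ZMod s → V) (i : ZMod s) : ℕ :=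
  {x : V | x ≠ v i ∧ (G.deleteEdges (cycleEdges v)).Reachable (v i) x ∧
    ((G.deleteEdges (cycleEdges v)).neighborSet x).ncard = 1}.ncard

namespace SimpleGraph

variable {V : Type*} {G F : SimpleGraph V}

/-- If the total number of edges equals the number of vertices, deleting a non-bridge edge of a
connected graph leaves an acyclic graph. -/
theorem Connected.isAcyclic_deleteEdges_of_not_isBridge [Fintype V] (hconn : G.Connected)
    (huni : G.edgeSet.ncard = Fintype.card V) {e : Sym2 V} (he : e ∈ G.edgeSet)
    (hb : ¬ G.IsBridge e) : (G.deleteEdges {e}).IsAcyclic := by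
  induction e with | h x y
  refine (isTree_iff_connected_and_card.2
    ⟨hconn.connected_delete_edge_of_not_isBridge hb, ?_⟩).isAcyclic
  rw [edgeSet_deleteEdges, Nat.card_coe_set_eq, Nat.card_eq_fintype_card, ← huni]
  exact Set.ncard_sdiff_singleton_add_one he (Set.toFinite _)

/-- Deleting a bridge separates one of its ends from any given vertex. -/
theorem IsBridge.exists_mem_not_reachable {e : Sym2 V} (hb : G.IsBridge e) (z : V) :
    ∃ x ∈ e, ¬ (G.deleteEdges {e}).Reachable x z := by
  induction e with | h x y
  rw [isBridge_iff] at hb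
  by_cases h : (G.deleteEdges {s(x, y)}).Reachable x z
  · exact ⟨y, by simp, fun h' => hb (h.trans h'.symm)⟩
  · exact ⟨x, by simp, h⟩

/-- Any two bridges lie on all walks between a suitable pair of vertices. -/
theorem IsBridge.exists_forall_walk_mem_edges {e f : Sym2 V} (he : G.IsBridge e)
    (hf : G.IsBridge f) (hfG : f ∈ G.edgeSet) (hne : f ≠ e) :
    ∃ x y, ∀ p : G.Walk x y, e ∈ p.edges ∧ f ∈ p.edges := by
  induction f with | h z t
  have hzt : (G.deleteEdges {e}).Reachable z t :=
    Adj.reachable (by rw [deleteEdges_adj]; exact ⟨hfG, by simpa using hne⟩)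
  obtain ⟨x, -, hx⟩ := he.exists_mem_not_reachable z
  obtain ⟨w, hw, hxw⟩ := hf.exists_mem_not_reachable x
  refine ⟨x, w, fun p => ⟨p.mem_edges_of_not_reachable_deleteEdges fun h => hx ?_,
    p.mem_edges_of_not_reachable_deleteEdges fun h => hxw h.symm⟩⟩
  rcases Sym2.mem_iff.1 hw with rfl | rfl
  · exact h
  · exact h.trans hzt.symm

theorem Walk.reachable_of_mem_edges {x a u : V} {e : Sym2 V} (p : F.Walk x a)
    (he : e ∈ p.edges) (hu : u ∈ e) : F.Reachable u a := by
  classical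
  exact ⟨p.dropUntil u (Walk.mem_support_of_mem_edges he hu)⟩

/-- A path has no vertex of degree one in its interior. -/
theorem Walk.IsPath.notMem_support_of_subsingleton {x a l : V} {p : F.Walk x a} (hp : p.IsPath)
    (hl : (F.neighborSet l).Subsingleton) (hx : l ≠ x) (ha : l ≠ a) : l ∉ p.support := by
  induction p with
  | nil => simpa using hx
  | @cons x y a h q ih =>
    rw [Walk.cons_isPath_iff] at hp
    rw [Walk.support_cons, List.mem_cons, not_or]
    refine ⟨hx, ?_⟩
    by_cases hy : l = y
    · subst hy
      cases q with
      | nil => exact absurd rfl ha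
      | cons h' q' =>
        have := hl h.symm h'
        subst this
        simp at hp
    · exact ih hp.1 hy ha

end SimpleGraph

open SimpleGraph

section RainbowConnection

variable {V : Type*} {G F : SimpleGraph V}

/-- Rainbow walks shorten to rainbow paths. -/
theorem isRainbowConnected_of_walk {α : Type*} {c : Sym2 V → α}
    (h : ∀ x y, ∃ p : G.Walk x y, (p.edges.map c).Nodup) : IsRainbowConnected G c := by
  classical
  intro x y
  obtain ⟨p, hp⟩ := h x y
  refine ⟨p.bypass, p.bypass_isPath, List.Nodup.map_on ?_ p.bypass_isPath.isTrail.edges_nodup⟩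
  intro e he f hf hef
  exact List.inj_on_of_nodup_map hp (p.edges_bypass_subset_edges he)
    (p.edges_bypass_subset_edges hf) hef

theorem IsRainbowConnected.injOn_isBridge {α : Type*} {c : Sym2 V → α}
    (h : IsRainbowConnected G c) : Set.InjOn c {e ∈ G.edgeSet | G.IsBridge e} := by
  rintro e ⟨-, he⟩ f ⟨hf, hf'⟩ hef
  by_contra hne
  obtain ⟨x, y, hxy⟩ := he.exists_forall_walk_mem_edges hf' hf (Ne.symm hne)
  obtain ⟨p, -, hp⟩ := h x y
  exact hne (List.inj_on_of_nodup_map hp (hxy p).1 (hxy p).2 hef)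

/-- The rainbow connection number is the number of edges of a set `S` of bridges as soon as the
graph has a rainbow coloring whose colors are the elements of `S`. -/
theorem rc_eq_ncard_of_isBridge [Finite V] {S : Set (Sym2 V)} (hS : S.Nonempty)
    (hSG : S ⊆ {e ∈ G.edgeSet | G.IsBridge e}) {c : Sym2 V → Sym2 V}
    (hcS : ∀ e ∈ G.edgeSet, c e ∈ S) (hc : IsRainbowConnected G c) :
    rc G = S.ncard := by
  classical
  have hmem : ∃ c : Sym2 V → Fin S.ncard, IsRainbowConnected G c := by
    let φ : S ≃ Fin S.ncard := Finite.equivFin S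
    obtain ⟨s₀, hs₀⟩ := hS
    let g : Sym2 V → Fin S.ncard := fun e => if h : e ∈ S then φ ⟨e, h⟩ else φ ⟨s₀, hs₀⟩
    have hg : Set.InjOn g S := by
      intro e he f hf hef
      simp only [g, dif_pos he, dif_pos hf] at hef
      simpa using φ.injective hef
    refine ⟨g ∘ c, fun x y => ?_⟩
    obtain ⟨p, hp, hnd⟩ := hc x y
    refine ⟨p, hp, ?_⟩
    rw [← List.map_map]
    refine hnd.map_on ?_
    intro e he f hf hef
    obtain ⟨e', he', rfl⟩ := List.mem_map.1 he
    obtain ⟨f', hf', rfl⟩ := List.mem_map.1 hf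
    exact hg (hcS _ (p.edges_subset_edgeSet he')) (hcS _ (p.edges_subset_edgeSet hf')) hef
  refine le_antisymm (Nat.sInf_le hmem) (le_csInf ⟨_, hmem⟩ ?_)
  rintro k ⟨c', hc'⟩
  have := Set.ncard_le_ncard_of_injOn (t := (Set.univ : Set (Fin k))) c'
    (fun _ _ => Set.mem_univ _) (hc'.injOn_isBridge.mono hSG)
  simpa [Set.ncard_univ] using this

/-- Two paths in different components of a subgraph `F` whose edges have themselves as colors can
be joined to a rainbow walk by a rainbow walk avoiding their colors. -/
theorem exists_walk_nodup_map_append {c : Sym2 V → Sym2 V} (hFG : F ≤ G)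
    (hc : ∀ e ∈ F.edgeSet, c e = e) {x a b y : V} {P : F.Walk x a} {Q : F.Walk b y}
    (hP : P.IsPath) (hQ : Q.IsPath) (hab : ¬ F.Reachable a b) (R : G.Walk a b)
    (hR : (R.edges.map c).Nodup) (hRP : ∀ e ∈ R.edges, c e ∉ P.edges)
    (hRQ : ∀ e ∈ R.edges, c e ∉ Q.edges) :
    ∃ p : G.Walk x y, (p.edges.map c).Nodup := by
  have hmap : ∀ {u w : V} (W : F.Walk u w), W.edges.map c = W.edges := fun W =>
    (List.map_congr_left fun e he => hc e (W.edges_subset_edgeSet he)).trans (List.map_id _)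
  refine ⟨((P.mapLe hFG).append R).append (Q.mapLe hFG), ?_⟩
  simp only [Walk.edges_append, Walk.edges_mapLe_eq_edges, List.map_append, hmap]
  rw [List.nodup_append', List.nodup_append']
  refine ⟨⟨hP.isTrail.edges_nodup, hR, ?_⟩, hQ.isTrail.edges_nodup, ?_⟩
  · intro e he he'
    obtain ⟨f, hf, rfl⟩ := List.mem_map.1 he'
    exact hRP f hf he
  · intro e he he'
    rcases List.mem_append.1 he with he | he
    · induction e with | h u w
      exact hab ((P.reachable_of_mem_edges he (Sym2.mem_mk_left u w)).symm.trans
        ((Q.reverse.reachable_of_mem_edges (by simpa using he') (Sym2.mem_mk_left u w))))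
    · obtain ⟨f, hf, rfl⟩ := List.mem_map.1 he
      exact hRQ f hf he'

end RainbowConnection

section Triangle

variable {V : Type*} {G : SimpleGraph V} {v : ZMod 3 → V}

theorem zmod_three_add_one_ne : ∀ i : ZMod 3, i + 1 ≠ i := by decide

theorem zmod_three_add_two_ne : ∀ i : ZMod 3, i + 2 ≠ i := by decide

theorem zmod_three_add_two_ne_add_one : ∀ i : ZMod 3, i + 2 ≠ i + 1 := by decide

theorem zmod_three_add_two_add_one : ∀ i : ZMod 3, i + 2 + 1 = i := by decide

theorem triangle_edge_injective (hinj : Function.Injective v) :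
    Function.Injective fun i : ZMod 3 => s(v i, v (i + 1)) := by
  intro i j h
  have : ∀ i j : ZMod 3, (i = j ∧ i + 1 = j + 1) ∨ (i = j + 1 ∧ i + 1 = j) → i = j := by decide
  exact this i j (by simpa [Sym2.eq_iff, hinj.eq_iff] using h)

theorem ncard_cycleEdges_triangle (hinj : Function.Injective v) : (cycleEdges v).ncard = 3 := by
  have : cycleEdges v = Set.range fun i : ZMod 3 => s(v i, v (i + 1)) := by
    ext e; simp [cycleEdges, eq_comm]
  rw [this, ← Set.image_univ, Set.ncard_image_of_injective _ (triangle_edge_injective hinj)]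
  simp [Set.ncard_univ]

theorem mk_mem_cycleEdges (i : ZMod 3) : s(v i, v (i + 1)) ∈ cycleEdges v := ⟨i, rfl⟩

theorem mk_mem_cycleEdges' (i : ZMod 3) : s(v (i + 2), v i) ∈ cycleEdges v :=
  ⟨i + 2, by rw [zmod_three_add_two_add_one]⟩

theorem mk_mem_cycleEdges'' (i : ZMod 3) : s(v (i + 1), v (i + 2)) ∈ cycleEdges v :=
  ⟨i + 1, by rw [add_assoc, one_add_one_eq_two]⟩

theorem adj_triangle_succ (hadj : ∀ i : ZMod 3, G.Adj (v i) (v (i + 1))) (i : ZMod 3) :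
    G.Adj (v (i + 1)) (v (i + 2)) := by
  have := hadj (i + 1)
  rwa [add_assoc, one_add_one_eq_two] at this

theorem adj_triangle_two (hadj : ∀ i : ZMod 3, G.Adj (v i) (v (i + 1))) (i : ZMod 3) :
    G.Adj (v (i + 2)) (v i) := by
  have := hadj (i + 2)
  rwa [zmod_three_add_two_add_one] at this

theorem triangle_edge_not_isBridge (hinj : Function.Injective v)
    {H : SimpleGraph V} (hH : ∀ i : ZMod 3, H.Adj (v i) (v (i + 1))) (i : ZMod 3) :
    ¬ H.IsBridge s(v i, v (i + 1)) := by
  have h1 : v (i + 1) ≠ v i := hinj.ne (zmod_three_add_one_ne i)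
  have h2 : v (i + 2) ≠ v i := hinj.ne (zmod_three_add_two_ne i)
  have h3 : v (i + 2) ≠ v (i + 1) := hinj.ne (zmod_three_add_two_ne_add_one i)
  rw [isBridge_iff, not_not]
  refine Reachable.trans (v := v (i + 2)) (Adj.reachable ?_) (Adj.reachable ?_)
  · rw [deleteEdges_adj]
    exact ⟨(adj_triangle_two hH i).symm, by simp [h2, h3, h1.symm]⟩
  · rw [deleteEdges_adj]
    exact ⟨(adj_triangle_succ hH i).symm, by simp [h1, h2, h3]⟩

theorem isBridge_of_notMem_cycleEdges [Fintype V] (hconn : G.Connected)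
    (huni : G.edgeSet.ncard = Fintype.card V) (hinj : Function.Injective v)
    (hadj : ∀ i : ZMod 3, G.Adj (v i) (v (i + 1))) {e : Sym2 V} (he : e ∈ G.edgeSet)
    (hec : e ∉ cycleEdges v) : G.IsBridge e := by
  by_contra hb
  have hac := hconn.isAcyclic_deleteEdges_of_not_isBridge huni he hb
  have hT : ∀ i : ZMod 3, (G.deleteEdges {e}).Adj (v i) (v (i + 1)) := fun i => by
    rw [deleteEdges_adj]
    refine ⟨hadj i, ?_⟩
    rintro rfl
    exact hec (mk_mem_cycleEdges i)
  exact triangle_edge_not_isBridge hinj hT 0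
    (isAcyclic_iff_forall_isBridge.1 hac (hT 0))

theorem not_reachable_triangle_succ [Fintype V] (hconn : G.Connected)
    (huni : G.edgeSet.ncard = Fintype.card V) (hinj : Function.Injective v)
    (hadj : ∀ i : ZMod 3, G.Adj (v i) (v (i + 1))) (i : ZMod 3) :
    ¬ (G.deleteEdges (cycleEdges v)).Reachable (v i) (v (i + 1)) := by
  intro hr
  have h1 : v (i + 1) ≠ v i := hinj.ne (zmod_three_add_one_ne i)
  have h2 : v (i + 2) ≠ v i := hinj.ne (zmod_three_add_two_ne i)
  have h3 : v (i + 2) ≠ v (i + 1) := hinj.ne (zmod_three_add_two_ne_add_one i)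
  have hac := hconn.isAcyclic_deleteEdges_of_not_isBridge huni (hadj i)
    (triangle_edge_not_isBridge hinj hadj i)
  have hb := isAcyclic_iff_forall_isBridge.1 hac (e := s(v (i + 1), v (i + 2))) (by
    rw [mem_edgeSet, deleteEdges_adj]
    exact ⟨adj_triangle_succ hadj i, by simp [h1, h2, h3]⟩)
  rw [isBridge_iff, deleteEdges_deleteEdges] at hb
  refine hb ((hr.symm.mono (deleteEdges_anti ?_)).trans (Adj.reachable ?_))
  · rintro e (rfl | rfl)
    · exact mk_mem_cycleEdges i
    · exact mk_mem_cycleEdges'' i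
  · rw [deleteEdges_adj]
    exact ⟨(adj_triangle_two hadj i).symm,
      by simp [h2, h3, h1.symm, h2.symm]⟩

theorem exists_reachable_triangle (hconn : G.Connected) (x : V) :
    ∃ i, (G.deleteEdges (cycleEdges v)).Reachable x (v i) := by
  obtain ⟨p⟩ := hconn.preconnected x (v 0)
  generalize hz : v 0 = z at p
  induction p with
  | nil => exact ⟨0, hz ▸ Reachable.refl _⟩
  | @cons x y z h p ih =>
    obtain ⟨i, hi⟩ := ih hz
    by_cases hc : s(x, y) ∈ cycleEdges v
    · obtain ⟨j, hj⟩ := hc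
      rcases Sym2.eq_iff.1 hj with ⟨rfl, -⟩ | ⟨rfl, -⟩
      · exact ⟨_, Reachable.refl _⟩
      · exact ⟨_, Reachable.refl _⟩
    · exact ⟨i, (Adj.reachable (deleteEdges_adj.2 ⟨h, hc⟩)).trans hi⟩

/-- The coloring giving every bridge its own color and the triangle edge `v i — v (i + 1)` the
color `col i` is rainbow as soon as it is so for pairs of vertices of different trees. -/
theorem rc_triangle_of_coloring [Fintype V] (hconn : G.Connected)
    (huni : G.edgeSet.ncard = Fintype.card V) (hinj : Function.Injective v)
    (hadj : ∀ i : ZMod 3, G.Adj (v i) (v (i + 1))) (col : ZMod 3 → Sym2 V)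
    (hcol : ∀ i, col i ∈ (G.deleteEdges (cycleEdges v)).edgeSet) (k : ZMod 3)
    (h : ∀ c : Sym2 V → Sym2 V, (∀ i, c s(v i, v (i + 1)) = col i) →
      (∀ e ∈ (G.deleteEdges (cycleEdges v)).edgeSet, c e = e) →
      ∀ i j, (i = k ∧ j = k + 1) ∨ (i = k ∧ j = k + 2) ∨ (i = k + 1 ∧ j = k + 2) → ∀ x y,
      ∀ P : (G.deleteEdges (cycleEdges v)).Walk x (v i), P.IsPath →
      ∀ Q : (G.deleteEdges (cycleEdges v)).Walk (v j) y, Q.IsPath →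
        ∃ p : G.Walk x y, (p.edges.map c).Nodup) :
    rc G = G.edgeSet.ncard - 3 := by
  classical
  set F := G.deleteEdges (cycleEdges v) with hF
  have hcyc : cycleEdges v ⊆ G.edgeSet := by
    rintro _ ⟨i, rfl⟩
    exact hadj i
  have hcard : F.edgeSet.ncard = G.edgeSet.ncard - 3 := by
    rw [hF, edgeSet_deleteEdges, Set.ncard_sdiff hcyc, ncard_cycleEdges_triangle hinj]
  obtain ⟨c, hc1, hc2⟩ : ∃ c : Sym2 V → Sym2 V, (∀ i, c s(v i, v (i + 1)) = col i) ∧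
      ∀ e ∉ cycleEdges v, c e = e := by
    refine ⟨fun e => if h : e ∈ cycleEdges v then col h.choose else e, fun i => ?_,
      fun e he => dif_neg he⟩
    have hi : s(v i, v (i + 1)) ∈ cycleEdges v := mk_mem_cycleEdges i
    refine (dif_pos hi).trans ?_
    exact congrArg col (triangle_edge_injective hinj hi.choose_spec).symm
  have hc3 : ∀ e ∈ F.edgeSet, c e = e := fun e he => hc2 e (by
    rw [hF, edgeSet_deleteEdges] at he
    exact he.2)
  rw [← hcard]
  refine rc_eq_ncard_of_isBridge (c := c) ⟨_, hcol 0⟩ ?_ ?_ (isRainbowConnected_of_walk ?_)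
  · intro e he
    rw [hF, edgeSet_deleteEdges] at he
    exact ⟨he.1, isBridge_of_notMem_cycleEdges hconn huni hinj hadj he.1 he.2⟩
  · intro e he
    by_cases hec : e ∈ cycleEdges v
    · obtain ⟨i, rfl⟩ := hec
      rw [hc1]
      exact hcol i
    · rw [hc2 e hec, hF, edgeSet_deleteEdges]
      exact ⟨he, hec⟩
  · intro x y
    obtain ⟨i, hi⟩ := exists_reachable_triangle (v := v) hconn x
    obtain ⟨j, hj⟩ := exists_reachable_triangle (v := v) hconn y
    have key : ∀ k i j : ZMod 3, i = j ∨
        ((i = k ∧ j = k + 1) ∨ (i = k ∧ j = k + 2) ∨ (i = k + 1 ∧ j = k + 2)) ∨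
        ((j = k ∧ i = k + 1) ∨ (j = k ∧ i = k + 2) ∨ (j = k + 1 ∧ i = k + 2)) := by decide
    rcases key k i j with rfl | hij | hij
    · obtain ⟨P, hP⟩ := (hi.trans hj.symm).exists_isPath
      refine ⟨P.mapLe (deleteEdges_le _), ?_⟩
      rw [Walk.edges_mapLe_eq_edges]
      refine hP.isTrail.edges_nodup.map_on fun e he f hf hef => ?_
      rwa [hc3 e (P.edges_subset_edgeSet he), hc3 f (P.edges_subset_edgeSet hf)] at hef
    · obtain ⟨P, hP⟩ := hi.exists_isPath
      obtain ⟨Q, hQ⟩ := hj.symm.exists_isPath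
      exact h c hc1 hc3 i j hij x y P hP Q hQ
    · obtain ⟨P, hP⟩ := hj.exists_isPath
      obtain ⟨Q, hQ⟩ := hi.symm.exists_isPath
      obtain ⟨p, hp⟩ := h c hc1 hc3 j i hij y x P hP Q hQ
      exact ⟨p.reverse, by simpa using hp⟩

theorem rc_triangle_of_forall_one_le [Fintype V] (hconn : G.Connected)
    (huni : G.edgeSet.ncard = Fintype.card V) (hinj : Function.Injective v)
    (hadj : ∀ i : ZMod 3, G.Adj (v i) (v (i + 1))) (hl : ∀ i : ZMod 3, 1 ≤ numLeaves G v i) :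
    rc G = G.edgeSet.ncard - 3 := by
  have hnr := not_reachable_triangle_succ hconn huni hinj hadj
  have hnbr : ∀ i, ∃ y, (G.deleteEdges (cycleEdges v)).Adj (v i) y := fun i => by
    obtain ⟨x, hx, ⟨p⟩, -⟩ := Set.nonempty_of_ncard_ne_zero (Nat.one_le_iff_ne_zero.1 (hl i))
    cases p with
    | nil => exact absurd rfl hx
    | cons h _ => exact ⟨_, h⟩
  choose y hy using hnbr
  have hnr' : ∀ i j, i ≠ j → ¬ (G.deleteEdges (cycleEdges v)).Reachable (v i) (v j) := by
    intro i j hij hr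
    have : ∀ i j : ZMod 3, i ≠ j → j = i + 1 ∨ i = j + 1 := by decide
    rcases this i j hij with rfl | rfl
    · exact hnr _ hr
    · exact hnr _ hr.symm
  refine rc_triangle_of_coloring hconn huni hinj hadj (fun i => s(v (i + 2), y (i + 2)))
    (fun i => hy _) 0 ?_
  intro c hc1 hc2 i j hij x z P hP Q hQ
  have hne : i ≠ j := by
    rcases hij with ⟨rfl, rfl⟩ | ⟨rfl, rfl⟩ | ⟨rfl, rfl⟩ <;> decide
  have hthird : ∀ i j : ZMod 3, i ≠ j → ∃ k, k ≠ i ∧ k ≠ j ∧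
      ((j = i + 1 ∧ k = i + 2) ∨ (i = j + 1 ∧ k = j + 2)) := by decide
  obtain ⟨k, hki, hkj, hk⟩ := hthird i j hne
  obtain ⟨hA, hcol⟩ : G.Adj (v i) (v j) ∧ c s(v i, v j) = s(v k, y k) := by
    rcases hk with ⟨rfl, rfl⟩ | ⟨rfl, rfl⟩
    · exact ⟨hadj i, hc1 i⟩
    · exact ⟨(hadj j).symm, by rw [Sym2.eq_swap]; exact hc1 j⟩
  refine exists_walk_nodup_map_append (deleteEdges_le _) hc2 hP hQ (hnr' i j hne) hA.toWalk
    (by simp) ?_ ?_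
  · simp only [Walk.edges_cons, Walk.edges_nil, List.mem_singleton, forall_eq, hcol]
    exact fun h => hnr' k i hki (P.reachable_of_mem_edges h (Sym2.mem_mk_left _ _))
  · simp only [Walk.edges_cons, Walk.edges_nil, List.mem_singleton, forall_eq, hcol]
    exact fun h => hnr' k j hkj
      (Q.reverse.reachable_of_mem_edges (by simpa using h) (Sym2.mem_mk_left _ _))

theorem rc_triangle_of_three_le [Fintype V] (hconn : G.Connected)
    (huni : G.edgeSet.ncard = Fintype.card V) (hinj : Function.Injective v)
    (hadj : ∀ i : ZMod 3, G.Adj (v i) (v (i + 1))) (i : ZMod 3) (hl : 3 ≤ numLeaves G v i) :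
    rc G = G.edgeSet.ncard - 3 := by
  have hnr := not_reachable_triangle_succ hconn huni hinj hadj
  have hn1 := hnr i
  have hn2 := hnr (i + 1)
  have hn3 := hnr (i + 2)
  rw [add_assoc, one_add_one_eq_two] at hn2
  rw [zmod_three_add_two_add_one] at hn3
  set F := G.deleteEdges (cycleEdges v) with hF
  set L := {x : V | x ≠ v i ∧ F.Reachable (v i) x ∧ (F.neighborSet x).ncard = 1} with hL
  obtain ⟨l₁, l₂, l₃, h₁, h₂, h₃, h₁₂, h₁₃, h₂₃⟩ := (Set.two_lt_ncard_iff (Set.toFinite L)).1 hl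
  have hsub : ∀ l ∈ L, (F.neighborSet l).Subsingleton := fun l hl => by
    obtain ⟨w, hw⟩ := Set.ncard_eq_one.1 hl.2.2
    rw [hw]
    exact Set.subsingleton_singleton
  have hpar : ∀ l ∈ L, ∃ q, F.Adj l q := fun l hl => by
    obtain ⟨w, hw⟩ := Set.ncard_eq_one.1 hl.2.2
    exact ⟨w, by rw [← mem_neighborSet, hw]; rfl⟩
  obtain ⟨q₁, hq₁⟩ := hpar l₁ h₁
  obtain ⟨q₂, hq₂⟩ := hpar l₂ h₂
  obtain ⟨q₃, hq₃⟩ := hpar l₃ h₃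
  have hleaf : ∀ l ∈ L, ∀ q x, l ≠ x → ∀ P : F.Walk x (v i), P.IsPath → s(l, q) ∉ P.edges :=
    fun l hl q x hx P hP h =>
      hP.notMem_support_of_subsingleton (hsub l hl) hx hl.1 (P.fst_mem_support_of_mem_edges h)
  have hpath : ∀ l ∈ L, ∀ q, F.Adj l q → ∀ P : F.Walk l (v i), s(l, q) ∈ P.edges := by
    intro l hl q hq P
    cases P with
    | nil => exact absurd rfl hl.1
    | cons h P =>
      rw [hsub l hl hq h]
      simp
  have hne : ∀ l ∈ L, ∀ l' ∈ L, l ≠ l' → ∀ q q', F.Adj l q → s(l, q) ≠ s(l', q') := by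
    intro l hl l' hl' hll q q' hq he
    obtain ⟨P, hP⟩ := hl.2.1.symm.exists_isPath
    exact hleaf l' hl' q' l hll.symm P hP (he ▸ hpath l hl q hq P)
  have hout : ∀ l ∈ L, ∀ q j y, ¬ F.Reachable (v i) (v j) → ∀ Q : F.Walk (v j) y,
      s(l, q) ∉ Q.edges := fun l hl q j y hj Q h =>
    hj (hl.2.1.trans
      (Q.reverse.reachable_of_mem_edges (by simpa using h) (Sym2.mem_mk_left _ _)))
  have e1 := zmod_three_add_one_ne i
  have e2 := zmod_three_add_two_ne i
  have e3 := zmod_three_add_two_ne_add_one i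
  refine rc_triangle_of_coloring hconn huni hinj hadj
    (fun j => if j = i then s(l₁, q₁) else if j = i + 1 then s(l₃, q₃) else s(l₂, q₂))
    (fun j => ?_) i ?_
  · split_ifs
    exacts [hq₁, hq₃, hq₂]
  intro c hc1 hc2 j k hjk x y P hP Q hQ
  have c1 : c s(v i, v (i + 1)) = s(l₁, q₁) := by simpa using hc1 i
  have c3 : c s(v (i + 1), v (i + 2)) = s(l₃, q₃) := by
    simpa [add_assoc, one_add_one_eq_two, e1] using hc1 (i + 1)
  have c2 : c s(v (i + 2), v i) = s(l₂, q₂) := by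
    simpa [zmod_three_add_two_add_one, e2, e3] using hc1 (i + 2)
  have c1' : c s(v (i + 1), v i) = s(l₁, q₁) := by rwa [Sym2.eq_swap]
  have c2' : c s(v i, v (i + 2)) = s(l₂, q₂) := by rwa [Sym2.eq_swap]
  have c3' : c s(v (i + 2), v (i + 1)) = s(l₃, q₃) := by rwa [Sym2.eq_swap]
  have a1 := hadj i
  have a2 := adj_triangle_two hadj i
  have a3 := adj_triangle_succ hadj i
  have hn3' : ¬ F.Reachable (v i) (v (i + 2)) := fun h => hn3 h.symm
  rcases hjk with ⟨rfl, rfl⟩ | ⟨rfl, rfl⟩ | ⟨rfl, rfl⟩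
  · by_cases hx : l₁ = x
    · refine exists_walk_nodup_map_append (deleteEdges_le _) hc2 hP hQ hn1
        (a2.symm.toWalk.append a3.symm.toWalk) ?_ ?_ ?_
      · simpa [c2', c3'] using hne l₂ h₂ l₃ h₃ h₂₃ q₂ q₃ hq₂
      · simpa [c2', c3'] using ⟨hleaf l₂ h₂ q₂ x (hx ▸ h₁₂.symm) P hP,
          hleaf l₃ h₃ q₃ x (hx ▸ h₁₃.symm) P hP⟩
      · simpa [c2', c3'] using ⟨hout l₂ h₂ q₂ _ y hn1 Q, hout l₃ h₃ q₃ _ y hn1 Q⟩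
    · refine exists_walk_nodup_map_append (deleteEdges_le _) hc2 hP hQ hn1 a1.toWalk (by simp) ?_ ?_
      · simpa [c1] using hleaf l₁ h₁ q₁ x hx P hP
      · simpa [c1] using hout l₁ h₁ q₁ _ y hn1 Q
  · by_cases hx : l₂ = x
    · refine exists_walk_nodup_map_append (deleteEdges_le _) hc2 hP hQ hn3'
        (a1.toWalk.append a3.toWalk) ?_ ?_ ?_
      · simpa [c1, c3] using hne l₁ h₁ l₃ h₃ h₁₃ q₁ q₃ hq₁
      · simpa [c1, c3] using ⟨hleaf l₁ h₁ q₁ x (hx ▸ h₁₂) P hP,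
          hleaf l₃ h₃ q₃ x (hx ▸ h₂₃.symm) P hP⟩
      · simpa [c1, c3] using ⟨hout l₁ h₁ q₁ _ y hn3' Q, hout l₃ h₃ q₃ _ y hn3' Q⟩
    · refine exists_walk_nodup_map_append (deleteEdges_le _) hc2 hP hQ hn3' a2.symm.toWalk
        (by simp) ?_ ?_
      · simpa [c2'] using hleaf l₂ h₂ q₂ x hx P hP
      · simpa [c2'] using hout l₂ h₂ q₂ _ y hn3' Q
  · refine exists_walk_nodup_map_append (deleteEdges_le _) hc2 hP hQ hn2 a3.toWalk (by simp) ?_ ?_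
    · simpa [c3] using hout l₃ h₃ q₃ _ x hn1 P.reverse
    · simpa [c3] using hout l₃ h₃ q₃ _ y hn3' Q

end Triangle

/-- Let `G` be a connected unicyclic graph with m edges whose unique
cycle `v₁v₂v₃v₁` has length 3. If every `l(vᵢ) ≥ 1`, or some `l(vᵢ) ≥ 3`, then
rc(G) = m − 3. -/
theorem stmt_8 {V : Type*} [Fintype V] (G : SimpleGraph V)
    (hconn : G.Connected) (huni : G.edgeSet.ncard = Fintype.card V)
    (v : ZMod 3 → V) (hinj : Function.Injective v)
    (hadj : ∀ i : ZMod 3, G.Adj (v i) (v (i + 1)))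
    (hl : (∀ i : ZMod 3, 1 ≤ numLeaves G v i) ∨ (∃ i : ZMod 3, 3 ≤ numLeaves G v i)) :
    rc G = G.edgeSet.ncard - 3 := by
  rcases hl with hl | ⟨i, hi⟩
  · exact rc_triangle_of_forall_one_le hconn huni hinj hadj hl
  · exact rc_triangle_of_three_le hconn huni hinj hadj i hi
end

section
/- Let G be a connected unicyclic graph with m edges whose unique cycle C = v₁v₂v₃v₁ has length 3 (girth 3). If there is an index i (mod 3) with l(vᵢ) = 0, l(v_{i+1}) ≤ 2 and l(v_{i+2}) ≤ 2, then rc(G) = m − 2. -/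
open SimpleGraph

/-- The edges of the triangle with corners `a`, `b`, `c`. -/
def triangleEdges {V : Type*} (a b c : V) : Set (Sym2 V) :=
  {s(a, b), s(b, c), s(c, a)}

theorem triangleEdges_rotate {V : Type*} (a b c : V) :
    triangleEdges b c a = triangleEdges a b c := by
  ext e
  simp only [triangleEdges, Set.mem_insert_iff, Set.mem_singleton_iff]
  tauto

theorem cycleEdges_eq_triangleEdges {V : Type*} (v : ZMod 3 → V) (i : ZMod 3) :
    cycleEdges v = triangleEdges (v i) (v (i + 1)) (v (i + 2)) := by
  have h3 : ∀ i j : ZMod 3, j = i ∨ j = i + 1 ∨ j = i + 2 := by decide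
  have h4 : ∀ i : ZMod 3, i + 1 + 1 = i + 2 := by decide
  have h5 : ∀ i : ZMod 3, i + 2 + 1 = i := by decide
  ext e
  simp only [cycleEdges, triangleEdges, Set.mem_ofPred_eq, Set.mem_insert_iff,
    Set.mem_singleton_iff]
  constructor
  · rintro ⟨j, rfl⟩
    rcases h3 i j with rfl | rfl | rfl
    · exact Or.inl rfl
    · rw [h4]; exact Or.inr (Or.inl rfl)
    · rw [h5]; exact Or.inr (Or.inr rfl)
  · rintro (rfl | rfl | rfl)
    · exact ⟨i, rfl⟩
    · exact ⟨i + 1, by rw [h4]⟩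
    · exact ⟨i + 2, by rw [h5]⟩

theorem ncard_triangleEdges {V : Type*} {a b c : V} (hab : a ≠ b) (hbc : b ≠ c) (hca : c ≠ a) :
    (triangleEdges a b c).ncard = 3 := by
  rw [triangleEdges, Set.ncard_eq_three]
  refine ⟨_, _, _, ?_, ?_, ?_, rfl⟩ <;> simp <;> tauto

namespace SimpleGraph

variable {V : Type*} {G : SimpleGraph V}

/-- The vertices separated from `o` by the edge `e`. -/
def cutOff (G : SimpleGraph V) (o : V) (e : Sym2 V) : Set V :=
  {z | ¬ (G.deleteEdges {e}).Reachable o z}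

theorem Walk.mem_edges_of_mem_cutOff {o z w : V} {e : Sym2 V} (p : G.Walk z w)
    (hz : z ∈ G.cutOff o e) (hw : w ∉ G.cutOff o e) : e ∈ p.edges := by
  by_contra h
  simp only [cutOff, Set.mem_ofPred_eq, not_not] at hw
  exact hz (hw.trans ⟨(p.toDeleteEdge e h).reverse⟩)

theorem Connected.notMem_cutOff_or {x y : V} (hG : G.Connected) (o : V) :
    x ∉ G.cutOff o s(x, y) ∨ y ∉ G.cutOff o s(x, y) := by
  by_contra! h
  obtain ⟨p⟩ := hG.preconnected x o
  obtain ⟨d, -, h1, h2⟩ := p.exists_boundary_dart (G.cutOff o s(x, y)) h.1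
    (fun h => h (Reachable.refl _))
  have h3 : s(x, y) ∈ d.adj.toWalk.edges := Walk.mem_edges_of_mem_cutOff _ h1 h2
  simp only [Walk.edges_cons, Walk.edges_nil, List.mem_singleton, Sym2.eq_iff] at h3
  rcases h3 with ⟨-, h3⟩ | ⟨h3, -⟩
  · exact h2 (h3 ▸ h.2)
  · exact h2 (h3 ▸ h.1)

theorem IsBridge.exists_mem_cutOff (hG : G.Connected) (o : V) {e : Sym2 V}
    (he : G.IsBridge e) :
    ∃ x y, e = s(x, y) ∧ x ∈ G.cutOff o e ∧ y ∉ G.cutOff o e := by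
  induction e with | h x y
  rw [isBridge_iff] at he
  rcases hG.notMem_cutOff_or (x := x) (y := y) o with h | h
  · refine ⟨y, x, Sym2.eq_swap, fun hy => he ?_, h⟩
    simp only [cutOff, Set.mem_ofPred_eq, not_not] at h
    exact h.symm.trans hy
  · refine ⟨x, y, rfl, fun hx => he ?_, h⟩
    simp only [cutOff, Set.mem_ofPred_eq, not_not] at h
    exact hx.symm.trans h

theorem exists_leaf_mem_cutOff [Finite V] {H : SimpleGraph V} (hG : G.Connected) (hle : H ≤ G)
    (hb : ∀ e ∈ H.edgeSet, G.IsBridge e) (o : V) {e : Sym2 V} (he : e ∈ H.edgeSet) :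
    ∃ z ∈ G.cutOff o e, (H.neighborSet z).ncard = 1 := by
  induction hn : (G.cutOff o e).ncard using Nat.strong_induction_on generalizing e with
  | _ n ih
  obtain ⟨x, y, rfl, hx, hy⟩ := (hb e he).exists_mem_cutOff hG o
  by_cases hw : ∀ w, H.Adj x w → w = y
  · refine ⟨x, hx, Set.ncard_eq_one.2 ⟨y, ?_⟩⟩
    ext w
    exact ⟨hw w, fun h => h ▸ he⟩
  push Not at hw
  obtain ⟨w, hxw, hwy⟩ := hw
  have hsub : G.cutOff o s(x, w) ⊆ G.cutOff o s(x, y) := by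
    intro u hu h
    obtain ⟨p⟩ := h
    refine hu ?_
    by_cases hp : s(x, w) ∈ p.edges
    · classical
      exact absurd ⟨p.takeUntil x (p.fst_mem_support_of_mem_edges hp)⟩ hx
    · refine Reachable.mono ?_ ⟨p.toDeleteEdge _ hp⟩
      exact deleteEdges_mono (deleteEdges_le _)
  have hx' : x ∉ G.cutOff o s(x, w) := by
    intro h
    have := Walk.mem_edges_of_mem_cutOff (hle he).toWalk h (fun h' => hy (hsub h'))
    simp at this
    grind
  have hlt : (G.cutOff o s(x, w)).ncard < n :=
    hn ▸ Set.ncard_lt_ncard ⟨hsub, fun h => hx' (h hx)⟩ (Set.toFinite _)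
  obtain ⟨z, hz, hz'⟩ := ih _ hlt hxw rfl
  exact ⟨z, hsub hz, hz'⟩

theorem Connected.isBridge_deleteEdges_of_not_isBridge [Fintype V] (hG : G.Connected)
    (hcard : G.edgeSet.ncard = Fintype.card V) {e f : Sym2 V} (he : e ∈ G.edgeSet)
    (hf : f ∈ G.edgeSet) (hfe : f ≠ e) (hne : ¬ G.IsBridge e) :
    (G.deleteEdges {e}).IsBridge f := by
  have hT : (G.deleteEdges {e}).IsTree := by
    rw [isTree_iff_connected_and_card]
    constructor
    · induction e with | h x y
      exact hG.connected_delete_edge_of_not_isBridge hne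
    · rw [edgeSet_deleteEdges, Nat.card_coe_set_eq, Set.ncard_sdiff_singleton_add_one he,
        hcard, Nat.card_eq_fintype_card]
  exact isAcyclic_iff_forall_isBridge.1 hT.isAcyclic
    (by rw [edgeSet_deleteEdges]; exact ⟨hf, hfe⟩)

section Triangle

variable {a b c : V}

theorem adj_deleteEdges_of_notMem_triangleEdges (hab : G.Adj a b) (hbc : G.Adj b c)
    (hca : G.Adj c a) {e : Sym2 V} (he : e ∉ triangleEdges a b c) :
    (G.deleteEdges {e}).Adj a b ∧ (G.deleteEdges {e}).Adj b c ∧ (G.deleteEdges {e}).Adj c a := by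
  simp only [triangleEdges, Set.mem_insert_iff, Set.mem_singleton_iff] at he
  simp only [deleteEdges_adj, Set.mem_singleton_iff]
  grind

theorem isBridge_of_mem_deleteEdges_triangleEdges [Fintype V] (hG : G.Connected)
    (hcard : G.edgeSet.ncard = Fintype.card V) (hab : G.Adj a b) (hbc : G.Adj b c)
    (hca : G.Adj c a) {e : Sym2 V} (he : e ∈ (G.deleteEdges (triangleEdges a b c)).edgeSet) :
    G.IsBridge e := by
  rw [edgeSet_deleteEdges] at he
  by_contra hne
  have hb := hG.isBridge_deleteEdges_of_not_isBridge hcard he.1 (f := s(a, b)) hab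
    (fun h => he.2 (h ▸ Or.inl rfl)) hne
  rw [isBridge_iff] at hb
  obtain ⟨-, h1, h2⟩ := adj_deleteEdges_of_notMem_triangleEdges hab hbc hca he.2
  refine hb ((Adj.reachable ?_).trans (Adj.reachable (v := c) ?_).symm)
  · rw [deleteEdges_adj]
    refine ⟨h2.symm, ?_⟩
    have := hbc.ne
    have := hca.ne
    simp
    grind
  · rw [deleteEdges_adj]
    refine ⟨h1, ?_⟩
    have := hbc.ne
    have := hca.ne
    simp
    grind

theorem not_reachable_deleteEdges_triangleEdges [Fintype V] (hG : G.Connected)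
    (hcard : G.edgeSet.ncard = Fintype.card V) (hab : G.Adj a b) (hbc : G.Adj b c)
    (hca : G.Adj c a) : ¬ (G.deleteEdges (triangleEdges a b c)).Reachable a b := by
  have hne := hab.ne
  have hne' := hbc.ne
  have hne'' := hca.ne
  have hb := hG.isBridge_deleteEdges_of_not_isBridge hcard (e := s(c, a)) hca (f := s(a, b)) hab
    (by simp; grind) (by
      rw [isBridge_iff, not_not]
      refine (Adj.reachable (v := b) ?_).trans (Adj.reachable ?_)
      · rw [deleteEdges_adj]
        exact ⟨hbc.symm, by simp; grind⟩
      · rw [deleteEdges_adj]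
        exact ⟨hab.symm, by simp; grind⟩)
  rw [isBridge_iff] at hb
  refine fun h => hb (h.mono ?_)
  rw [deleteEdges_deleteEdges]
  refine deleteEdges_anti ?_
  rintro e (rfl | rfl)
  · exact Or.inr (Or.inr rfl)
  · exact Or.inl rfl

theorem exists_reachable_deleteEdges_triangleEdges (hG : G.Connected) (x : V) :
    ∃ t, (t = a ∨ t = b ∨ t = c) ∧ (G.deleteEdges (triangleEdges a b c)).Reachable t x := by
  obtain ⟨p⟩ := hG.preconnected a x
  by_contra! h
  obtain ⟨d, -, h1, h2⟩ := p.exists_boundary_dart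
    {x | ∃ t, (t = a ∨ t = b ∨ t = c) ∧ (G.deleteEdges (triangleEdges a b c)).Reachable t x}
    ⟨a, Or.inl rfl, Reachable.refl _⟩ (fun ⟨t, ht, h'⟩ => h t ht h')
  obtain ⟨t, ht, h3⟩ := h1
  by_cases he : s(d.fst, d.snd) ∈ triangleEdges a b c
  · refine h2 ⟨d.snd, ?_, Reachable.refl _⟩
    simp only [triangleEdges, Set.mem_insert_iff, Set.mem_singleton_iff, Sym2.eq_iff] at he
    tauto
  · refine h2 ⟨t, ht, h3.trans (Adj.reachable ?_)⟩
    rw [deleteEdges_adj]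
    exact ⟨d.adj, he⟩

/-- A walk leaving the component of `a` uses one of the two triangle edges at `a`. -/
theorem Walk.mem_edges_of_reachable_ne [Fintype V] (hG : G.Connected)
    (hcard : G.edgeSet.ncard = Fintype.card V) (hab : G.Adj a b) (hbc : G.Adj b c)
    (hca : G.Adj c a) {z w : V} (p : G.Walk z w)
    (hzw : ¬ ((G.deleteEdges (triangleEdges a b c)).Reachable a z ↔
      (G.deleteEdges (triangleEdges a b c)).Reachable a w)) :
    s(a, b) ∈ p.edges ∨ s(c, a) ∈ p.edges := by
  wlog hz : (G.deleteEdges (triangleEdges a b c)).Reachable a z generalizing z w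
  · simpa using this p.reverse (fun h => hzw h.symm) (by tauto)
  have hw : ¬ (G.deleteEdges (triangleEdges a b c)).Reachable a w := by tauto
  obtain ⟨d, hd, h1, h2⟩ := p.exists_boundary_dart
    {x | (G.deleteEdges (triangleEdges a b c)).Reachable a x} hz hw
  simp only [Set.mem_ofPred_eq] at h1 h2
  have he : s(d.fst, d.snd) ∈ p.edges := List.mem_map_of_mem hd
  have ht : s(d.fst, d.snd) ∈ triangleEdges a b c := by
    by_contra ht
    refine h2 (h1.trans (Adj.reachable ?_))
    rw [deleteEdges_adj]
    exact ⟨d.adj, ht⟩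
  have hnb := not_reachable_deleteEdges_triangleEdges hG hcard hab hbc hca
  have hnc : ¬ (G.deleteEdges (triangleEdges a b c)).Reachable a c := by
    rw [← triangleEdges_rotate, ← triangleEdges_rotate]
    exact fun h => not_reachable_deleteEdges_triangleEdges hG hcard hca hab hbc h.symm
  rcases ht with ht | ht | ht
  · exact Or.inl (ht ▸ he)
  · rcases Sym2.eq_iff.1 ht with ⟨h3, -⟩ | ⟨h3, -⟩ <;> rw [h3] at h1 <;> contradiction
  · exact Or.inr ((Set.mem_singleton_iff.1 ht) ▸ he)

end Triangle

end SimpleGraph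

section Coloring

variable {V α : Type*} {G : SimpleGraph V} {c : Sym2 V → α}

theorem exists_rainbow_path_of_injOn {u w : V} (p : G.Walk u w)
    (hc : Set.InjOn c {e | e ∈ p.edges}) :
    ∃ q : G.Walk u w, q.IsPath ∧ (q.edges.map c).Nodup := by
  classical
  refine ⟨p.bypass, p.bypass_isPath, ?_⟩
  refine List.Nodup.map_on (fun x hx y hy h => ?_) p.bypass_isPath.isTrail.edges_nodup
  exact hc (p.edges_bypass_subset_edges hx) (p.edges_bypass_subset_edges hy) h

theorem IsRainbowConnected.exists_walk_injOn (hc : IsRainbowConnected G c) (u w : V) :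
    ∃ p : G.Walk u w, Set.InjOn c {e | e ∈ p.edges} := by
  obtain ⟨p, -, hp⟩ := hc u w
  exact ⟨p, fun x hx y hy h => List.inj_on_of_nodup_map hp hx hy h⟩

theorem SimpleGraph.IsBridge.eq_of_isRainbowConnected (hG : G.Connected)
    (hc : IsRainbowConnected G c) {e f : Sym2 V} (he : G.IsBridge e) (hf : G.IsBridge f)
    (h : c e = c f) : e = f := by
  obtain ⟨o⟩ := hG.nonempty
  obtain ⟨x, -, -, hx, -⟩ := he.exists_mem_cutOff hG o
  obtain ⟨y, -, -, hy, -⟩ := hf.exists_mem_cutOff hG o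
  have ho : ∀ e, o ∉ G.cutOff o e := fun e h => h (Reachable.refl _)
  by_cases hxf : x ∈ G.cutOff o f
  · obtain ⟨p, hp⟩ := hc.exists_walk_injOn x o
    exact hp (p.mem_edges_of_mem_cutOff hx (ho e)) (p.mem_edges_of_mem_cutOff hxf (ho f)) h
  by_cases hye : y ∈ G.cutOff o e
  · obtain ⟨p, hp⟩ := hc.exists_walk_injOn y o
    exact hp (p.mem_edges_of_mem_cutOff hye (ho e)) (p.mem_edges_of_mem_cutOff hy (ho f)) h
  obtain ⟨p, hp⟩ := hc.exists_walk_injOn x y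
  refine hp (p.mem_edges_of_mem_cutOff hx hye) ?_ h
  simpa using p.reverse.mem_edges_of_mem_cutOff hy hxf

variable {x y z : V}

theorem isRainbowConnected_of_injOn_deleteEdges_triangleEdges (hG : G.Connected)
    (hxy : G.Adj x y) (hyz : G.Adj y z) (hzx : G.Adj z x)
    (hinj : Set.InjOn c (G.deleteEdges (triangleEdges x y z)).edgeSet)
    (hne : ∀ e ∈ (G.deleteEdges (triangleEdges x y z)).edgeSet,
      ∀ t ∈ triangleEdges x y z, c e ≠ c t) :
    IsRainbowConnected G c := by
  intro u w
  have hle : G.deleteEdges (triangleEdges x y z) ≤ G := deleteEdges_le _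
  obtain ⟨s, hs, ⟨p⟩⟩ := exists_reachable_deleteEdges_triangleEdges (a := x) (b := y) (c := z) hG u
  obtain ⟨t, ht, ⟨q⟩⟩ := exists_reachable_deleteEdges_triangleEdges (a := x) (b := y) (c := z) hG w
  have hmem : ∀ {u v} (p : (G.deleteEdges (triangleEdges x y z)).Walk u v),
      ∀ e ∈ (p.mapLe hle).edges, e ∈ (G.deleteEdges (triangleEdges x y z)).edgeSet := by
    intro u v p e he
    rw [Walk.edges_mapLe_eq_edges] at he
    exact p.edges_subset_edgeSet he
  rcases eq_or_ne s t with rfl | hst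
  · refine exists_rainbow_path_of_injOn ((p.reverse.append q).mapLe hle) ?_
    exact hinj.mono (hmem _)
  · have hT : s(s, t) ∈ triangleEdges x y z := by
      simp only [triangleEdges, Set.mem_insert_iff, Set.mem_singleton_iff, Sym2.eq_iff]
      grind
    have hadj : G.Adj s t := by
      rcases hT with h | h | h <;> rw [← mem_edgeSet, h] <;> assumption
    refine exists_rainbow_path_of_injOn
      ((p.reverse.mapLe hle).append (.cons hadj (q.mapLe hle))) ?_
    have key : ∀ e ∈ ((p.reverse.mapLe hle).append (.cons hadj (q.mapLe hle))).edges,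
        e ∈ (G.deleteEdges (triangleEdges x y z)).edgeSet ∨ e = s(s, t) := by
      intro e he
      rw [Walk.edges_append, Walk.edges_cons, List.mem_append, List.mem_cons] at he
      rcases he with he | he | he
      · exact Or.inl (hmem _ _ he)
      · exact Or.inr he
      · exact Or.inl (hmem _ _ he)
    intro e he f hf h
    rcases key e he with h1 | rfl <;> rcases key f hf with h2 | rfl
    · exact hinj h1 h2 h
    · exact absurd h (hne _ h1 _ hT)
    · exact absurd h.symm (hne _ h2 _ hT)
    · rfl

/-- Suppose the colors of the two triangle edges at `x` also occur on bridges `e` and `f`. Then the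
vertices cut off by `e` and by `f` are distinct, and lie on the same side of the cut formed by the
two triangle edges. -/
theorem IsRainbowConnected.ne_and_reachable_iff [Fintype V] (hG : G.Connected)
    (hcard : G.edgeSet.ncard = Fintype.card V) (hxy : G.Adj x y) (hyz : G.Adj y z)
    (hzx : G.Adj z x) (hc : IsRainbowConnected G c) {o : V} (ho : o = x ∨ o = y ∨ o = z)
    {e f : Sym2 V} (he : e ∈ (G.deleteEdges (triangleEdges x y z)).edgeSet)
    (hf : f ∈ (G.deleteEdges (triangleEdges x y z)).edgeSet)
    (hce : c e = c s(x, y)) (hcf : c f = c s(z, x)) {u w : V}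
    (hu : u ∈ G.cutOff o e) (hw : w ∈ G.cutOff o f) :
    u ≠ w ∧ ((G.deleteEdges (triangleEdges x y z)).Reachable x u ↔
      (G.deleteEdges (triangleEdges x y z)).Reachable x w) := by
  rw [edgeSet_deleteEdges] at he hf
  have hroot : ∀ e ∉ triangleEdges x y z, x ∉ G.cutOff o e ∧ y ∉ G.cutOff o e := by
    intro e he
    obtain ⟨h1, h2, h3⟩ := adj_deleteEdges_of_notMem_triangleEdges hxy hyz hzx he
    simp only [cutOff, Set.mem_ofPred_eq, not_not]
    rcases ho with rfl | rfl | rfl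
    · exact ⟨Reachable.refl _, h1.reachable⟩
    · exact ⟨h1.symm.reachable, Reachable.refl _⟩
    · exact ⟨h3.reachable, h2.symm.reachable⟩
  have hcut : ∀ {u w : V} (p : G.Walk u w), Set.InjOn c {e | e ∈ p.edges} →
      e ∈ p.edges → f ∈ p.edges →
      ((G.deleteEdges (triangleEdges x y z)).Reachable x u ↔
        (G.deleteEdges (triangleEdges x y z)).Reachable x w) := by
    intro u w p hp hep hfp
    by_contra h
    rcases p.mem_edges_of_reachable_ne hG hcard hxy hyz hzx h with h | h
    · exact he.2 (hp hep h hce ▸ Or.inl rfl)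
    · exact hf.2 (hp hfp h hcf ▸ Or.inr (Or.inr rfl))
  have hdisj : ∀ u ∈ G.cutOff o e, u ∉ G.cutOff o f := by
    intro u hue huf
    obtain ⟨p, hp⟩ := hc.exists_walk_injOn u x
    obtain ⟨q, hq⟩ := hc.exists_walk_injOn u y
    have h1 := hcut p hp (p.mem_edges_of_mem_cutOff hue (hroot e he.2).1)
      (p.mem_edges_of_mem_cutOff huf (hroot f hf.2).1)
    have h2 := hcut q hq (q.mem_edges_of_mem_cutOff hue (hroot e he.2).2)
      (q.mem_edges_of_mem_cutOff huf (hroot f hf.2).2)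
    exact not_reachable_deleteEdges_triangleEdges hG hcard hxy hyz hzx
      (h2.1 (h1.2 (Reachable.refl _)))
  refine ⟨fun h => hdisj u hu (h ▸ hw), ?_⟩
  obtain ⟨p, hp⟩ := hc.exists_walk_injOn u w
  refine hcut p hp (p.mem_edges_of_mem_cutOff hu fun h => hdisj w h hw) ?_
  simpa using p.reverse.mem_edges_of_mem_cutOff hw (hdisj u hu)

/-- If every triangle color occurs on a bridge and the tree at `x` has no leaf, then some triangle
vertex carries a tree with at least three leaves. -/
theorem IsRainbowConnected.exists_three_leaves [Fintype V] (hG : G.Connected)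
    (hcard : G.edgeSet.ncard = Fintype.card V) (hxy : G.Adj x y) (hyz : G.Adj y z)
    (hzx : G.Adj z x) (hc : IsRainbowConnected G c)
    (hcol : ∀ t ∈ triangleEdges x y z,
      ∃ e ∈ (G.deleteEdges (triangleEdges x y z)).edgeSet, c e = c t)
    (hzero : ∀ u, u ≠ x → (G.deleteEdges (triangleEdges x y z)).Reachable x u →
      ((G.deleteEdges (triangleEdges x y z)).neighborSet u).ncard ≠ 1) :
    ∃ t, (t = x ∨ t = y ∨ t = z) ∧
      3 ≤ {u : V | u ≠ t ∧ (G.deleteEdges (triangleEdges x y z)).Reachable t u ∧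
        ((G.deleteEdges (triangleEdges x y z)).neighborSet u).ncard = 1}.ncard := by
  have hleaf : ∀ e ∈ (G.deleteEdges (triangleEdges x y z)).edgeSet, ∃ u ∈ G.cutOff x e,
      ((G.deleteEdges (triangleEdges x y z)).neighborSet u).ncard = 1 := fun e he =>
    exists_leaf_mem_cutOff hG (deleteEdges_le _)
      (fun e he => isBridge_of_mem_deleteEdges_triangleEdges hG hcard hxy hyz hzx he) x he
  have hroot : ∀ e ∈ (G.deleteEdges (triangleEdges x y z)).edgeSet, ∀ u ∈ G.cutOff x e,
      u ≠ x ∧ u ≠ y ∧ u ≠ z := by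
    intro e he u hu
    rw [edgeSet_deleteEdges] at he
    obtain ⟨h1, h2, h3⟩ := adj_deleteEdges_of_notMem_triangleEdges hxy hyz hzx he.2
    refine ⟨?_, ?_, ?_⟩ <;> rintro rfl
    · exact hu (Reachable.refl _)
    · exact hu h1.reachable
    · exact hu h3.symm.reachable
  obtain ⟨e, he, hce⟩ := hcol s(x, y) (Or.inl rfl)
  obtain ⟨f, hf, hcf⟩ := hcol s(y, z) (Or.inr (Or.inl rfl))
  obtain ⟨g, hg, hcg⟩ := hcol s(z, x) (Or.inr (Or.inr rfl))
  obtain ⟨u, hu, hu1⟩ := hleaf e he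
  obtain ⟨v, hv, hv1⟩ := hleaf f hf
  obtain ⟨w, hw, hw1⟩ := hleaf g hg
  have hr1 := triangleEdges_rotate x y z
  have hr2 : triangleEdges z x y = triangleEdges x y z := (triangleEdges_rotate z x y).symm
  obtain ⟨hne1, hx⟩ := hc.ne_and_reachable_iff hG hcard hxy hyz hzx (o := x) (by tauto)
    he hg hce hcg hu hw
  obtain ⟨hne2, hy⟩ := hc.ne_and_reachable_iff hG hcard hyz hzx hxy (o := x) (by tauto)
    (hr1 ▸ hf) (hr1 ▸ he) hcf hce hv hu
  obtain ⟨hne3, hz⟩ := hc.ne_and_reachable_iff hG hcard hzx hxy hyz (o := x) (by tauto)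
    (hr2 ▸ hg) (hr2 ▸ hf) hcg hcf hw hv
  rw [hr1] at hy
  rw [hr2] at hz
  have hthree : ∃ t, (t = x ∨ t = y ∨ t = z) ∧
      (G.deleteEdges (triangleEdges x y z)).Reachable t u ∧
      (G.deleteEdges (triangleEdges x y z)).Reachable t v ∧
      (G.deleteEdges (triangleEdges x y z)).Reachable t w := by
    have htrans : ∀ {s t p q : V}, (G.deleteEdges (triangleEdges x y z)).Reachable s p →
        (G.deleteEdges (triangleEdges x y z)).Reachable t p →
        (G.deleteEdges (triangleEdges x y z)).Reachable t q →
        (G.deleteEdges (triangleEdges x y z)).Reachable s q :=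
      fun h1 h2 h3 => h1.trans (h2.symm.trans h3)
    obtain ⟨t, ht, h⟩ := exists_reachable_deleteEdges_triangleEdges
      (a := x) (b := y) (c := z) hG u
    obtain ⟨t', ht', h'⟩ := exists_reachable_deleteEdges_triangleEdges
      (a := x) (b := y) (c := z) hG v
    obtain ⟨t'', ht'', h''⟩ := exists_reachable_deleteEdges_triangleEdges
      (a := x) (b := y) (c := z) hG w
    have hux : ¬ (G.deleteEdges (triangleEdges x y z)).Reachable x u :=
      fun h => hzero u (hroot e he u hu).1 h hu1
    have hvx : ¬ (G.deleteEdges (triangleEdges x y z)).Reachable x v :=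
      fun h => hzero v (hroot f hf v hv).1 h hv1
    clear hleaf hroot hcol hzero
    rcases ht with rfl | rfl | rfl <;> rcases ht' with rfl | rfl | rfl <;>
      rcases ht'' with rfl | rfl | rfl <;> grind
  obtain ⟨t, ht, htu, htv, htw⟩ := hthree
  refine ⟨t, ht, ?_⟩
  have hne : ∀ e ∈ (G.deleteEdges (triangleEdges x y z)).edgeSet, ∀ u ∈ G.cutOff x e, u ≠ t := by
    intro e he u hu
    have := hroot e he u hu
    rcases ht with rfl | rfl | rfl <;> tauto
  rw [← Set.ncard_eq_three.2 ⟨u, v, w, hne2.symm, hne1, hne3.symm, rfl⟩]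
  refine Set.ncard_le_ncard ?_ (Set.toFinite _)
  rintro s (rfl | rfl | rfl)
  · exact ⟨hne e he _ hu, htu, hu1⟩
  · exact ⟨hne f hf _ hv, htv, hv1⟩
  · exact ⟨hne g hg _ hw, htw, hw1⟩

end Coloring

/-- Let `G` be a connected unicyclic graph with m edges whose unique
cycle `v₁v₂v₃v₁` has length 3. If for some index `i` (mod 3), `l(vᵢ) = 0`,
`l(v_{i+1}) ≤ 2` and `l(v_{i+2}) ≤ 2`, then rc(G) = m − 2. -/
theorem stmt_9 {V : Type*} [Fintype V] (G : SimpleGraph V)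
    (hconn : G.Connected) (huni : G.edgeSet.ncard = Fintype.card V)
    (v : ZMod 3 → V) (hinj : Function.Injective v)
    (hadj : ∀ i : ZMod 3, G.Adj (v i) (v (i + 1)))
    (hl : ∃ i : ZMod 3, numLeaves G v i = 0 ∧ numLeaves G v (i + 1) ≤ 2 ∧
      numLeaves G v (i + 2) ≤ 2) :
    rc G = G.edgeSet.ncard - 2 := by
  classical
  obtain ⟨i, h0, h1, h2⟩ := hl
  have h12 : i + 1 + 1 = i + 2 := by rw [add_assoc]; rfl
  have h20 : i + 2 + 1 = i := (by decide : ∀ i : ZMod 3, i + 2 + 1 = i) i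
  have hxy : G.Adj (v i) (v (i + 1)) := hadj i
  have hyz : G.Adj (v (i + 1)) (v (i + 2)) := h12 ▸ hadj (i + 1)
  have hzx : G.Adj (v (i + 2)) (v i) := by simpa only [h20] using hadj (i + 2)
  have htri := cycleEdges_eq_triangleEdges v i
  simp only [numLeaves, htri] at h0 h1 h2
  set H := G.deleteEdges (triangleEdges (v i) (v (i + 1)) (v (i + 2))) with hH
  have hsub : triangleEdges (v i) (v (i + 1)) (v (i + 2)) ⊆ G.edgeSet := by
    rintro e (rfl | rfl | rfl) <;> assumption
  have hcardH : H.edgeSet.ncard + 3 = G.edgeSet.ncard := by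
    rw [← ncard_triangleEdges hxy.ne hyz.ne hzx.ne, hH, edgeSet_deleteEdges]
    exact Set.ncard_sdiff_add_ncard_of_subset hsub (Set.toFinite _)
  have hm : G.edgeSet.ncard - 2 = H.edgeSet.ncard + 1 := by omega
  rw [hm]
  have hub : ∃ c : Sym2 V → Fin (H.edgeSet.ncard + 1), IsRainbowConnected G c := by
    let φ : H.edgeSet ≃ Fin H.edgeSet.ncard := Finite.equivFinOfCardEq (Nat.card_coe_set_eq _)
    refine ⟨fun e => if h : e ∈ H.edgeSet then (φ ⟨e, h⟩).castSucc else Fin.last _,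
      isRainbowConnected_of_injOn_deleteEdges_triangleEdges hconn hxy hyz hzx ?_ ?_⟩
    · intro e he f hf h
      rw [← hH] at he hf
      simpa only [he, hf, dite_true, Fin.castSucc_inj, φ.injective.eq_iff, Subtype.mk.injEq]
        using h
    · intro e he t ht
      have ht' : t ∉ H.edgeSet := by
        rw [hH, edgeSet_deleteEdges]
        exact fun h => h.2 ht
      rw [← hH] at he
      simpa only [he, ht', dite_true, dite_false] using (Fin.castSucc_lt_last _).ne
  refine le_antisymm (Nat.sInf_le hub) (le_csInf ⟨_, hub⟩ ?_)
  rintro k ⟨c, hc⟩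
  by_contra! hk
  have hinjOn : Set.InjOn c H.edgeSet := fun e he f hf h =>
    SimpleGraph.IsBridge.eq_of_isRainbowConnected hconn hc
      (isBridge_of_mem_deleteEdges_triangleEdges hconn huni hxy hyz hzx he)
      (isBridge_of_mem_deleteEdges_triangleEdges hconn huni hxy hyz hzx hf) h
  have himage : c '' H.edgeSet = Set.univ := by
    refine Set.eq_of_subset_of_ncard_le (Set.subset_univ _) ?_
    rw [hinjOn.ncard_image, Set.ncard_univ, Nat.card_fin]
    omega
  obtain ⟨t, ht, h3⟩ := hc.exists_three_leaves hconn huni hxy hyz hzx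
    (fun t _ => (himage ▸ Set.mem_univ (c t) : c t ∈ c '' H.edgeSet))
    (fun u hu hr h1 => ((Set.ncard_eq_zero (Set.toFinite _)).1 h0).subset ⟨hu, hr, h1⟩)
  rw [← hH] at h3
  rcases ht with rfl | rfl | rfl <;> omega
end

section
/- Let G be a connected unicyclic graph with m edges whose unique cycle C = v₁v₂v₃v₄v₁ has length 4 (girth 4). If there is an index i (mod 4) with l(vᵢ) = l(v_{i+2}) = 0, l(v_{i+1}) ≤ 1 and l(v_{i+3}) ≤ 1, then rc(G) = m − 2. -/
namespace SimpleGraph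

variable {V : Type*}

/-- The vertices of degree one, other than `r`, in the component of `r`. -/
def rootedLeaves (H : SimpleGraph V) (r : V) : Set V :=
  {x | x ≠ r ∧ H.Reachable r x ∧ (H.neighborSet x).ncard = 1}

/-- In a forest, a vertex has at most one neighbour that is not farther from the root. -/
lemma IsAcyclic.eq_of_adj_of_dist_le {H : SimpleGraph V} (hH : H.IsAcyclic) {r z w₁ w₂ : V}
    (hr : H.Reachable r z) (h₁ : H.Adj z w₁) (h₂ : H.Adj z w₂)
    (hd₁ : H.dist r w₁ ≤ H.dist r z) (hd₂ : H.dist r w₂ ≤ H.dist r z) : w₁ = w₂ := by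
  classical
  have key : ∀ w, H.Adj z w → H.dist r w ≤ H.dist r z →
      ∃ q : H.Path r z, q.1.penultimate = w := by
    intro w h hd
    obtain ⟨p, hp, hpl⟩ := (hr.trans h.reachable).exists_path_of_dist
    have hz : z ∉ p.support := by
      intro hz
      have := p.length_takeUntil_lt_length hz h.ne
      have := dist_le (p.takeUntil z hz)
      omega
    exact ⟨⟨p.concat h.symm, hp.concat hz h.symm⟩, p.penultimate_concat h.symm⟩
  obtain ⟨q₁, rfl⟩ := key w₁ h₁ hd₁
  obtain ⟨q₂, rfl⟩ := key w₂ h₂ hd₂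
  rw [(hH.subsingleton_path r z).elim q₁ q₂]

lemma Reachable.dist_lt_card [Fintype V] {H : SimpleGraph V} {r z : V} (hr : H.Reachable r z) :
    H.dist r z < Fintype.card V := by
  obtain ⟨p, hp, hpl⟩ := hr.exists_path_of_dist
  exact hpl ▸ hp.length_lt

/-- In a finite forest, every vertex other than the root lies on a geodesic from the root
to a leaf. -/
lemma IsAcyclic.exists_rootedLeaf [Fintype V] {H : SimpleGraph V} (hH : H.IsAcyclic) {r z : V}
    (hr : H.Reachable r z) (hz : z ≠ r) :
    ∃ x ∈ H.rootedLeaves r, ∃ p : H.Walk z x, H.dist r z + p.length = H.dist r x := by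
  induction hn : Fintype.card V - H.dist r z using Nat.strong_induction_on generalizing z with
  | _ n ih =>
  by_cases hleaf : (H.neighborSet z).ncard = 1
  · exact ⟨z, ⟨hz, hr, hleaf⟩, .nil, rfl⟩
  have hne : (H.neighborSet z).Nonempty := by
    obtain ⟨p⟩ := hr.symm
    cases p with
    | nil => exact absurd rfl hz
    | cons h _ => exact ⟨_, h⟩
  have hpos := (Set.ncard_pos (Set.toFinite _)).2 hne
  obtain ⟨w₁, h₁, w₂, h₂, hw⟩ := (Set.one_lt_ncard (Set.toFinite _)).1
    (show 1 < (H.neighborSet z).ncard by omega)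
  obtain ⟨w, h, hd⟩ : ∃ w, H.Adj z w ∧ H.dist r z < H.dist r w := by
    by_contra! hcon
    exact hw (hH.eq_of_adj_of_dist_le hr h₁ h₂ (hcon _ h₁) (hcon _ h₂))
  have hrw := hr.trans h.reachable
  have hlt := hrw.dist_lt_card
  obtain ⟨x, hx, p, hp⟩ := ih _ (by omega) hrw (by rintro rfl; simp at hd) rfl
  refine ⟨x, hx, p.cons h, ?_⟩
  have := h.diff_dist_adj (u := r)
  rw [Walk.length_cons]
  omega

lemma IsAcyclic.eq_root_of_rootedLeaves_eq_empty [Fintype V] {H : SimpleGraph V}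
    (hH : H.IsAcyclic) {r z : V} (hl : (H.rootedLeaves r).ncard = 0) (hr : H.Reachable r z) :
    z = r := by
  by_contra hz
  obtain ⟨x, hx, -⟩ := hH.exists_rootedLeaf hr hz
  rw [(Set.ncard_eq_zero (Set.toFinite _)).1 hl] at hx
  exact hx

/-- In a tree with at most one leaf besides the root, vertices are determined by their distance
to the root. -/
lemma IsAcyclic.injOn_dist [Fintype V] {H : SimpleGraph V} (hH : H.IsAcyclic) {r : V}
    (hl : (H.rootedLeaves r).ncard ≤ 1) : Set.InjOn (H.dist r) {z | H.Reachable r z} := by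
  intro z₁ hz₁ z₂ hz₂ hd
  by_cases h₁ : z₁ = r
  · subst h₁
    rw [dist_self, eq_comm] at hd
    exact (Reachable.dist_eq_zero_iff hz₂).1 hd
  by_cases h₂ : z₂ = r
  · subst h₂
    rw [dist_self] at hd
    exact ((Reachable.dist_eq_zero_iff hz₁).1 hd).symm
  obtain ⟨x₁, hx₁, p₁, hp₁⟩ := hH.exists_rootedLeaf hz₁ h₁
  obtain ⟨x₂, hx₂, p₂, hp₂⟩ := hH.exists_rootedLeaf hz₂ h₂
  obtain rfl := (Set.ncard_le_one (Set.toFinite _)).1 hl _ hx₁ _ hx₂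
  have key : ∀ z, H.Reachable r z → ∀ p : H.Walk z x₁, H.dist r z + p.length = H.dist r x₁ →
      ∃ q : H.Path r x₁, q.1.getVert (H.dist r z) = z := by
    intro z hz p hp
    obtain ⟨g, hg⟩ := hz.exists_walk_length_eq_dist
    refine ⟨⟨g.append p, Walk.isPath_of_length_eq_dist _ (by simp; omega)⟩, ?_⟩
    simp [Walk.getVert_append, ← hg]
  obtain ⟨q₁, hq₁⟩ := key z₁ hz₁ p₁ hp₁
  obtain ⟨q₂, hq₂⟩ := key z₂ hz₂ p₂ hp₂
  rw [← hq₁, ← hq₂, hd, (hH.subsingleton_path r x₁).elim q₁ q₂]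

/-- A tree with at most one leaf besides the root has a vertex at distance `n - 1` from it. -/
lemma IsAcyclic.exists_ncard_le_dist_add_one [Fintype V] {H : SimpleGraph V} (hH : H.IsAcyclic)
    {r : V} (hl : (H.rootedLeaves r).ncard ≤ 1) :
    ∃ x, H.Reachable r x ∧ {z | H.Reachable r z}.ncard ≤ H.dist r x + 1 := by
  by_contra! hcon
  have hpos : 0 < {z | H.Reachable r z}.ncard :=
    (Set.ncard_pos (Set.toFinite _)).2 ⟨r, Reachable.rfl⟩
  have h := Set.ncard_le_ncard_of_injOn (t := ↑(Finset.range ({z | H.Reachable r z}.ncard - 1)))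
    (H.dist r) (fun z hz => by have := hcon z hz; simp; omega) (hH.injOn_dist hl)
  rw [Set.ncard_coe_finset, Finset.card_range] at h
  omega

/-- The edges of the square `a — b — c — d — a`. -/
def squareEdges (a b c d : V) : Set (Sym2 V) :=
  {s(a, b), s(b, c), s(c, d), s(d, a)}

lemma squareEdges_rotate (a b c d : V) : squareEdges b c d a = squareEdges a b c d := by
  ext e
  simp only [squareEdges, Set.mem_insert_iff, Set.mem_singleton_iff]
  tauto

lemma mem_of_mem_squareEdges {x y : V} {a b c d : V}
    (hxy : s(x, y) ∈ squareEdges a b c d) :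
    y = a ∨ y = b ∨ y = c ∨ y = d := by
  simp only [squareEdges, Set.mem_insert_iff, Set.mem_singleton_iff, Sym2.eq_iff] at hxy
  tauto

/-- A square `a — b — c — d — a` in a connected unicyclic graph. -/
structure IsUnicyclicSquare [Fintype V] (G : SimpleGraph V) (a b c d : V) : Prop where
  connected : G.Connected
  ncard_edgeSet : G.edgeSet.ncard = Fintype.card V
  ab : G.Adj a b
  bc : G.Adj b c
  cd : G.Adj c d
  da : G.Adj d a
  ac : a ≠ c
  bd : b ≠ d

namespace IsUnicyclicSquare

variable [Fintype V] {G : SimpleGraph V} {a b c d : V}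

lemma rotate (h : G.IsUnicyclicSquare a b c d) : G.IsUnicyclicSquare b c d a :=
  ⟨h.connected, h.ncard_edgeSet, h.bc, h.cd, h.da, h.ab, h.bd, h.ac.symm⟩

lemma pairwise_ne (h : G.IsUnicyclicSquare a b c d) :
    a ≠ b ∧ a ≠ c ∧ a ≠ d ∧ b ≠ c ∧ b ≠ d ∧ c ≠ d :=
  ⟨h.ab.ne, h.ac, h.da.ne', h.bc.ne, h.bd, h.cd.ne⟩

/-- Deleting two edges of a unicyclic graph separates the ends of some edge. -/
lemma exists_adj_not_reachable (h : G.IsUnicyclicSquare a b c d) {e₁ e₂ : Sym2 V}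
    (h₁ : e₁ ∈ G.edgeSet) (h₂ : e₂ ∈ G.edgeSet) (hne : e₁ ≠ e₂) :
    ∃ x y, G.Adj x y ∧ ¬ (G.deleteEdges {e₁, e₂}).Reachable x y := by
  by_contra! hcon
  have hpre : (G.deleteEdges {e₁, e₂}).Preconnected := by
    intro x y
    obtain ⟨p⟩ := h.connected.preconnected x y
    induction p with
    | nil => rfl
    | cons hxy _ ih => exact (hcon _ _ hxy).trans ih
  have := h.connected.nonempty
  have hcard := (Connected.mk hpre).card_vert_le_card_edgeSet_add_one
  have hdiff := Set.ncard_sdiff (s := {e₁, e₂}) (t := G.edgeSet)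
    (by rintro e (rfl | rfl) <;> assumption) (Set.toFinite _)
  rw [Nat.card_coe_set_eq, edgeSet_deleteEdges, hdiff, Set.ncard_pair hne, h.ncard_edgeSet,
    Nat.card_eq_fintype_card] at hcard
  have : 1 < Fintype.card V := Fintype.one_lt_card_iff.2 ⟨a, b, h.ab.ne⟩
  omega

/-- If the ends of two edges stay connected after deleting both, we get a contradiction. -/
lemma false_of_reachable (h : G.IsUnicyclicSquare a b c d) {x₁ y₁ x₂ y₂ : V}
    (h₁ : G.Adj x₁ y₁) (h₂ : G.Adj x₂ y₂) (hne : s(x₁, y₁) ≠ s(x₂, y₂))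
    (hr₁ : (G.deleteEdges {s(x₁, y₁), s(x₂, y₂)}).Reachable x₁ y₁)
    (hr₂ : (G.deleteEdges {s(x₁, y₁), s(x₂, y₂)}).Reachable x₂ y₂) : False := by
  obtain ⟨x, y, hxy, hr⟩ := h.exists_adj_not_reachable h₁ h₂ hne
  have key : ∀ {u w : V}, (G.deleteEdges {s(x₁, y₁), s(x₂, y₂)}).Reachable u w →
      s(x, y) ≠ s(u, w) := by
    intro u w huw heq
    rcases Sym2.eq_iff.1 heq with ⟨rfl, rfl⟩ | ⟨rfl, rfl⟩
    exacts [hr huw, hr huw.symm]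
  refine hr (Adj.reachable ?_)
  rw [deleteEdges_adj]
  refine ⟨hxy, ?_⟩
  rintro (heq | heq)
  exacts [key hr₁ heq, key hr₂ heq]

lemma isAcyclic (h : G.IsUnicyclicSquare a b c d) :
    (G.deleteEdges (squareEdges a b c d)).IsAcyclic := by
  rw [isAcyclic_iff_forall_adj_isBridge]
  intro x y hxy
  rw [isBridge_iff]
  intro hr
  rw [deleteEdges_adj] at hxy
  obtain ⟨hxy, hmem⟩ := hxy
  simp only [squareEdges, Set.mem_insert_iff, Set.mem_singleton_iff, not_or] at hmem
  obtain ⟨n₁, n₂, n₃, n₄⟩ := hmem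
  refine h.false_of_reachable h.ab hxy (Ne.symm n₁) ?_ (hr.mono ?_)
  · have := h.pairwise_ne
    have h₂ : (G.deleteEdges {s(a, b), s(x, y)}).Adj b c := by
      rw [deleteEdges_adj]
      refine ⟨h.bc, ?_⟩
      rintro (heq | heq)
      · simp at heq; grind
      · exact n₂ heq.symm
    have h₃ : (G.deleteEdges {s(a, b), s(x, y)}).Adj c d := by
      rw [deleteEdges_adj]
      refine ⟨h.cd, ?_⟩
      rintro (heq | heq)
      · simp at heq; grind
      · exact n₃ heq.symm
    have h₄ : (G.deleteEdges {s(a, b), s(x, y)}).Adj d a := by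
      rw [deleteEdges_adj]
      refine ⟨h.da, ?_⟩
      rintro (heq | heq)
      · simp at heq; grind
      · exact n₄ heq.symm
    exact ((h₂.reachable.trans h₃.reachable).trans h₄.reachable).symm
  · rw [deleteEdges_deleteEdges]
    refine deleteEdges_anti ?_
    rintro e (rfl | rfl) <;> simp [squareEdges]

lemma not_reachable_adj (h : G.IsUnicyclicSquare a b c d) :
    ¬ (G.deleteEdges (squareEdges a b c d)).Reachable a b := by
  intro hr
  have := h.pairwise_ne
  have hr' : (G.deleteEdges {s(a, b), s(b, c)}).Reachable a b :=
    hr.mono (deleteEdges_anti (by rintro e (rfl | rfl) <;> simp [squareEdges]))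
  have h₃ : (G.deleteEdges {s(a, b), s(b, c)}).Adj c d := by
    simp [deleteEdges_adj, h.cd]; grind
  have h₄ : (G.deleteEdges {s(a, b), s(b, c)}).Adj d a := by
    simp [deleteEdges_adj, h.da]; grind
  exact h.false_of_reachable h.ab h.bc (by simp; grind) hr'
    ((h₃.reachable.trans h₄.reachable).trans hr').symm

lemma not_reachable_opposite (h : G.IsUnicyclicSquare a b c d) :
    ¬ (G.deleteEdges (squareEdges a b c d)).Reachable a c := by
  intro hr
  have := h.pairwise_ne
  have hr' : (G.deleteEdges {s(a, b), s(c, d)}).Reachable a c :=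
    hr.mono (deleteEdges_anti (by rintro e (rfl | rfl) <;> simp [squareEdges]))
  have h₂ : (G.deleteEdges {s(a, b), s(c, d)}).Adj b c := by
    simp [deleteEdges_adj, h.bc]; grind
  have h₄ : (G.deleteEdges {s(a, b), s(c, d)}).Adj d a := by
    simp [deleteEdges_adj, h.da]; grind
  exact h.false_of_reachable h.ab h.cd (by simp; grind)
    (hr'.trans h₂.reachable.symm) (h₄.reachable.trans hr').symm

lemma not_reachable_of_ne (h : G.IsUnicyclicSquare a b c d) {s t : V}
    (hs : s = a ∨ s = b ∨ s = c ∨ s = d) (ht : t = a ∨ t = b ∨ t = c ∨ t = d) (hst : s ≠ t) :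
    ¬ (G.deleteEdges (squareEdges a b c d)).Reachable s t := by
  have e₁ := squareEdges_rotate a b c d
  have e₂ := squareEdges_rotate b c d a
  have e₃ := squareEdges_rotate c d a b
  have hab := h.not_reachable_adj
  have hbc := h.rotate.not_reachable_adj
  have hcd := h.rotate.rotate.not_reachable_adj
  have hda := h.rotate.rotate.rotate.not_reachable_adj
  have hac := h.not_reachable_opposite
  have hbd := h.rotate.not_reachable_opposite
  rw [e₃, e₂, e₁] at hda
  rw [e₂, e₁] at hcd
  rw [e₁] at hbc hbd
  rcases hs with rfl | rfl | rfl | rfl <;> rcases ht with rfl | rfl | rfl | rfl <;>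
    first
    | exact absurd rfl hst
    | assumption
    | (rw [reachable_comm]; assumption)

/-- Every vertex lies in a tree attached to the square. -/
lemma exists_reachable (h : G.IsUnicyclicSquare a b c d) (x : V) :
    ∃ t, (t = a ∨ t = b ∨ t = c ∨ t = d) ∧
      (G.deleteEdges (squareEdges a b c d)).Reachable t x := by
  have key : ∀ {x w : V}, G.Walk x w → w = a → ∃ t, (t = a ∨ t = b ∨ t = c ∨ t = d) ∧
      (G.deleteEdges (squareEdges a b c d)).Reachable t x := by
    intro x w p hw
    induction p with
    | nil => exact ⟨_, .inl hw, .rfl⟩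
    | @cons x y _ hxy _ ih =>
      obtain ⟨t, ht, hty⟩ := ih hw
      by_cases hmem : s(y, x) ∈ squareEdges a b c d
      · exact ⟨x, mem_of_mem_squareEdges hmem, .rfl⟩
      · exact ⟨t, ht, hty.trans (Adj.reachable (deleteEdges_adj.2 ⟨hxy.symm, hmem⟩))⟩
  obtain ⟨p⟩ := h.connected.preconnected x a
  exact key p rfl

lemma squareEdges_subset (h : G.IsUnicyclicSquare a b c d) :
    squareEdges a b c d ⊆ G.edgeSet := by
  rintro e (rfl | rfl | rfl | rfl)
  exacts [h.ab, h.bc, h.cd, h.da]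

lemma ncard_squareEdges (h : G.IsUnicyclicSquare a b c d) :
    (squareEdges a b c d).ncard = 4 := by
  have := h.pairwise_ne
  rw [squareEdges, Set.ncard_insert_of_notMem, Set.ncard_insert_of_notMem, Set.ncard_pair] <;>
    simp <;> grind

lemma ncard_edgeSet_deleteEdges (h : G.IsUnicyclicSquare a b c d) :
    (G.deleteEdges (squareEdges a b c d)).edgeSet.ncard + 4 = G.edgeSet.ncard := by
  rw [edgeSet_deleteEdges, ← h.ncard_squareEdges]
  exact Set.ncard_sdiff_add_ncard_of_subset h.squareEdges_subset (Set.toFinite _)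

/-- The colouring of a unicyclic graph that alternates two colours on the square and is
injective elsewhere makes the graph rainbow connected. -/
lemma isRainbowConnected {α : Type*} (h : G.IsUnicyclicSquare a b c d) (f : Sym2 V → α)
    (hf : ∀ e ∈ (G.deleteEdges (squareEdges a b c d)).edgeSet, ∀ e', f e = f e' → e = e')
    (hab : f s(a, b) ≠ f s(b, c)) (hbc : f s(b, c) ≠ f s(c, d))
    (hcd : f s(c, d) ≠ f s(d, a)) (hda : f s(d, a) ≠ f s(a, b)) : IsRainbowConnected G f := by
  classical
  set H := G.deleteEdges (squareEdges a b c d) with hH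
  have hle : H ≤ G := deleteEdges_le _
  intro u w
  suffices hs : ∃ p : G.Walk u w, (p.edges.map f).Nodup by
    obtain ⟨p, hp⟩ := hs
    refine ⟨p.bypass, p.bypass_isPath, p.bypass_isPath.isTrail.edges_nodup.map_on ?_⟩
    intro e he e' he' hee
    exact List.inj_on_of_nodup_map hp (p.edges_bypass_subset_edges he)
      (p.edges_bypass_subset_edges he') hee
  have tree : ∀ {x y : V}, H.Reachable x y → ∃ p : G.Walk x y, (p.edges.map f).Nodup ∧
      ∀ e ∈ p.edges, e ∈ H.edgeSet ∧ ∀ z ∈ e, H.Reachable x z := by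
    intro x y hxy
    obtain ⟨p, hp⟩ := hxy.exists_isPath
    have hmem : ∀ e ∈ p.edges, e ∈ H.edgeSet := fun e he => p.edges_subset_edgeSet he
    refine ⟨p.mapLe hle, ?_, ?_⟩
    · rw [Walk.edges_mapLe_eq_edges]
      exact hp.isTrail.edges_nodup.map_on fun e he e' _ hee => hf e (hmem e he) e' hee
    · rw [Walk.edges_mapLe_eq_edges]
      refine fun e he => ⟨hmem e he, fun z hz => ?_⟩
      exact ⟨p.takeUntil z (p.mem_support_of_mem_edges he hz)⟩
  obtain ⟨s, hs, hsu⟩ := h.exists_reachable u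
  obtain ⟨t, ht, htw⟩ := h.exists_reachable w
  by_cases hst : s = t
  · subst hst
    obtain ⟨p, hp, -⟩ := tree (hsu.symm.trans htw)
    exact ⟨p, hp⟩
  have hsep := h.not_reachable_of_ne hs ht hst
  obtain ⟨q, hq, hqC⟩ : ∃ q : G.Walk s t, (q.edges.map f).Nodup ∧
      ∀ e ∈ q.edges, e ∈ squareEdges a b c d := by
    have one : ∀ {x y : V}, G.Adj x y → s(x, y) ∈ squareEdges a b c d →
        ∃ q : G.Walk x y, (q.edges.map f).Nodup ∧ ∀ e ∈ q.edges, e ∈ squareEdges a b c d :=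
      fun hxy hm => ⟨.cons hxy .nil, by simp, by simpa using hm⟩
    have two : ∀ {x y z : V}, G.Adj x y → G.Adj y z → s(x, y) ∈ squareEdges a b c d →
        s(y, z) ∈ squareEdges a b c d → f s(x, y) ≠ f s(y, z) →
        ∃ q : G.Walk x z, (q.edges.map f).Nodup ∧ ∀ e ∈ q.edges, e ∈ squareEdges a b c d :=
      fun hxy hyz hm₁ hm₂ hne => ⟨.cons hxy (.cons hyz .nil), by simpa using hne,
        by simpa using ⟨hm₁, hm₂⟩⟩
    have mab : s(a, b) ∈ squareEdges a b c d := by simp [squareEdges]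
    have mbc : s(b, c) ∈ squareEdges a b c d := by simp [squareEdges]
    have mcd : s(c, d) ∈ squareEdges a b c d := by simp [squareEdges]
    have mda : s(d, a) ∈ squareEdges a b c d := by simp [squareEdges]
    rcases hs with rfl | rfl | rfl | rfl <;> rcases ht with rfl | rfl | rfl | rfl <;>
      first
      | exact absurd rfl hst
      | exact one h.ab mab
      | exact one h.ab.symm (Sym2.eq_swap ▸ mab)
      | exact one h.bc mbc
      | exact one h.bc.symm (Sym2.eq_swap ▸ mbc)
      | exact one h.cd mcd
      | exact one h.cd.symm (Sym2.eq_swap ▸ mcd)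
      | exact one h.da mda
      | exact one h.da.symm (Sym2.eq_swap ▸ mda)
      | exact two h.ab h.bc mab mbc hab
      | exact two h.bc h.cd mbc mcd hbc
      | exact two h.cd h.da mcd mda hcd
      | exact two h.da h.ab mda mab hda
  obtain ⟨p₁, hp₁, hm₁⟩ := tree hsu
  obtain ⟨p₂, hp₂, hm₂⟩ := tree htw
  refine ⟨p₁.reverse.append (q.append p₂), ?_⟩
  have hHS : ∀ e ∈ H.edgeSet, e ∉ squareEdges a b c d := by
    intro e he
    rw [hH, edgeSet_deleteEdges] at he
    exact he.2
  simp only [Walk.edges_append, Walk.edges_reverse, List.map_append, List.map_reverse,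
    List.nodup_append, List.nodup_reverse, List.mem_reverse, List.mem_append, List.mem_map]
  refine ⟨hp₁, ⟨hq, hp₂, ?_⟩, ?_⟩
  · rintro _ ⟨e, he, rfl⟩ _ ⟨e', he', rfl⟩ hee
    obtain rfl := hf e' (hm₂ _ he').1 e hee.symm
    exact hHS _ (hm₂ _ he').1 (hqC _ he)
  · rintro _ ⟨e, he, rfl⟩ _ (⟨e', he', rfl⟩ | ⟨e', he', rfl⟩) hee
    · obtain rfl := hf e (hm₁ _ he).1 e' hee
      exact hHS _ (hm₁ _ he).1 (hqC _ he')
    · obtain rfl := hf e (hm₁ _ he).1 e' hee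
      induction e using Sym2.ind with
      | _ x y =>
        exact hsep (((hm₁ _ he).2 x (Sym2.mem_mk_left x y)).trans
          ((hm₂ _ he').2 x (Sym2.mem_mk_left x y)).symm)

/-- A unicyclic graph of girth 4 can be rainbow connected with two colours less than the number
of edges. -/
lemma exists_isRainbowConnected (h : G.IsUnicyclicSquare a b c d) :
    ∃ f : Sym2 V → Fin (G.edgeSet.ncard - 2), IsRainbowConnected G f := by
  classical
  set H := G.deleteEdges (squareEdges a b c d) with hH
  have hcard : Nat.card (H.edgeSet ⊕ Bool) = G.edgeSet.ncard - 2 := by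
    have := h.ncard_edgeSet_deleteEdges
    rw [← hH] at this
    rw [Nat.card_sum, Nat.card_coe_set_eq, Nat.card_eq_fintype_card, Fintype.card_bool]
    lia
  let φ : H.edgeSet ⊕ Bool ≃ Fin (G.edgeSet.ncard - 2) := Finite.equivFinOfCardEq hcard
  let g : Sym2 V → H.edgeSet ⊕ Bool := fun e =>
    if he : e ∈ H.edgeSet then .inl ⟨e, he⟩ else .inr (decide (e = s(a, b) ∨ e = s(c, d)))
  have hg : ∀ e ∈ squareEdges a b c d, g e = .inr (decide (e = s(a, b) ∨ e = s(c, d))) := by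
    intro e he
    refine dif_neg fun he' => ?_
    rw [hH, edgeSet_deleteEdges] at he'
    exact he'.2 he
  have := h.pairwise_ne
  have gab : g s(a, b) = .inr true := by rw [hg _ (by simp [squareEdges])]; simp
  have gbc : g s(b, c) = .inr false := by rw [hg _ (by simp [squareEdges])]; simp; grind
  have gcd : g s(c, d) = .inr true := by rw [hg _ (by simp [squareEdges])]; simp
  have gda : g s(d, a) = .inr false := by rw [hg _ (by simp [squareEdges])]; simp; grind
  refine ⟨φ ∘ g, h.isRainbowConnected _ ?_ ?_ ?_ ?_ ?_⟩
  · intro e he e' hee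
    have hee := φ.injective hee
    have he₁ : g e = .inl ⟨e, he⟩ := dif_pos he
    rw [he₁] at hee
    by_cases he' : e' ∈ H.edgeSet
    · have he₂ : g e' = .inl ⟨e', he'⟩ := dif_pos he'
      rw [he₂] at hee
      simpa using hee
    · have he₂ : g e' = .inr _ := dif_neg he'
      rw [he₂] at hee
      cases hee
  all_goals
    simp only [Function.comp_apply, ne_eq, φ.injective.eq_iff, gab, gbc, gcd, gda]
    simp

/-- If two opposite trees are trivial and the two others are paths starting on the square, some
two vertices are at distance `m - 2`. -/
lemma exists_forall_le_length (h : G.IsUnicyclicSquare a b c d)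
    (ha : ((G.deleteEdges (squareEdges a b c d)).rootedLeaves a).ncard = 0)
    (hc : ((G.deleteEdges (squareEdges a b c d)).rootedLeaves c).ncard = 0)
    (hb : ((G.deleteEdges (squareEdges a b c d)).rootedLeaves b).ncard ≤ 1)
    (hd : ((G.deleteEdges (squareEdges a b c d)).rootedLeaves d).ncard ≤ 1) :
    ∃ x y, ∀ p : G.Walk x y, G.edgeSet.ncard - 2 ≤ p.length := by
  classical
  set H := G.deleteEdges (squareEdges a b c d) with hH
  have hacyc : H.IsAcyclic := h.isAcyclic
  obtain ⟨x, hx, hxB⟩ := hacyc.exists_ncard_le_dist_add_one hb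
  obtain ⟨y, hy, hyD⟩ := hacyc.exists_ncard_le_dist_add_one hd
  refine ⟨x, y, fun p => ?_⟩
  have hba : ¬ H.Reachable b a := h.not_reachable_of_ne (by simp) (by simp) h.ab.ne'
  have hbc : ¬ H.Reachable b c := h.not_reachable_of_ne (by simp) (by simp) h.bc.ne
  have hbd : ¬ H.Reachable b d := h.not_reachable_of_ne (by simp) (by simp) h.bd
  have hda : ¬ H.Reachable d a := h.not_reachable_of_ne (by simp) (by simp) h.da.ne
  have hdc : ¬ H.Reachable d c := h.not_reachable_of_ne (by simp) (by simp) h.cd.ne'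
  have hsep : ∀ {z}, H.Reachable b z → ¬ H.Reachable d z := fun h₁ h₂ => hbd (h₁.trans h₂.symm)
  have hcover : Fintype.card V ≤
      {z | H.Reachable b z}.ncard + {z | H.Reachable d z}.ncard + 2 := by
    have huniv : (Set.univ : Set V) ⊆
        ({z | H.Reachable b z} ∪ {z | H.Reachable d z}) ∪ {a, c} := by
      intro z _
      obtain ⟨t, rfl | rfl | rfl | rfl, hz⟩ := h.exists_reachable z
      · exact .inr (.inl (hacyc.eq_root_of_rootedLeaves_eq_empty ha hz))
      · exact .inl (.inl hz)
      · exact .inr (.inr (hacyc.eq_root_of_rootedLeaves_eq_empty hc hz))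
      · exact .inl (.inr hz)
    have h₁ := Set.ncard_le_ncard huniv (Set.toFinite _)
    have h₂ := Set.ncard_union_le ({z | H.Reachable b z} ∪ {z | H.Reachable d z}) {a, c}
    have h₃ := Set.ncard_union_le {z | H.Reachable b z} {z | H.Reachable d z}
    rw [Set.ncard_pair h.ac] at h₂
    rw [Set.ncard_univ, Nat.card_eq_fintype_card] at h₁
    omega
  let φ : V → ℤ := fun z =>
    if H.Reachable b z then -(H.dist b z : ℤ) else if H.Reachable d z then 2 + H.dist d z else 1
  have hφb : ∀ {z}, H.Reachable b z → φ z = -(H.dist b z : ℤ) := fun hz => if_pos hz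
  have hφd : ∀ {z}, H.Reachable d z → φ z = 2 + (H.dist d z : ℤ) := fun hz => by
    simp [φ, hz, show ¬ H.Reachable b _ from fun h₁ => hsep h₁ hz]
  have hφ : ∀ {z}, ¬ H.Reachable b z → ¬ H.Reachable d z → φ z = 1 := fun h₁ h₂ => by
    simp [φ, h₁, h₂]
  have φa : φ a = 1 := hφ hba hda
  have φb : φ b = 0 := by simp [hφb Reachable.rfl]
  have φc : φ c = 1 := hφ hbc hdc
  have φd : φ d = 2 := by simp [hφd Reachable.rfl]
  have hstep : ∀ {u w : V}, G.Adj u w → φ w ≤ φ u + 1 := by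
    intro u w huw
    by_cases hmem : s(u, w) ∈ squareEdges a b c d
    · simp only [squareEdges, Set.mem_insert_iff, Set.mem_singleton_iff, Sym2.eq_iff] at hmem
      rcases hmem with (⟨rfl, rfl⟩ | ⟨rfl, rfl⟩) | (⟨rfl, rfl⟩ | ⟨rfl, rfl⟩) |
        (⟨rfl, rfl⟩ | ⟨rfl, rfl⟩) | (⟨rfl, rfl⟩ | ⟨rfl, rfl⟩) <;> omega
    · have hadj : H.Adj u w := deleteEdges_adj.2 ⟨huw, hmem⟩
      by_cases hbu : H.Reachable b u
      · rw [hφb hbu, hφb (hbu.trans hadj.reachable)]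
        have := hadj.diff_dist_adj (u := b)
        omega
      have hbw : ¬ H.Reachable b w := fun h' => hbu (h'.trans hadj.symm.reachable)
      by_cases hdu : H.Reachable d u
      · rw [hφd hdu, hφd (hdu.trans hadj.reachable)]
        have := hadj.diff_dist_adj (u := d)
        omega
      have hdw : ¬ H.Reachable d w := fun h' => hdu (h'.trans hadj.symm.reachable)
      rw [hφ hbu hdu, hφ hbw hdw]
      omega
  have hwalk : ∀ {u w : V} (q : G.Walk u w), φ w ≤ φ u + q.length := by
    intro u w q
    induction q with
    | nil => simp
    | cons huw _ ih =>
      have := hstep huw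
      rw [Walk.length_cons]
      push_cast
      omega
  have hp := hwalk p
  rw [hφb hx, hφd hy] at hp
  rw [h.ncard_edgeSet]
  omega

/-- The rainbow connection number of a unicyclic graph of girth 4 with two opposite trivial trees
whose other two trees are paths starting on the square. -/
theorem rc_eq (h : G.IsUnicyclicSquare a b c d)
    (ha : ((G.deleteEdges (squareEdges a b c d)).rootedLeaves a).ncard = 0)
    (hc : ((G.deleteEdges (squareEdges a b c d)).rootedLeaves c).ncard = 0)
    (hb : ((G.deleteEdges (squareEdges a b c d)).rootedLeaves b).ncard ≤ 1)
    (hd : ((G.deleteEdges (squareEdges a b c d)).rootedLeaves d).ncard ≤ 1) :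
    rc G = G.edgeSet.ncard - 2 := by
  refine le_antisymm (Nat.sInf_le h.exists_isRainbowConnected)
    (le_csInf ⟨_, h.exists_isRainbowConnected⟩ ?_)
  rintro k ⟨f, hf⟩
  obtain ⟨x, y, hxy⟩ := h.exists_forall_le_length ha hc hb hd
  obtain ⟨p, -, hp⟩ := hf x y
  have hk := hp.length_le_card
  rw [List.length_map, Walk.length_edges, Fintype.card_fin] at hk
  exact (hxy p).trans hk

end IsUnicyclicSquare

end SimpleGraph

open SimpleGraph in
lemma cycleEdges_eq_squareEdges {V : Type*} (v : ZMod 4 → V) (i : ZMod 4) :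
    cycleEdges v = squareEdges (v i) (v (i + 1)) (v (i + 2)) (v (i + 3)) := by
  have hcover : ∀ i j : ZMod 4, j = i ∨ j = i + 1 ∨ j = i + 2 ∨ j = i + 3 := by decide
  have h₁ : i + 1 + 1 = i + 2 := by ring
  have h₂ : i + 2 + 1 = i + 3 := by ring
  have h₃ : i + 3 + 1 = i := by
    rw [add_assoc, show (3 + 1 : ZMod 4) = 0 by decide, add_zero]
  ext e
  simp only [cycleEdges, squareEdges, Set.mem_ofPred_eq, Set.mem_insert_iff,
    Set.mem_singleton_iff]
  constructor
  · rintro ⟨j, rfl⟩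
    rcases hcover i j with rfl | rfl | rfl | rfl
    · exact .inl rfl
    · exact .inr (.inl (by rw [h₁]))
    · exact .inr (.inr (.inl (by rw [h₂])))
    · exact .inr (.inr (.inr (by rw [h₃])))
  · rintro (rfl | rfl | rfl | rfl)
    · exact ⟨i, rfl⟩
    · exact ⟨i + 1, by rw [h₁]⟩
    · exact ⟨i + 2, by rw [h₂]⟩
    · exact ⟨i + 3, by rw [h₃]⟩

/-- Let `G` be a connected unicyclic graph with m edges whose unique
cycle `v₁v₂v₃v₄v₁` has length 4. If for some index `i` (mod 4),
`l(vᵢ) = l(v_{i+2}) = 0`, `l(v_{i+1}) ≤ 1` and `l(v_{i+3}) ≤ 1`, then rc(G) = m − 2. -/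
theorem stmt_10 {V : Type*} [Fintype V] (G : SimpleGraph V)
    (hconn : G.Connected) (huni : G.edgeSet.ncard = Fintype.card V)
    (v : ZMod 4 → V) (hinj : Function.Injective v)
    (hadj : ∀ i : ZMod 4, G.Adj (v i) (v (i + 1)))
    (hl : ∃ i : ZMod 4, numLeaves G v i = 0 ∧ numLeaves G v (i + 2) = 0 ∧
      numLeaves G v (i + 1) ≤ 1 ∧ numLeaves G v (i + 3) ≤ 1) :
    rc G = G.edgeSet.ncard - 2 := by
  obtain ⟨i, hi, hi₂, hi₁, hi₃⟩ := hl
  have hshift : ∀ j k : ZMod 4, v (i + j) = v (i + k) → j = k :=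
    fun j k h => add_left_cancel (hinj h)
  have hsq : G.IsUnicyclicSquare (v i) (v (i + 1)) (v (i + 2)) (v (i + 3)) := by
    refine ⟨hconn, huni, hadj i, ?_, ?_, ?_, ?_, ?_⟩
    · have := hadj (i + 1)
      rwa [add_assoc, show (1 + 1 : ZMod 4) = 2 by decide] at this
    · have := hadj (i + 2)
      rwa [add_assoc, show (2 + 1 : ZMod 4) = 3 by decide] at this
    · have := hadj (i + 3)
      rwa [add_assoc, show (3 + 1 : ZMod 4) = 0 by decide, add_zero] at this
    · intro h
      exact absurd (hshift 0 2 (by rwa [add_zero])) (by decide)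
    · intro h
      exact absurd (hshift 1 3 h) (by decide)
  simp only [numLeaves, cycleEdges_eq_squareEdges v i] at hi hi₁ hi₂ hi₃
  exact hsq.rc_eq hi hi₂ hi₁ hi₃
end
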